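/- There exists β₀ > 0 such that for all β < β₀ the following holds. Let k₁ ≥ 4 and k₂,…,k_n be natural numbers, and let m′, m″ be replica indices with m′ ∉ {1(1),2(1)} and m″ ∉ {1(0),2(0)}. Then ν((R_{1(1),m′} − R_{2(1),m′}) S₁^{k₁−3} ∏_{l=2}^n S_l^{k_l}) = (k₁ − 3)·ν((R_{1(0),m″} − R_{2(0),m″}) S₀ S₁^{k₁−4} ∏_{l=2}^n S_l^{k_l}) + O(N^{-1}), where the O(N^{-1}) constant depends only on β₀, n and k₁+⋯+k_n, not on N. -/

import Mathlib

open MeasureTheory ProbabilityTheory Finset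

noncomputable section

/-- A spin configuration on `N` sites. -/
abbrev Cfg (N : ℕ) := Fin N → Bool

/-- The spin value `±1` of a Boolean. -/
def spin (b : Bool) : ℝ := if b then 1 else -1

/-- Minus the SK Hamiltonian. -/
def negH (N : ℕ) (β h : ℝ) (g : Fin N → Fin N → ℝ) (σ : Cfg N) : ℝ :=
  (β / Real.sqrt N) *
      ∑ i : Fin N, ∑ j : Fin N, (if i < j then g i j * spin (σ i) * spin (σ j) else 0) +
    h * ∑ i : Fin N, spin (σ i)

/-- Gibbs average `⟨f⟩` of a function of `ι`-indexed replicas. -/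
def gibbs (N : ℕ) (β h : ℝ) (g : Fin N → Fin N → ℝ) {ι : Type} [DecidableEq ι] [Fintype ι]
    (f : (ι → Cfg N) → ℝ) : ℝ :=
  (∑ σs : ι → Cfg N, f σs * ∏ l, Real.exp (negH N β h g (σs l))) /
    (∑ σ : Cfg N, Real.exp (negH N β h g σ)) ^ (Fintype.card ι)

/-- The law of the disorder: i.i.d. standard Gaussians. -/
def gaussN (N : ℕ) : Measure (Fin N → Fin N → ℝ) :=
  Measure.pi fun _ => Measure.pi fun _ => gaussianReal 0 1

/-- `ν(f) = E⟨f⟩`. -/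
def nu (N : ℕ) (β h : ℝ) {ι : Type} [DecidableEq ι] [Fintype ι]
    (f : (ι → Cfg N) → ℝ) : ℝ :=
  ∫ g, gibbs N β h g f ∂ gaussN N

/-- `S_l = Σ_i t_i (σ_i^{1(l)} - σ_i^{2(l)})`, replica pairs indexed by `Fin m × Fin 2`. -/
def Sbar (N m : ℕ) (t : Fin N → ℝ) (σs : Fin m × Fin 2 → Cfg N) (l : Fin m) : ℝ :=
  ∑ i, t i * (spin (σs (l, 0) i) - spin (σs (l, 1) i))

/-- `a(k)`: the `k`-th moment of a standard Gaussian. -/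
def gaussMoment (k : ℕ) : ℝ := ∫ x, x ^ k ∂ (gaussianReal 0 1 : Measure ℝ)

/-- The overlap `R_{l,l'}` of two configurations. -/
def overlap (N : ℕ) (σ τ : Cfg N) : ℝ := (∑ i, spin (σ i) * spin (τ i)) / N

/-- Replica indices: pairs `(1(l), 2(l))` for `l = 0,…,m-1` plus `r` extra replicas. -/
abbrev RepIx (m r : ℕ) := (Fin m × Fin 2) ⊕ Fin r

/-- `S_l = Σ_i t_i (σ_i^{1(l)} − σ_i^{2(l)})` for the `l`-th replica pair. -/
def SbarS (N m r : ℕ) (t : Fin N → ℝ) (σs : RepIx m r → Cfg N) (l : Fin m) : ℝ :=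
  ∑ i, t i * (spin (σs (Sum.inl (l, 0)) i) - spin (σs (Sum.inl (l, 1)) i))

set_option linter.unusedSectionVars false

section Proof

open Asymptotics

/-- The Gibbs weight of a configuration for the (minus) Hamiltonian `H`. -/
def gibbsWeight {C : Type} [Fintype C] (H : C → ℝ) (σ : C) : ℝ :=
  Real.exp (H σ) / ∑ τ, Real.exp (H τ)

/-- The Gibbs average of a function of `ι`-indexed replicas for the (minus) Hamiltonian `H`. -/
def gibbsAvg {C ι : Type} [Fintype C] [Fintype ι] [DecidableEq ι] (H : C → ℝ)
    (f : (ι → C) → ℝ) : ℝ :=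
  ∑ σs : ι → C, f σs * ∏ l, gibbsWeight H (σs l)

/-- The replica derivative of `f` in the direction `c`. It lives on one more replica. -/
def repDeriv {C ι : Type} [Fintype ι] (c : C → ℝ) (f : (ι → C) → ℝ) (σs : Option ι → C) : ℝ :=
  f (fun l => σs (some l)) * (∑ l : ι, c (σs (some l)) - Fintype.card ι * c (σs none))

section GibbsAvg

variable {C ι ι' : Type} [Fintype C] [Nonempty C] [Fintype ι] [DecidableEq ι] [Fintype ι']
  [DecidableEq ι']

theorem partition_pos (H : C → ℝ) : 0 < ∑ τ, Real.exp (H τ) :=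
  Finset.sum_pos (fun _ _ => Real.exp_pos _) Finset.univ_nonempty

theorem gibbsWeight_nonneg (H : C → ℝ) (σ : C) : 0 ≤ gibbsWeight H σ :=
  div_nonneg (Real.exp_pos _).le (partition_pos H).le

theorem sum_gibbsWeight (H : C → ℝ) : ∑ σ, gibbsWeight H σ = 1 := by
  unfold gibbsWeight
  rw [← Finset.sum_div, div_self (partition_pos H).ne']

theorem sum_prod_gibbsWeight (H : C → ℝ) :
    ∑ σs : ι → C, ∏ l, gibbsWeight H (σs l) = 1 := by
  have h := Finset.prod_univ_sum (fun _ : ι => (Finset.univ : Finset C))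
    (fun _ σ => gibbsWeight H σ)
  rw [Fintype.piFinset_univ] at h
  rw [← h]
  simp [sum_gibbsWeight]

theorem gibbsAvg_add (H : C → ℝ) (f g : (ι → C) → ℝ) :
    gibbsAvg H (fun σs => f σs + g σs) = gibbsAvg H f + gibbsAvg H g := by
  simp [gibbsAvg, add_mul, Finset.sum_add_distrib]

theorem gibbsAvg_const_mul (H : C → ℝ) (a : ℝ) (f : (ι → C) → ℝ) :
    gibbsAvg H (fun σs => a * f σs) = a * gibbsAvg H f := by
  simp [gibbsAvg, Finset.mul_sum, mul_assoc]

theorem gibbsAvg_sum {κ : Type*} (H : C → ℝ) (s : Finset κ) (f : κ → (ι → C) → ℝ) :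
    gibbsAvg H (fun σs => ∑ k ∈ s, f k σs) = ∑ k ∈ s, gibbsAvg H (f k) := by
  simp only [gibbsAvg, Finset.sum_mul]
  rw [Finset.sum_comm]

theorem gibbsAvg_const (H : C → ℝ) (a : ℝ) :
    gibbsAvg H (fun _ : ι → C => a) = a := by
  simp [gibbsAvg, ← Finset.mul_sum, sum_prod_gibbsWeight]

theorem gibbsAvg_mono (H : C → ℝ) {f g : (ι → C) → ℝ} (h : ∀ σs, f σs ≤ g σs) :
    gibbsAvg H f ≤ gibbsAvg H g :=
  Finset.sum_le_sum fun σs _ => mul_le_mul_of_nonneg_right (h σs)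
    (Finset.prod_nonneg fun _ _ => gibbsWeight_nonneg _ _)

theorem abs_gibbsAvg_le (H : C → ℝ) (f : (ι → C) → ℝ) :
    |gibbsAvg H f| ≤ gibbsAvg H (fun σs => |f σs|) := by
  refine (Finset.abs_sum_le_sum_abs _ _).trans (le_of_eq ?_)
  refine Finset.sum_congr rfl fun σs _ => ?_
  rw [abs_mul, abs_of_nonneg (Finset.prod_nonneg fun _ _ => gibbsWeight_nonneg _ _)]

theorem abs_gibbsAvg_le_const (H : C → ℝ) {f : (ι → C) → ℝ} {B : ℝ} (h : ∀ σs, |f σs| ≤ B) :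
    |gibbsAvg H f| ≤ B :=
  (abs_gibbsAvg_le H f).trans ((gibbsAvg_mono H h).trans (gibbsAvg_const H B).le)

theorem exists_abs_bound (f : (ι → C) → ℝ) : ∃ B, 0 ≤ B ∧ ∀ σs, |f σs| ≤ B :=
  ⟨∑ σs, |f σs|, Finset.sum_nonneg fun _ _ => abs_nonneg _, fun σs =>
    Finset.single_le_sum (f := fun σs => |f σs|) (fun _ _ => abs_nonneg _) (Finset.mem_univ σs)⟩

theorem gibbsAvg_comp_equiv (H : C → ℝ) (e : ι' ≃ ι) (f : (ι' → C) → ℝ) :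
    gibbsAvg H (fun σs : ι → C => f (fun l => σs (e l))) = gibbsAvg H f := by
  refine Fintype.sum_equiv (Equiv.arrowCongr e.symm (Equiv.refl C)) _ _ fun σs => ?_
  have : ∏ l, gibbsWeight H (σs l) = ∏ l, gibbsWeight H (σs (e l)) :=
    (Equiv.prod_comp e (fun l => gibbsWeight H (σs l))).symm
  rw [this]
  rfl

theorem gibbsAvg_comp_inl (H : C → ℝ) (f : (ι → C) → ℝ) :
    gibbsAvg H (fun σs : ι ⊕ ι' → C => f (fun l => σs (Sum.inl l))) = gibbsAvg H f := by
  unfold gibbsAvg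
  rw [Fintype.sum_equiv (Equiv.sumArrowEquivProdArrow ι ι' C) _
    (fun p : (ι → C) × (ι' → C) =>
      f p.1 * ((∏ l, gibbsWeight H (p.1 l)) * ∏ l, gibbsWeight H (p.2 l)))
    (fun σs => by rw [Fintype.prod_sum_type]; rfl), Fintype.sum_prod_type]
  refine Finset.sum_congr rfl fun σs _ => ?_
  simp only [← mul_assoc]
  rw [← Finset.mul_sum, sum_prod_gibbsWeight, mul_one]

/-- Gibbs averages only depend on the replicas which are used. -/
theorem gibbsAvg_comp_injective (H : C → ℝ) {e : ι' → ι} (he : Function.Injective e)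
    (f : (ι' → C) → ℝ) :
    gibbsAvg H (fun σs : ι → C => f (fun l => σs (e l))) = gibbsAvg H f := by
  classical
  let E : ι' ⊕ {x // ¬ x ∈ Set.range e} ≃ ι :=
    (Equiv.sumCongr (Equiv.ofInjective e he) (Equiv.refl _)).trans (Equiv.sumCompl _)
  have h := gibbsAvg_comp_equiv H E
    (fun σs : ι' ⊕ {x // ¬ x ∈ Set.range e} → C => f (fun l => σs (Sum.inl l)))
  rw [gibbsAvg_comp_inl] at h
  rw [← h]
  rfl

theorem hasDerivAt_gibbsWeight {H : ℝ → C → ℝ} {c : C → ℝ} {x : ℝ}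
    (hH : ∀ σ, HasDerivAt (fun y => H y σ) (c σ) x) (σ : C) :
    HasDerivAt (fun y => gibbsWeight (H y) σ)
      (gibbsWeight (H x) σ * (c σ - ∑ τ, c τ * gibbsWeight (H x) τ)) x := by
  have h1 : HasDerivAt (fun y => ∑ τ, Real.exp (H y τ)) (∑ τ, Real.exp (H x τ) * c τ) x :=
    HasDerivAt.fun_sum fun τ _ => (hH τ).exp
  have h2 := ((hH σ).exp).div h1 (partition_pos (H x)).ne'
  convert! h2 using 1
  have hZ := (partition_pos (H x)).ne'
  have h3 : ∑ τ, c τ * gibbsWeight (H x) τ =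
      (∑ τ, Real.exp (H x τ) * c τ) / ∑ τ, Real.exp (H x τ) := by
    rw [Finset.sum_div]
    exact Finset.sum_congr rfl fun τ _ => by unfold gibbsWeight; ring
  rw [h3]
  unfold gibbsWeight
  field_simp

theorem gibbsAvg_repDeriv (H : C → ℝ) (c : C → ℝ) (f : (ι → C) → ℝ) :
    gibbsAvg H (repDeriv c f) =
      ∑ σs : ι → C, f σs * ((∏ l, gibbsWeight H (σs l)) *
        ∑ l : ι, (c (σs l) - ∑ τ, c τ * gibbsWeight H τ)) := by
  unfold gibbsAvg repDeriv
  rw [Fintype.sum_equiv (Equiv.piOptionEquivProd (β := fun _ : Option ι => C)) _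
    (fun p : C × (ι → C) =>
      f p.2 * (∑ l : ι, c (p.2 l) - Fintype.card ι * c p.1) *
        (gibbsWeight H p.1 * ∏ l, gibbsWeight H (p.2 l)))
    (fun σs => by rw [Fintype.prod_option]; rfl), Fintype.sum_prod_type_right]
  refine Finset.sum_congr rfl fun σs _ => ?_
  have h : ∀ τ : C, f σs * (∑ l : ι, c (σs l) - Fintype.card ι * c τ) *
      (gibbsWeight H τ * ∏ l, gibbsWeight H (σs l)) =
      (f σs * (∑ l : ι, c (σs l)) * ∏ l, gibbsWeight H (σs l)) * gibbsWeight H τ -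
      (f σs * Fintype.card ι * ∏ l, gibbsWeight H (σs l)) * (c τ * gibbsWeight H τ) :=
    fun τ => by ring
  simp only [h]
  rw [Finset.sum_sub_distrib, ← Finset.mul_sum, ← Finset.mul_sum, sum_gibbsWeight,
    Finset.sum_sub_distrib]
  simp only [Finset.sum_const, Finset.card_univ, nsmul_eq_mul]
  ring

theorem hasDerivAt_gibbsAvg {H : ℝ → C → ℝ} {c : C → ℝ} {x : ℝ}
    (hH : ∀ σ, HasDerivAt (fun y => H y σ) (c σ) x) (f : (ι → C) → ℝ) :
    HasDerivAt (fun y => gibbsAvg (H y) f) (gibbsAvg (H x) (repDeriv c f)) x := by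
  rw [gibbsAvg_repDeriv]
  unfold gibbsAvg
  refine HasDerivAt.fun_sum fun σs _ => HasDerivAt.const_mul _ ?_
  have h := HasDerivAt.fun_finsetProd (u := Finset.univ)
    (fun (l : ι) _ => hasDerivAt_gibbsWeight hH (σs l))
  convert! h using 1
  rw [Finset.mul_sum]
  refine Finset.sum_congr rfl fun l _ => ?_
  rw [← Finset.mul_prod_erase Finset.univ _ (Finset.mem_univ l), smul_eq_mul]
  ring

end GibbsAvg

theorem gibbs_eq_gibbsAvg (N : ℕ) (β h : ℝ) (g : Fin N → Fin N → ℝ) {ι : Type} [DecidableEq ι]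
    [Fintype ι] (f : (ι → Cfg N) → ℝ) : gibbs N β h g f = gibbsAvg (negH N β h g) f := by
  unfold gibbs gibbsAvg gibbsWeight
  rw [Finset.sum_div]
  refine Finset.sum_congr rfl fun σs _ => ?_
  rw [Finset.prod_div_distrib, Finset.prod_const, Finset.card_univ, mul_div_assoc]

theorem hasDerivAt_gaussianPDFReal_std (x : ℝ) :
    HasDerivAt (gaussianPDFReal 0 1) (-(x * gaussianPDFReal 0 1 x)) x := by
  have h : HasDerivAt (fun y : ℝ => -(y - 0) ^ 2 / (2 * ((1 : NNReal) : ℝ))) (-x) x := by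
    have := (((hasDerivAt_id x).sub_const 0).pow 2).neg.div_const (2 * ((1 : NNReal) : ℝ))
    convert! this using 1
    norm_num
    ring
  have := (h.exp).const_mul (√(2 * Real.pi * ((1 : NNReal) : ℝ)))⁻¹
  rw [gaussianPDFReal_def]
  convert! this using 1
  ring

/-- Gaussian integration by parts in dimension one. -/
theorem gaussianReal_integral_mul_eq {φ φ' : ℝ → ℝ} {B B' : ℝ}
    (hφ : ∀ y, HasDerivAt φ (φ' y) y) (hB : ∀ y, |φ y| ≤ B) (hB' : ∀ y, |φ' y| ≤ B') :
    ∫ y, y * φ y ∂gaussianReal 0 1 = ∫ y, φ' y ∂gaussianReal 0 1 := by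
  have hcont : Continuous φ := continuous_iff_continuousAt.2 fun y => (hφ y).continuousAt
  have hd : φ' = deriv φ := funext fun y => (hφ y).deriv.symm
  have hmeas : Measurable φ' := hd ▸ measurable_deriv φ
  have hpdf := integrable_gaussianPDFReal 0 1
  have hid : Integrable (fun y : ℝ => y) (gaussianReal 0 1) :=
    (memLp_id_gaussianReal 1).integrable le_rfl
  have hidpdf : Integrable (fun y : ℝ => -(y * gaussianPDFReal 0 1 y)) := by
    rw [gaussianReal_of_var_ne_zero _ one_ne_zero,
      integrable_withDensity_iff_integrable_smul' (measurable_gaussianPDF _ _)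
        (ae_of_all _ fun _ => gaussianPDF_lt_top)] at hid
    refine hid.neg.congr (ae_of_all _ fun y => ?_)
    simp [toReal_gaussianPDF, mul_comm]
  have key := integral_mul_deriv_eq_deriv_mul_of_integrable (u := φ) (u' := φ')
    (v := gaussianPDFReal 0 1) (v' := fun y => -(y * gaussianPDFReal 0 1 y))
    (fun y _ => hφ y) (fun y _ => hasDerivAt_gaussianPDFReal_std y)
    (hidpdf.bdd_mul hcont.aestronglyMeasurable (ae_of_all _ hB))
    (hpdf.bdd_mul hmeas.aestronglyMeasurable (ae_of_all _ hB'))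
    (hpdf.bdd_mul hcont.aestronglyMeasurable (ae_of_all _ hB))
  rw [integral_gaussianReal_eq_integral_smul one_ne_zero,
    integral_gaussianReal_eq_integral_smul one_ne_zero]
  have h1 : ∫ y, φ y * -(y * gaussianPDFReal 0 1 y) =
      - ∫ y, gaussianPDFReal 0 1 y • (y * φ y) := by
    rw [← integral_neg]
    exact integral_congr_ae (ae_of_all _ fun y => by simp only [smul_eq_mul]; ring)
  have h2 : ∫ y, φ' y * gaussianPDFReal 0 1 y = ∫ y, gaussianPDFReal 0 1 y • φ' y :=
    integral_congr_ae (ae_of_all _ fun y => by simp only [smul_eq_mul]; ring)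
  rw [h1, h2] at key
  linarith

/-- The standard Gaussian measure on `J → ℝ`. -/
def stdGauss (J : Type) [Fintype J] : Measure (J → ℝ) := Measure.pi fun _ => gaussianReal 0 1

section StdGauss

variable {J : Type} [Fintype J] [DecidableEq J]

instance : IsProbabilityMeasure (stdGauss J) := by unfold stdGauss; infer_instance

theorem measurePreserving_update (j : J) :
    MeasurePreserving (fun p : (J → ℝ) × ℝ => Function.update p.1 j p.2)
      ((stdGauss J).prod (gaussianReal 0 1)) (stdGauss J) := by
  have hm : Measurable (fun p : (J → ℝ) × ℝ => Function.update p.1 j p.2) := by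
    refine measurable_pi_iff.2 fun k => ?_
    by_cases hk : k = j
    · subst hk; simpa using measurable_snd
    · simp only [Function.update_of_ne hk]
      exact (measurable_pi_apply k).comp measurable_fst
  refine ⟨hm, ?_⟩
  symm
  refine Measure.pi_eq fun s hs => ?_
  rw [Measure.map_apply hm (MeasurableSet.univ_pi hs)]
  have : (fun p : (J → ℝ) × ℝ => Function.update p.1 j p.2) ⁻¹' (Set.univ.pi s) =
      (Set.univ.pi (Function.update s j Set.univ)) ×ˢ (s j) := by
    ext ⟨x, y⟩
    simp only [Set.mem_preimage, Set.mem_pi, Set.mem_univ, true_implies, Set.mem_prod]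
    constructor
    · intro h
      refine ⟨fun k => ?_, by simpa using h j⟩
      by_cases hk : k = j
      · subst hk; simp
      · simpa [Function.update_of_ne hk] using h k
    · rintro ⟨h1, h2⟩ k
      by_cases hk : k = j
      · subst hk; simpa using h2
      · simpa [Function.update_of_ne hk] using h1 k
  rw [this, Measure.prod_prod, stdGauss, Measure.pi_pi,
    ← Finset.mul_prod_erase Finset.univ _ (Finset.mem_univ j),
    ← Finset.mul_prod_erase Finset.univ (fun k => gaussianReal 0 1 (s k)) (Finset.mem_univ j)]
  simp only [Function.update_self, measure_univ, one_mul]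
  rw [mul_comm]
  congr 1
  refine Finset.prod_congr rfl fun k hk => ?_
  rw [Function.update_of_ne (Finset.ne_of_mem_erase hk)]

theorem integrable_coord (j : J) : Integrable (fun x : J → ℝ => x j) (stdGauss J) := by
  have hid : Integrable (fun y : ℝ => y) (gaussianReal 0 1) :=
    (memLp_id_gaussianReal 1).integrable le_rfl
  exact (measurePreserving_eval (fun _ : J => gaussianReal 0 1) j).integrable_comp_of_integrable hid

/-- Gaussian integration by parts for one coordinate of a standard Gaussian vector. -/
theorem stdGauss_integral_mul_eq (j : J) {Φ Φ' : (J → ℝ) → ℝ} {B B' : ℝ}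
    (hΦ : ∀ x y, HasDerivAt (fun y => Φ (Function.update x j y)) (Φ' (Function.update x j y)) y)
    (hB : ∀ x, |Φ x| ≤ B) (hB' : ∀ x, |Φ' x| ≤ B') (hm : Measurable Φ) (hm' : Measurable Φ') :
    ∫ x, x j * Φ x ∂stdGauss J = ∫ x, Φ' x ∂stdGauss J := by
  have hp := measurePreserving_update (J := J) j
  have hi' : Integrable Φ' (stdGauss J) :=
    (integrable_const B').mono' hm'.aestronglyMeasurable (ae_of_all _ hB')
  have hi : Integrable (fun x => x j * Φ x) (stdGauss J) :=
    (integrable_coord j).mul_bdd hm.aestronglyMeasurable (ae_of_all _ hB)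
  have e : ∀ F : (J → ℝ) → ℝ, Integrable F (stdGauss J) → ∫ x, F x ∂stdGauss J =
      ∫ x, ∫ y, F (Function.update x j y) ∂gaussianReal 0 1 ∂stdGauss J := by
    intro F hF
    have hF' : AEStronglyMeasurable F (Measure.map
        (fun p : (J → ℝ) × ℝ => Function.update p.1 j p.2)
          ((stdGauss J).prod (gaussianReal 0 1))) := by
      rw [hp.map_eq]; exact hF.aestronglyMeasurable
    have h1 := integral_prod _ (hp.integrable_comp_of_integrable hF)
    have h2 := integral_map hp.measurable.aemeasurable hF'
    rw [hp.map_eq] at h2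
    rw [h2]
    exact h1
  rw [e _ hi, e _ hi']
  refine integral_congr_ae (ae_of_all _ fun x => ?_)
  have := gaussianReal_integral_mul_eq (hΦ x) (fun y => hB _) (fun y => hB' _)
  simpa using this

variable {C ι : Type} [Fintype C] [Nonempty C] [Fintype ι] [DecidableEq ι]

/-- The Hamiltonian which is linear in the Gaussian variables. -/
def linHam (c : J → C → ℝ) (d : C → ℝ) (x : J → ℝ) (σ : C) : ℝ := ∑ j, x j * c j σ + d σ

/-- Disorder average of the Gibbs average for a Hamiltonian linear in the disorder. -/
def gaussAvg (c : J → C → ℝ) (d : C → ℝ) (f : (ι → C) → ℝ) : ℝ :=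
  ∫ x, gibbsAvg (linHam c d x) f ∂stdGauss J

theorem continuous_gibbsAvg_linHam (c : J → C → ℝ) (d : C → ℝ) (f : (ι → C) → ℝ) :
    Continuous fun x => gibbsAvg (linHam c d x) f := by
  unfold gibbsAvg gibbsWeight
  refine continuous_finsetSum _ fun σs _ => continuous_const.mul
    (continuous_finsetProd _ fun l _ => ?_)
  refine Continuous.div ?_ ?_ fun x => (partition_pos _).ne'
  · unfold linHam; fun_prop
  · unfold linHam; fun_prop

theorem integrable_gibbsAvg_linHam (c : J → C → ℝ) (d : C → ℝ) (f : (ι → C) → ℝ) :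
    Integrable (fun x => gibbsAvg (linHam c d x) f) (stdGauss J) := by
  obtain ⟨B, -, hB⟩ := exists_abs_bound f
  exact (integrable_const B).mono' (continuous_gibbsAvg_linHam c d f).aestronglyMeasurable
    (ae_of_all _ fun x => abs_gibbsAvg_le_const _ hB)

theorem gaussAvg_ibp (c : J → C → ℝ) (d : C → ℝ) (f : (ι → C) → ℝ) (j : J) :
    ∫ x, x j * gibbsAvg (linHam c d x) f ∂stdGauss J = gaussAvg c d (repDeriv (c j) f) := by
  obtain ⟨B, -, hB⟩ := exists_abs_bound f
  obtain ⟨B', -, hB'⟩ := exists_abs_bound (repDeriv (c j) f)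
  refine stdGauss_integral_mul_eq j (fun x y => ?_) (fun x => abs_gibbsAvg_le_const _ hB)
    (fun x => abs_gibbsAvg_le_const _ hB') (continuous_gibbsAvg_linHam c d f).measurable
    (continuous_gibbsAvg_linHam c d _).measurable
  refine hasDerivAt_gibbsAvg (H := fun y => linHam c d (Function.update x j y)) (fun σ => ?_) f
  have h : (fun y => linHam c d (Function.update x j y) σ) =
      fun y => y * c j σ + (∑ k ∈ Finset.univ.erase j, x k * c k σ + d σ) := by
    funext y
    unfold linHam
    rw [← Finset.add_sum_erase Finset.univ _ (Finset.mem_univ j), Function.update_self, add_assoc]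
    congr 2
    refine Finset.sum_congr rfl fun k hk => ?_
    rw [Function.update_of_ne (Finset.ne_of_mem_erase hk)]
  rw [h]
  simpa using ((hasDerivAt_id y).mul_const (c j σ)).add_const
    (∑ k ∈ Finset.univ.erase j, x k * c k σ + d σ)

theorem gaussAvg_sum {κ : Type*} (c : J → C → ℝ) (d : C → ℝ) (s : Finset κ)
    (f : κ → (ι → C) → ℝ) :
    gaussAvg c d (fun σs => ∑ k ∈ s, f k σs) = ∑ k ∈ s, gaussAvg c d (f k) := by
  unfold gaussAvg
  simp only [gibbsAvg_sum]
  exact integral_finsetSum _ fun k _ => integrable_gibbsAvg_linHam _ _ _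

/-- The derivative of the disorder average along a path of covariances. -/
theorem hasDerivAt_gaussAvg {c c' : ℝ → J → C → ℝ} (d : C → ℝ) {B : ℝ}
    (hc : ∀ θ j σ, HasDerivAt (fun θ => c θ j σ) (c' θ j σ) θ) (hB : ∀ θ j σ, |c' θ j σ| ≤ B)
    (f : (ι → C) → ℝ) (θ : ℝ) :
    HasDerivAt (fun θ => gaussAvg (c θ) d f)
      (gaussAvg (c θ) d fun σs => ∑ j, repDeriv (c θ j) (repDeriv (c' θ j) f) σs) θ := by
  obtain ⟨Bf, hBf0, hBf⟩ := exists_abs_bound f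
  let n : ℝ := Fintype.card ι
  have hn : 0 ≤ n := Nat.cast_nonneg _
  have hbd : ∀ θ j σs, |repDeriv (c' θ j) f σs| ≤ Bf * (n * B + n * B) := by
    intro θ j σs
    unfold repDeriv
    rw [abs_mul]
    refine mul_le_mul (hBf _) ?_ (abs_nonneg _) hBf0
    refine (abs_sub _ _).trans (add_le_add ?_ ?_)
    · refine (Finset.abs_sum_le_sum_abs _ _).trans ?_
      refine (Finset.sum_le_sum fun l _ => hB θ j (σs (some l))).trans ?_
      simp [n]
    · rw [abs_mul, Nat.abs_cast]
      exact mul_le_mul_of_nonneg_left (hB _ _ _) hn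
  let F' : ℝ → (J → ℝ) → ℝ := fun θ x =>
    ∑ j, x j * gibbsAvg (linHam (c θ) d x) (repDeriv (c' θ j) f)
  have hder : ∀ x θ, HasDerivAt (fun θ => gibbsAvg (linHam (c θ) d x) f) (F' θ x) θ := by
    intro x θ
    have h := hasDerivAt_gibbsAvg (H := fun θ => linHam (c θ) d x)
      (c := fun σ => ∑ j, x j * c' θ j σ) (x := θ) (fun σ => by
        unfold linHam
        exact (HasDerivAt.fun_sum fun j _ => (hc θ j σ).const_mul (x j)).add_const _) f
    convert! h using 1
    simp only [F', ← gibbsAvg_const_mul, ← gibbsAvg_sum]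
    congr 1
    funext σs
    unfold repDeriv
    rw [Finset.sum_comm, Finset.mul_sum, ← Finset.sum_sub_distrib, Finset.mul_sum]
    refine Finset.sum_congr rfl fun j _ => ?_
    rw [← Finset.mul_sum]
    ring
  have hInt : ∀ j, Integrable (fun x => x j * gibbsAvg (linHam (c θ) d x) (repDeriv (c' θ j) f))
      (stdGauss J) := fun j =>
    (integrable_coord j).mul_bdd (continuous_gibbsAvg_linHam _ _ _).aestronglyMeasurable
      (ae_of_all _ fun x => abs_gibbsAvg_le_const _ (hbd θ j))
  have key := hasDerivAt_integral_of_dominated_loc_of_deriv_le (μ := stdGauss J)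
    (F := fun θ x => gibbsAvg (linHam (c θ) d x) f) (F' := F') (x₀ := θ) (s := Set.univ)
    (bound := fun x => ∑ j, |x j| * (Bf * (n * B + n * B))) Filter.univ_mem
    (Filter.Eventually.of_forall fun θ => (continuous_gibbsAvg_linHam _ _ _).aestronglyMeasurable)
    (integrable_gibbsAvg_linHam _ _ _)
    (integrable_finsetSum _ fun j _ => hInt j).aestronglyMeasurable
    (ae_of_all _ fun x θ _ => (Finset.abs_sum_le_sum_abs _ _).trans (Finset.sum_le_sum fun j _ => by
      rw [abs_mul]
      exact mul_le_mul_of_nonneg_left (abs_gibbsAvg_le_const _ (hbd θ j)) (abs_nonneg _)))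
    (integrable_finsetSum _ fun j _ => (integrable_coord j).abs.mul_const _)
    (ae_of_all _ fun x θ _ => hder x θ)
  have h2 := key.2
  rw [integral_finsetSum _ fun j _ => hInt j] at h2
  simp only [gaussAvg_ibp, ← gaussAvg_sum] at h2
  exact h2

end StdGauss

/-- The weights of the replicas in `repDeriv`. -/
def repWeight (ι : Type) [Fintype ι] (a : Option ι) : ℝ :=
  a.elim (-(Fintype.card ι : ℝ)) fun _ => 1

theorem sum_repWeight (ι : Type) [Fintype ι] : ∑ a, repWeight ι a = 0 := by
  simp [repWeight, Fintype.sum_option]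

theorem abs_repWeight_le (ι : Type) [Fintype ι] (a : Option ι) :
    |repWeight ι a| ≤ Fintype.card ι + 1 := by
  have : (0 : ℝ) ≤ Fintype.card ι := Nat.cast_nonneg _
  cases a <;> simp [repWeight]

theorem repDeriv_eq_sum {C ι : Type} [Fintype ι] (c : C → ℝ) (f : (ι → C) → ℝ)
    (σs : Option ι → C) :
    repDeriv c f σs = f (fun l => σs (some l)) * ∑ a, repWeight ι a * c (σs a) := by
  simp [repDeriv, repWeight, Fintype.sum_option]
  ring_nf
  simp

section Path

variable {C ι J : Type} [Fintype C] [Nonempty C] [Fintype ι] [DecidableEq ι] [Fintype J]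
  [DecidableEq J]

theorem sum_repDeriv_repDeriv (c c' : J → C → ℝ) {κ u0 : ℝ} {u : C → C → ℝ}
    (hU : ∀ σ τ, ∑ j, c' j σ * c j τ = κ * u σ τ) (hu : ∀ σ, u σ σ = u0) (f : (ι → C) → ℝ)
    (σs : Option (Option ι) → C) :
    ∑ j, repDeriv (c j) (repDeriv (c' j) f) σs =
      ∑ a : Option ι, ∑ b ∈ Finset.univ.erase (some a),
        κ * (repWeight ι a * repWeight (Option ι) b) *
          (f (fun l => σs (some (some l))) * u (σs (some a)) (σs b)) := by
  have h1 : ∀ j, repDeriv (c j) (repDeriv (c' j) f) σs = ∑ a : Option ι, ∑ b,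
      f (fun l => σs (some (some l))) * (repWeight ι a * repWeight (Option ι) b) *
        (c' j (σs (some a)) * c j (σs b)) := by
    intro j
    rw [repDeriv_eq_sum, repDeriv_eq_sum, mul_assoc, Finset.sum_mul_sum, Finset.mul_sum]
    refine Finset.sum_congr rfl fun a _ => ?_
    rw [Finset.mul_sum]
    exact Finset.sum_congr rfl fun b _ => by ring
  simp only [h1]
  rw [Finset.sum_comm]
  have h2 : ∀ a : Option ι, ∑ j, ∑ b,
      f (fun l => σs (some (some l))) * (repWeight ι a * repWeight (Option ι) b) *
        (c' j (σs (some a)) * c j (σs b)) =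
      repWeight ι a * (f (fun l => σs (some (some l))) * (κ * u0)) +
      ∑ b ∈ Finset.univ.erase (some a),
        κ * (repWeight ι a * repWeight (Option ι) b) *
          (f (fun l => σs (some (some l))) * u (σs (some a)) (σs b)) := by
    intro a
    rw [Finset.sum_comm]
    simp only [← Finset.mul_sum, hU]
    rw [← Finset.add_sum_erase Finset.univ _ (Finset.mem_univ (some a))]
    congr 1
    · rw [hu]; simp [repWeight]; ring
    · exact Finset.sum_congr rfl fun b _ => by ring
  simp only [h2]
  rw [Finset.sum_add_distrib, ← Finset.sum_mul, sum_repWeight, zero_mul, zero_add]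

theorem gaussAvg_const_mul (c : J → C → ℝ) (d : C → ℝ) (a : ℝ) (f : (ι → C) → ℝ) :
    gaussAvg c d (fun σs => a * f σs) = a * gaussAvg c d f := by
  unfold gaussAvg
  simp only [gibbsAvg_const_mul]
  exact integral_const_mul _ _

theorem hasDerivAt_gaussAvg_path {c c' : ℝ → J → C → ℝ} (d : C → ℝ) {B : ℝ}
    (hc : ∀ θ j σ, HasDerivAt (fun θ => c θ j σ) (c' θ j σ) θ) (hB : ∀ θ j σ, |c' θ j σ| ≤ B)
    {κ : ℝ → ℝ} {u0 : ℝ} {u : C → C → ℝ}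
    (hU : ∀ θ σ τ, ∑ j, c' θ j σ * c θ j τ = κ θ * u σ τ) (hu : ∀ σ, u σ σ = u0)
    (f : (ι → C) → ℝ) (θ : ℝ) :
    HasDerivAt (fun θ => gaussAvg (c θ) d f)
      (κ θ * ∑ a : Option ι, ∑ b ∈ Finset.univ.erase (some a),
        repWeight ι a * repWeight (Option ι) b *
          gaussAvg (c θ) d fun σs => f (fun l => σs (some (some l))) * u (σs (some a)) (σs b))
      θ := by
  have h := hasDerivAt_gaussAvg d hc hB f θ
  simp only [sum_repDeriv_repDeriv _ _ (hU θ) hu] at h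
  simp only [gaussAvg_sum, gaussAvg_const_mul] at h
  convert! h using 1
  rw [Finset.mul_sum]
  refine Finset.sum_congr rfl fun a _ => ?_
  rw [Finset.mul_sum]
  exact Finset.sum_congr rfl fun b _ => by ring

end Path

/-- Index set of the Gaussian variables: the couplings and one extra field. -/
abbrev DisorderIx (N : ℕ) := Option (Fin N × Fin N)

/-- Coefficients of the Gaussian variables along the cavity path at site `i`. -/
def cavCoeff (N : ℕ) (β q : ℝ) (i : Fin N) (θ : ℝ) (J : DisorderIx N) (σ : Cfg N) : ℝ :=
  J.elim (Real.cos θ * (β * √q * spin (σ i))) fun p =>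
    (if p.1 = i ∨ p.2 = i then Real.sin θ else 1) *
      (β / √N * if p.1 < p.2 then spin (σ p.1) * spin (σ p.2) else 0)

/-- Derivative of `cavCoeff` along the path. -/
def cavCoeffDeriv (N : ℕ) (β q : ℝ) (i : Fin N) (θ : ℝ) (J : DisorderIx N) (σ : Cfg N) : ℝ :=
  J.elim (-Real.sin θ * (β * √q * spin (σ i))) fun p =>
    (if p.1 = i ∨ p.2 = i then Real.cos θ else 0) *
      (β / √N * if p.1 < p.2 then spin (σ p.1) * spin (σ p.2) else 0)

/-- The external field. -/
def extField (N : ℕ) (h : ℝ) (σ : Cfg N) : ℝ := h * ∑ i, spin (σ i)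

/-- The averages along the cavity path at site `i`; `θ = π / 2` is the original system, and at
`θ = 0` the site `i` is decoupled. -/
def cav (N : ℕ) (β h q : ℝ) (i : Fin N) (θ : ℝ) {ι : Type} [DecidableEq ι] [Fintype ι]
    (f : (ι → Cfg N) → ℝ) : ℝ :=
  gaussAvg (cavCoeff N β q i θ) (extField N h) f

/-- The overlap without the site `i`. -/
def cavOverlap (N : ℕ) (i : Fin N) (σ τ : Cfg N) : ℝ :=
  (∑ j ∈ Finset.univ.erase i, spin (σ j) * spin (τ j)) / N

theorem spin_mul_self (b : Bool) : spin b * spin b = 1 := by cases b <;> simp [spin]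

theorem abs_spin (b : Bool) : |spin b| = 1 := by cases b <;> simp [spin]

theorem overlap_eq (N : ℕ) (i : Fin N) (σ τ : Cfg N) :
    overlap N σ τ = cavOverlap N i σ τ + spin (σ i) * spin (τ i) / N := by
  unfold overlap cavOverlap
  rw [← Finset.add_sum_erase Finset.univ _ (Finset.mem_univ i)]
  ring

theorem cavOverlap_comm (N : ℕ) (i : Fin N) (σ τ : Cfg N) :
    cavOverlap N i σ τ = cavOverlap N i τ σ := by
  simp [cavOverlap, mul_comm]

theorem measurePreserving_some (A : Type) [Fintype A] :
    MeasurePreserving (fun (x : Option A → ℝ) (a : A) => x (some a)) (stdGauss (Option A))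
      (stdGauss A) := by
  have hm : Measurable (fun (x : Option A → ℝ) (a : A) => x (some a)) :=
    measurable_pi_iff.2 fun a => measurable_pi_apply _
  refine ⟨hm, ?_⟩
  symm
  refine Measure.pi_eq fun s hs => ?_
  rw [Measure.map_apply hm (MeasurableSet.univ_pi hs)]
  have : (fun (x : Option A → ℝ) (a : A) => x (some a)) ⁻¹' (Set.univ.pi s) =
      Set.univ.pi (fun o : Option A => o.elim Set.univ s) := by
    ext x
    simp only [Set.mem_preimage, Set.mem_pi, Set.mem_univ, true_implies, Option.forall]
    simp
  rw [this, stdGauss, Measure.pi_pi, Fintype.prod_option]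
  simp

theorem measurePreserving_coupling (N : ℕ) :
    MeasurePreserving (fun (x : DisorderIx N → ℝ) (j k : Fin N) => x (some (j, k)))
      (stdGauss (DisorderIx N)) (gaussN N) := by
  have h1 : MeasurePreserving (MeasurableEquiv.curry (Fin N) (Fin N) ℝ)
      (stdGauss (Fin N × Fin N)) (gaussN N) := by
    refine ⟨MeasurableEquiv.measurable _, ?_⟩
    have := Measure.infinitePi_map_curry (fun (_ _ : Fin N) => gaussianReal 0 1)
    simp only [Measure.infinitePi_eq_pi] at this
    exact this
  exact h1.comp (measurePreserving_some (Fin N × Fin N))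

theorem cav_pi_div_two (N : ℕ) (β h q : ℝ) (i : Fin N) {ι : Type} [DecidableEq ι] [Fintype ι]
    (f : (ι → Cfg N) → ℝ) : cav N β h q i (Real.pi / 2) f = nu N β h f := by
  have hH : ∀ x : DisorderIx N → ℝ,
      linHam (cavCoeff N β q i (Real.pi / 2)) (extField N h) x =
        negH N β h fun j k => x (some (j, k)) := by
    intro x
    funext σ
    unfold linHam negH extField
    rw [Fintype.sum_option, Fintype.sum_prod_type]
    simp only [cavCoeff, Option.elim, Real.cos_pi_div_two, Real.sin_pi_div_two, ite_self]
    simp only [zero_mul, mul_zero, zero_add, one_mul, Finset.mul_sum]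
    congr 1
    refine Finset.sum_congr rfl fun j _ => Finset.sum_congr rfl fun k _ => ?_
    split_ifs
    · ring
    · simp
  unfold cav gaussAvg nu
  simp only [hH, gibbs_eq_gibbsAvg]
  have hp := measurePreserving_coupling N
  have hcont : Continuous fun g => gibbsAvg (negH N β h g) f := by
    unfold gibbsAvg gibbsWeight
    have : ∀ σ, Continuous fun g : Fin N → Fin N → ℝ => negH N β h g σ := by
      intro σ
      unfold negH
      refine (continuous_const.mul (continuous_finsetSum _ fun j _ =>
        continuous_finsetSum _ fun k _ => ?_)).add continuous_const
      split_ifs <;> fun_prop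
    refine continuous_finsetSum _ fun σs _ => continuous_const.mul
      (continuous_finsetProd _ fun l _ => ?_)
    exact (Real.continuous_exp.comp (this _)).div
      (continuous_finsetSum _ fun τ _ => Real.continuous_exp.comp (this _))
      fun x => (partition_pos _).ne'
  rw [← hp.map_eq, integral_map hp.measurable.aemeasurable hcont.aestronglyMeasurable]

theorem hasDerivAt_cavCoeff (N : ℕ) (β q : ℝ) (i : Fin N) (θ : ℝ) (J : DisorderIx N)
    (σ : Cfg N) :
    HasDerivAt (fun θ => cavCoeff N β q i θ J σ) (cavCoeffDeriv N β q i θ J σ) θ := by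
  rcases J with _ | p
  · exact (Real.hasDerivAt_cos θ).mul_const _
  · refine HasDerivAt.mul_const ?_ _
    split_ifs
    · exact Real.hasDerivAt_sin θ
    · exact hasDerivAt_const _ _

theorem abs_cavCoeffDeriv_le (N : ℕ) (β q : ℝ) (i : Fin N) (θ : ℝ) (J : DisorderIx N)
    (σ : Cfg N) : |cavCoeffDeriv N β q i θ J σ| ≤ |β * √q| + |β / √N| := by
  rcases J with _ | p
  · simp only [cavCoeffDeriv, Option.elim]
    rw [abs_mul, abs_neg, abs_mul (β * √q), abs_spin, mul_one]
    have := mul_le_mul_of_nonneg_right (Real.abs_sin_le_one θ) (abs_nonneg (β * √q))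
    have := abs_nonneg (β / √N)
    linarith
  · simp only [cavCoeffDeriv, Option.elim]
    have h1 : |(if p.1 = i ∨ p.2 = i then Real.cos θ else 0)| ≤ 1 := by
      split_ifs
      · exact Real.abs_cos_le_one θ
      · simp
    have h2 : |(if p.1 < p.2 then spin (σ p.1) * spin (σ p.2) else 0)| ≤ 1 := by
      split_ifs
      · rw [abs_mul, abs_spin, abs_spin, one_mul]
      · simp
    rw [abs_mul, abs_mul]
    have := mul_le_mul h1 (mul_le_mul_of_nonneg_left h2 (abs_nonneg (β / √N)))
      (by positivity) zero_le_one
    have := abs_nonneg (β * √q)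
    linarith

theorem sum_lt_site {N : ℕ} (i : Fin N) (x : Fin N → ℝ) :
    ∑ p : Fin N × Fin N, (if p.1 = i ∨ p.2 = i then if p.1 < p.2 then x p.1 * x p.2 else 0 else 0)
      = x i * ∑ j ∈ Finset.univ.erase i, x j := by
  have h : ∀ p : Fin N × Fin N,
      (if p.1 = i ∨ p.2 = i then if p.1 < p.2 then x p.1 * x p.2 else 0 else 0) =
      (if p.1 = i then if i < p.2 then x i * x p.2 else 0 else 0) +
      (if p.2 = i then if p.1 < i then x i * x p.1 else 0 else 0) := by
    rintro ⟨j, k⟩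
    by_cases hj : j = i <;> by_cases hk : k = i
    · subst hj; subst hk; simp
    · subst hj; simp [hk]
    · subst hk; simp [hj, mul_comm]
    · simp [hj, hk]
  have h1 : ∀ g : Fin N → ℝ, ∑ j : Fin N, ∑ k, (if j = i then g k else 0) = ∑ k, g k := by
    intro g
    rw [Finset.sum_comm]
    simp
  simp only [h]
  rw [Finset.sum_add_distrib, Fintype.sum_prod_type, Fintype.sum_prod_type_right]
  dsimp only
  rw [h1 (fun k => if i < k then x i * x k else 0), h1 (fun k => if k < i then x i * x k else 0),
    ← Finset.sum_add_distrib, Finset.mul_sum, ← Finset.sum_erase_add _ _ (Finset.mem_univ i)]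
  simp only [lt_self_iff_false, if_false, add_zero]
  refine Finset.sum_congr rfl fun k hk => ?_
  rcases lt_or_gt_of_ne (Finset.ne_of_mem_erase hk) with h2 | h2
  · simp [h2, h2.not_gt]
  · simp [h2, h2.not_gt]

theorem sum_cavCoeffDeriv_mul (N : ℕ) (hN : 0 < N) (β : ℝ) {q : ℝ} (hq : 0 ≤ q) (i : Fin N)
    (θ : ℝ) (σ τ : Cfg N) :
    ∑ J, cavCoeffDeriv N β q i θ J σ * cavCoeff N β q i θ J τ =
      (β ^ 2 * (Real.sin θ * Real.cos θ)) *
        (spin (σ i) * spin (τ i) * (cavOverlap N i σ τ - q)) := by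
  have hN' : (0 : ℝ) < N := Nat.cast_pos.2 hN
  have hs := sum_lt_site i fun j => spin (σ j) * spin (τ j)
  rw [Fintype.sum_option]
  simp only [cavCoeffDeriv, cavCoeff, Option.elim]
  have h : ∀ p : Fin N × Fin N,
      (if p.1 = i ∨ p.2 = i then Real.cos θ else 0) *
        (β / √N * if p.1 < p.2 then spin (σ p.1) * spin (σ p.2) else 0) *
      ((if p.1 = i ∨ p.2 = i then Real.sin θ else 1) *
        (β / √N * if p.1 < p.2 then spin (τ p.1) * spin (τ p.2) else 0)) =
      β ^ 2 / N * (Real.sin θ * Real.cos θ) *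
        (if p.1 = i ∨ p.2 = i then if p.1 < p.2 then
          (spin (σ p.1) * spin (τ p.1)) * (spin (σ p.2) * spin (τ p.2)) else 0 else 0) := by
    intro p
    split_ifs
    · rw [show β ^ 2 / (N : ℝ) = β / √N * (β / √N) by
        rw [div_mul_div_comm, Real.mul_self_sqrt hN'.le, sq]]
      ring
    all_goals simp
  simp only [h]
  rw [← Finset.mul_sum, hs]
  unfold cavOverlap
  have := Real.mul_self_sqrt hq
  field_simp
  rw [Real.sq_sqrt hq]
  ring

/-- The interaction created by the cavity derivative between two replicas. -/
def cavInter (N : ℕ) (q : ℝ) (i : Fin N) (σ τ : Cfg N) : ℝ :=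
  spin (σ i) * spin (τ i) * (cavOverlap N i σ τ - q)

theorem cavInter_self (N : ℕ) (hN : 0 < N) (q : ℝ) (i : Fin N) (σ : Cfg N) :
    cavInter N q i σ σ = ((N : ℝ) - 1) / N - q := by
  simp only [cavInter, cavOverlap, spin_mul_self, Finset.sum_const, Finset.card_erase_of_mem
    (Finset.mem_univ i), Finset.card_univ, Fintype.card_fin, nsmul_eq_mul, mul_one, one_mul]
  rw [Nat.cast_pred hN]

theorem hasDerivAt_cav (N : ℕ) (hN : 0 < N) (β h : ℝ) {q : ℝ} (hq : 0 ≤ q) (i : Fin N)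
    {ι : Type} [DecidableEq ι] [Fintype ι] (f : (ι → Cfg N) → ℝ) (θ : ℝ) :
    HasDerivAt (fun θ => cav N β h q i θ f)
      (β ^ 2 * (Real.sin θ * Real.cos θ) * ∑ a : Option ι, ∑ b ∈ Finset.univ.erase (some a),
        repWeight ι a * repWeight (Option ι) b *
          cav N β h q i θ fun σs =>
            f (fun l => σs (some (some l))) * cavInter N q i (σs (some a)) (σs b)) θ :=
  hasDerivAt_gaussAvg_path (κ := fun θ => β ^ 2 * (Real.sin θ * Real.cos θ)) (extField N h)
    (hasDerivAt_cavCoeff N β q i)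
    (abs_cavCoeffDeriv_le N β q i) (fun θ σ τ => sum_cavCoeffDeriv_mul N hN β hq i θ σ τ)
    (cavInter_self N hN q i) f θ

/-- `g` does not depend on the spin at site `i` of the replicas in `A`. -/
def SiteFree {N : ℕ} {ι : Type} (i : Fin N) (A : Set ι) (g : (ι → Cfg N) → ℝ) : Prop :=
  ∀ σs τs : ι → Cfg N, (∀ l j, (l ∉ A ∨ j ≠ i) → σs l j = τs l j) → g σs = g τs

section SiteFree

variable {N : ℕ} {ι ι' : Type} {i : Fin N} {A B : Set ι} {f g : (ι → Cfg N) → ℝ}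

theorem SiteFree.subset (hf : SiteFree i B f) (h : A ⊆ B) : SiteFree i A f :=
  fun σs τs hst => hf σs τs fun l j hl => hst l j (hl.imp_left fun hl' hA => hl' (h hA))

theorem siteFree_const (c : ℝ) : SiteFree i A fun _ => c := fun _ _ _ => rfl

theorem SiteFree.mul (hf : SiteFree i A f) (hg : SiteFree i A g) :
    SiteFree i A fun σs => f σs * g σs :=
  fun σs τs h => by dsimp only; rw [hf σs τs h, hg σs τs h]

theorem SiteFree.sub (hf : SiteFree i A f) (hg : SiteFree i A g) :
    SiteFree i A fun σs => f σs - g σs :=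
  fun σs τs h => by dsimp only; rw [hf σs τs h, hg σs τs h]

theorem SiteFree.pow (hf : SiteFree i A f) (k : ℕ) : SiteFree i A fun σs => f σs ^ k :=
  fun σs τs h => by dsimp only; rw [hf σs τs h]

theorem SiteFree.sum {κ : Type*} {s : Finset κ} {f : κ → (ι → Cfg N) → ℝ}
    (hf : ∀ k ∈ s, SiteFree i A (f k)) : SiteFree i A fun σs => ∑ k ∈ s, f k σs :=
  fun σs τs h => Finset.sum_congr rfl fun k hk => hf k hk σs τs h

theorem SiteFree.prod {κ : Type*} {s : Finset κ} {f : κ → (ι → Cfg N) → ℝ}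
    (hf : ∀ k ∈ s, SiteFree i A (f k)) : SiteFree i A fun σs => ∏ k ∈ s, f k σs :=
  fun σs τs h => Finset.prod_congr rfl fun k hk => hf k hk σs τs h

theorem siteFree_spin {a : ι} {j : Fin N} (h : a ∉ A ∨ j ≠ i) :
    SiteFree i A fun σs => spin (σs a j) :=
  fun σs τs hst => by dsimp only; rw [hst a j h]

theorem siteFree_cavOverlap (a b : ι) :
    SiteFree i A fun σs => cavOverlap N i (σs a) (σs b) := by
  intro σs τs h
  dsimp only
  unfold cavOverlap
  congr 1
  refine Finset.sum_congr rfl fun j hj => ?_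
  have hj := Finset.ne_of_mem_erase hj
  rw [h a j (Or.inr hj), h b j (Or.inr hj)]

theorem SiteFree.comp {A' : Set ι'} (hf : SiteFree i A f) (e : ι → ι')
    (h : ∀ l, e l ∈ A' → l ∈ A) : SiteFree i A' fun σs => f fun l => σs (e l) :=
  fun _ _ hst => hf _ _ fun l j hl => hst (e l) j (hl.imp_left fun hl' hA => hl' (h l hA))

end SiteFree

/-- Flip the spin at site `i`. -/
def flipAt {N : ℕ} (i : Fin N) (σ : Cfg N) : Cfg N := Function.update σ i (!σ i)

theorem flipAt_flipAt {N : ℕ} (i : Fin N) (σ : Cfg N) : flipAt i (flipAt i σ) = σ := by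
  simp [flipAt]

theorem flipAt_apply_self {N : ℕ} (i : Fin N) (σ : Cfg N) : flipAt i σ i = !σ i := by
  simp [flipAt]

theorem spin_not (b : Bool) : spin (!b) = -spin b := by cases b <;> simp [spin]

section Decoupled

variable {N : ℕ} {ι : Type} [DecidableEq ι] [Fintype ι]

theorem gibbsAvg_spin_mul {i : Fin N} {y : ℝ} {H W : Cfg N → ℝ}
    (hH : ∀ σ, H σ = y * spin (σ i) + W σ) (hW : ∀ σ, W (flipAt i σ) = W σ) {a : ι}
    {g : (ι → Cfg N) → ℝ} (hg : SiteFree i {a} g) :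
    gibbsAvg H (fun σs => spin (σs a i) * g σs) = Real.tanh y * gibbsAvg H g := by
  rw [← gibbsAvg_const_mul, ← sub_eq_zero]
  unfold gibbsAvg
  rw [← Finset.sum_sub_distrib]
  refine Finset.sum_involution (fun σs _ => Function.update σs a (flipAt i (σs a)))
    (fun σs _ => ?_) (fun σs _ _ h => ?_) (fun _ _ => Finset.mem_univ _) (fun σs _ => ?_)
  · have hgf : g (Function.update σs a (flipAt i (σs a))) = g σs := by
      refine hg _ _ fun l j hl => ?_
      by_cases hla : l = a
      · subst hla
        have hj : j ≠ i := by simpa using hl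
        simp [flipAt, hj]
      · simp [hla]
    have hp : ∀ τs : ι → Cfg N, ∏ l, gibbsWeight H (τs l) =
        gibbsWeight H (τs a) * ∏ l ∈ Finset.univ.erase a, gibbsWeight H (τs l) := fun τs =>
      (Finset.mul_prod_erase _ _ (Finset.mem_univ a)).symm
    have hr : ∏ l ∈ Finset.univ.erase a,
        gibbsWeight H (Function.update σs a (flipAt i (σs a)) l) =
        ∏ l ∈ Finset.univ.erase a, gibbsWeight H (σs l) :=
      Finset.prod_congr rfl fun l hl => by
        rw [Function.update_of_ne (Finset.ne_of_mem_erase hl)]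
    dsimp only
    rw [hp σs, hp (Function.update σs a (flipAt i (σs a))), hr, hgf]
    generalize ∏ l ∈ Finset.univ.erase a, gibbsWeight H (σs l) = P
    simp only [Function.update_self, flipAt_apply_self, spin_not, gibbsWeight]
    generalize ∑ τ, Real.exp (H τ) = Z
    rw [hH, hH, hW, flipAt_apply_self, spin_not, Real.exp_add, Real.exp_add]
    rw [Real.tanh_eq_sinh_div_cosh]
    have hc := (Real.cosh_pos y).ne'
    have he1 : Real.exp y = Real.cosh y + Real.sinh y := (Real.cosh_add_sinh y).symm
    have he2 : Real.exp (-y) = Real.cosh y - Real.sinh y := (Real.cosh_sub_sinh y).symm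
    rcases Bool.eq_false_or_eq_true (σs a i) with hb | hb
    · simp only [hb, spin, if_true, mul_one, mul_neg, he1, he2]
      field_simp
      ring
    · simp only [hb, spin, Bool.false_eq_true, if_false, mul_one, mul_neg, neg_neg, he1, he2]
      field_simp
      ring
  · have h1 := congrFun (congrFun h a) i
    simp [flipAt] at h1
  · simp [flipAt_flipAt]

theorem gibbsAvg_prod_spin_mul {i : Fin N} {y : ℝ} {H W : Cfg N → ℝ}
    (hH : ∀ σ, H σ = y * spin (σ i) + W σ) (hW : ∀ σ, W (flipAt i σ) = W σ) (A : Finset ι)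
    {g : (ι → Cfg N) → ℝ} (hg : SiteFree i Set.univ g) :
    gibbsAvg H (fun σs => (∏ a ∈ A, spin (σs a i)) * g σs) =
      Real.tanh y ^ A.card * gibbsAvg H g := by
  induction A using Finset.induction_on with
  | empty => simp
  | insert a A ha ih =>
    simp only [Finset.prod_insert ha, mul_assoc]
    rw [gibbsAvg_spin_mul hH hW, ih, Finset.card_insert_of_notMem ha, pow_succ]
    · ring
    · refine SiteFree.mul (SiteFree.prod fun k hk => siteFree_spin (Or.inl ?_))
        (hg.subset (Set.subset_univ _))
      rintro rfl
      exact ha hk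

/-- The part of the decoupled Hamiltonian away from site `i`. -/
theorem linHam_cavCoeff_zero (β h q : ℝ) (i : Fin N) (x : DisorderIx N → ℝ) :
    ∃ W : Cfg N → ℝ, (∀ σ, W (flipAt i σ) = W σ) ∧ ∀ (y : ℝ) (σ : Cfg N),
      linHam (cavCoeff N β q i 0) (extField N h) (Function.update x none y) σ =
        (β * √q * y + h) * spin (σ i) + W σ := by
  refine ⟨fun σ => ∑ p : Fin N × Fin N, x (some p) * cavCoeff N β q i 0 (some p) σ +
    h * ∑ j ∈ Finset.univ.erase i, spin (σ j), fun σ => ?_, fun y σ => ?_⟩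
  · dsimp only
    congr 1
    · refine Finset.sum_congr rfl fun p _ => ?_
      simp only [cavCoeff, Option.elim]
      by_cases hp : p.1 = i ∨ p.2 = i
      · simp [hp]
      · rw [not_or] at hp
        simp [flipAt, hp.1, hp.2]
    · congr 1
      refine Finset.sum_congr rfl fun j hj => ?_
      simp [flipAt, Finset.ne_of_mem_erase hj]
  · simp only [linHam, extField, Fintype.sum_option]
    rw [← Finset.add_sum_erase Finset.univ _ (Finset.mem_univ i)]
    simp [cavCoeff]
    ring

/-- Moments of `tanh` under a Gaussian field. -/
def tanhMoment (s h : ℝ) (k : ℕ) : ℝ := ∫ z, Real.tanh (s * z + h) ^ k ∂gaussianReal 0 1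

theorem gibbsAvg_decoupled_update (β h q : ℝ) (i : Fin N) (x : DisorderIx N → ℝ)
    {g : (ι → Cfg N) → ℝ} (hg : SiteFree i Set.univ g) (y y' : ℝ) :
    gibbsAvg (linHam (cavCoeff N β q i 0) (extField N h) (Function.update x none y)) g =
      gibbsAvg (linHam (cavCoeff N β q i 0) (extField N h) (Function.update x none y')) g := by
  obtain ⟨W, hW, hH⟩ := linHam_cavCoeff_zero β h q i x
  have hd : ∀ y, HasDerivAt (fun y =>
      gibbsAvg (linHam (cavCoeff N β q i 0) (extField N h) (Function.update x none y)) g) 0 y := by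
    intro y
    have h1 := hasDerivAt_gibbsAvg (x := y)
      (H := fun y => linHam (cavCoeff N β q i 0) (extField N h) (Function.update x none y))
      (c := fun σ => β * √q * spin (σ i)) (fun σ => by
        simp only [hH]
        have := (((hasDerivAt_id y).const_mul (β * √q)).add_const h).mul_const (spin (σ i))
        convert! (this.add_const (W σ)) using 1
        ring) g
    have hgs : SiteFree i Set.univ fun σs : Option ι → Cfg N => g fun l => σs (some l) :=
      hg.comp some fun _ _ => trivial
    convert! h1 using 1
    symm
    have h2 : repDeriv (fun σ : Cfg N => β * √q * spin (σ i)) g = fun σs =>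
        ∑ a : Option ι, (β * √q * repWeight ι a) * (spin (σs a i) * g fun l => σs (some l)) := by
      funext σs
      rw [repDeriv_eq_sum, Finset.mul_sum]
      exact Finset.sum_congr rfl fun a _ => by ring
    rw [h2, gibbsAvg_sum]
    simp only [gibbsAvg_const_mul]
    have h3 : ∀ a : Option ι, gibbsAvg
        (linHam (cavCoeff N β q i 0) (extField N h) (Function.update x none y))
        (fun σs => spin (σs a i) * g fun l => σs (some l)) = Real.tanh (β * √q * y + h) * gibbsAvg
        (linHam (cavCoeff N β q i 0) (extField N h) (Function.update x none y))
        (fun σs : Option ι → Cfg N => g fun l => σs (some l)) := fun a =>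
      gibbsAvg_spin_mul (hH y) hW (hgs.subset (Set.subset_univ _))
    simp only [h3]
    rw [← Finset.sum_mul, ← Finset.mul_sum, sum_repWeight, mul_zero, zero_mul]
  exact is_const_of_deriv_eq_zero (fun y => (hd y).differentiableAt) (fun y => (hd y).deriv) y y'

theorem cav_zero_prod_spin_mul (β h q : ℝ) (i : Fin N) (A : Finset ι)
    {g : (ι → Cfg N) → ℝ} (hg : SiteFree i Set.univ g) :
    cav N β h q i 0 (fun σs => (∏ a ∈ A, spin (σs a i)) * g σs) =
      tanhMoment (β * √q) h A.card * cav N β h q i 0 g := by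
  have hp := measurePreserving_update (J := DisorderIx N) none
  unfold cav gaussAvg
  rw [← hp.map_eq, integral_map hp.measurable.aemeasurable
      (continuous_gibbsAvg_linHam _ _ _).aestronglyMeasurable,
    integral_map hp.measurable.aemeasurable
      (continuous_gibbsAvg_linHam _ _ _).aestronglyMeasurable]
  have h1 : ∀ (p : (DisorderIx N → ℝ) × ℝ),
      gibbsAvg (linHam (cavCoeff N β q i 0) (extField N h) (Function.update p.1 none p.2)) g =
      gibbsAvg (linHam (cavCoeff N β q i 0) (extField N h) (Function.update p.1 none 0)) g * 1 :=
    fun p => by rw [mul_one]; exact gibbsAvg_decoupled_update β h q i p.1 hg p.2 0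
  have h2 : ∀ (p : (DisorderIx N → ℝ) × ℝ),
      gibbsAvg (linHam (cavCoeff N β q i 0) (extField N h) (Function.update p.1 none p.2))
        (fun σs => (∏ a ∈ A, spin (σs a i)) * g σs) =
      gibbsAvg (linHam (cavCoeff N β q i 0) (extField N h) (Function.update p.1 none 0)) g *
        Real.tanh (β * √q * p.2 + h) ^ A.card := by
    intro p
    obtain ⟨W, hW, hH⟩ := linHam_cavCoeff_zero β h q i p.1
    rw [gibbsAvg_prod_spin_mul (hH p.2) hW A hg, h1, mul_one, mul_comm]
  simp only [h1, h2]
  rw [integral_prod_mul (fun x => gibbsAvg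
      (linHam (cavCoeff N β q i 0) (extField N h) (Function.update x none 0)) g)
      fun y => Real.tanh (β * √q * y + h) ^ A.card,
    integral_prod_mul (fun x => gibbsAvg
      (linHam (cavCoeff N β q i 0) (extField N h) (Function.update x none 0)) g) fun _ => 1]
  simp [tanhMoment, mul_comm]

theorem cav_zero_spin_sub_mul (β h q : ℝ) (i : Fin N) {a b : ι}
    {g : (ι → Cfg N) → ℝ} (hg : SiteFree i {a, b} g) :
    cav N β h q i 0 (fun σs => (spin (σs a i) - spin (σs b i)) * g σs) = 0 := by
  unfold cav gaussAvg
  refine integral_eq_zero_of_ae (ae_of_all _ fun x => ?_)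
  obtain ⟨W, hW, hH⟩ := linHam_cavCoeff_zero β h q i x
  have hx := hH (x none)
  rw [Function.update_eq_self] at hx
  have h1 := gibbsAvg_spin_mul (ι := ι) hx hW (hg.subset (A := {a}) (by simp))
  have h2 := gibbsAvg_spin_mul (ι := ι) hx hW (hg.subset (A := {b}) (by simp))
  have h3 : (fun σs : ι → Cfg N => (spin (σs a i) - spin (σs b i)) * g σs) = fun σs =>
      spin (σs a i) * g σs + (-1) * (spin (σs b i) * g σs) := by
    funext σs; ring
  rw [h3]
  dsimp only
  rw [gibbsAvg_add, gibbsAvg_const_mul, h1, h2, Pi.zero_apply]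
  ring

end Decoupled

theorem abs_tanhMoment_le (s h : ℝ) (k : ℕ) : |tanhMoment s h k| ≤ 1 := by
  have := norm_integral_le_of_norm_le_const (μ := gaussianReal 0 1) (C := 1)
    (f := fun z => Real.tanh (s * z + h) ^ k) (ae_of_all _ fun z => by
      rw [norm_pow, Real.norm_eq_abs]
      exact pow_le_one₀ (abs_nonneg _) (Real.abs_tanh_lt_one _).le)
  simpa [tanhMoment] using this

theorem tanhMoment_nonneg (s h : ℝ) {k : ℕ} (hk : Even k) : 0 ≤ tanhMoment s h k :=
  integral_nonneg fun _ => hk.pow_nonneg _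

theorem exists_fixedPoint (β h : ℝ) :
    ∃ q, 0 ≤ q ∧ q ≤ 1 ∧ tanhMoment (β * √q) h 2 = q := by
  have hc : Continuous Real.tanh := by
    simp only [funext Real.tanh_eq_sinh_div_cosh]
    exact Real.continuous_sinh.div Real.continuous_cosh fun x => (Real.cosh_pos x).ne'
  have hcont : Continuous fun q : ℝ => tanhMoment (β * √q) h 2 - q := by
    refine Continuous.sub ?_ continuous_id
    refine continuous_of_dominated (bound := fun _ => 1) (fun q => ?_) (fun q => ?_)
      (integrable_const _) (ae_of_all _ fun z => ?_)
    · exact Continuous.aestronglyMeasurable (by fun_prop)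
    · refine ae_of_all _ fun z => ?_
      rw [norm_pow, Real.norm_eq_abs]
      exact pow_le_one₀ (abs_nonneg _) (Real.abs_tanh_lt_one _).le
    · fun_prop
  have h0 : 0 ≤ tanhMoment (β * √0) h 2 - 0 := by
    rw [sub_zero]; exact tanhMoment_nonneg _ _ (by decide)
  have h1 : tanhMoment (β * √1) h 2 - 1 ≤ 0 :=
    sub_nonpos.2 ((le_abs_self _).trans (abs_tanhMoment_le _ _ _))
  obtain ⟨q, hq, hq0⟩ := intermediate_value_Icc' zero_le_one hcont.continuousOn ⟨h1, h0⟩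
  exact ⟨q, hq.1, hq.2, sub_eq_zero.1 hq0⟩

section CavLinear

variable {N : ℕ} {ι ι' : Type} [DecidableEq ι] [Fintype ι] [DecidableEq ι'] [Fintype ι']
  (β h q : ℝ) (i : Fin N) (θ : ℝ)

theorem cav_const_mul (a : ℝ) (f : (ι → Cfg N) → ℝ) :
    cav N β h q i θ (fun σs => a * f σs) = a * cav N β h q i θ f :=
  gaussAvg_const_mul _ _ _ _

theorem cav_sum {κ : Type*} (s : Finset κ) (f : κ → (ι → Cfg N) → ℝ) :
    cav N β h q i θ (fun σs => ∑ k ∈ s, f k σs) = ∑ k ∈ s, cav N β h q i θ (f k) :=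
  gaussAvg_sum _ _ _ _

theorem cav_add (f g : (ι → Cfg N) → ℝ) :
    cav N β h q i θ (fun σs => f σs + g σs) = cav N β h q i θ f + cav N β h q i θ g := by
  have := cav_sum β h q i θ Finset.univ fun b : Bool => if b then f else g
  simpa using this

theorem cav_sub (f g : (ι → Cfg N) → ℝ) :
    cav N β h q i θ (fun σs => f σs - g σs) = cav N β h q i θ f - cav N β h q i θ g := by
  have h1 := cav_add β h q i θ f fun σs => (-1) * g σs
  rw [cav_const_mul] at h1
  rw [sub_eq_add_neg, ← neg_one_mul, ← h1]
  congr 1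
  funext σs
  ring

theorem cav_mono {f g : (ι → Cfg N) → ℝ} (hfg : ∀ σs, f σs ≤ g σs) :
    cav N β h q i θ f ≤ cav N β h q i θ g :=
  integral_mono (integrable_gibbsAvg_linHam _ _ _) (integrable_gibbsAvg_linHam _ _ _)
    fun _ => gibbsAvg_mono _ hfg

theorem cav_const (a : ℝ) : cav N β h q i θ (fun _ : ι → Cfg N => a) = a := by
  simp [cav, gaussAvg, gibbsAvg_const]

theorem cav_nonneg {f : (ι → Cfg N) → ℝ} (hf : ∀ σs, 0 ≤ f σs) : 0 ≤ cav N β h q i θ f := by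
  have := cav_mono β h q i θ hf
  rwa [cav_const] at this

theorem abs_cav_le_of_abs_le {f g : (ι → Cfg N) → ℝ} (hfg : ∀ σs, |f σs| ≤ g σs) :
    |cav N β h q i θ f| ≤ cav N β h q i θ g := by
  rw [abs_le, ← neg_one_mul, ← cav_const_mul]
  exact ⟨cav_mono _ _ _ _ _ fun σs => by linarith [(abs_le.1 (hfg σs)).1],
    cav_mono _ _ _ _ _ fun σs => (abs_le.1 (hfg σs)).2⟩

theorem cav_comp_injective {e : ι' → ι} (he : Function.Injective e) (f : (ι' → Cfg N) → ℝ) :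
    cav N β h q i θ (fun σs : ι → Cfg N => f fun l => σs (e l)) = cav N β h q i θ f := by
  unfold cav gaussAvg
  simp only [gibbsAvg_comp_injective _ he]

end CavLinear

/-- The total fluctuation of the overlaps. -/
def overlapFluct (N : ℕ) (q : ℝ) {ι : Type} [DecidableEq ι] [Fintype ι] (σs : ι → Cfg N) : ℝ :=
  ∑ a, ∑ b ∈ Finset.univ.erase a, (|overlap N (σs a) (σs b) - q| + 1 / N)

section Gronwall

variable {N : ℕ} {ι : Type} [DecidableEq ι] [Fintype ι]

theorem abs_cavOverlap_sub_le (q : ℝ) (i : Fin N) (σ τ : Cfg N) :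
    |cavOverlap N i σ τ - q| ≤ |overlap N σ τ - q| + 1 / N := by
  rw [overlap_eq N i]
  have h1 : |spin (σ i) * spin (τ i) / (N : ℝ)| = 1 / N := by
    rw [abs_div, abs_mul, abs_spin, abs_spin, Nat.abs_cast, mul_one]
  have h2 : cavOverlap N i σ τ - q =
      (cavOverlap N i σ τ + spin (σ i) * spin (τ i) / N - q) + -(spin (σ i) * spin (τ i) / N) := by
    ring
  rw [h2]
  refine (abs_add_le _ _).trans ?_
  rw [abs_neg, h1]

theorem abs_cavInter (q : ℝ) (i : Fin N) (σ τ : Cfg N) :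
    |cavInter N q i σ τ| = |cavOverlap N i σ τ - q| := by
  simp [cavInter, abs_mul, abs_spin]

theorem abs_cavOverlap_le (i : Fin N) (σ τ : Cfg N) : |cavOverlap N i σ τ| ≤ 1 := by
  have hN : (0 : ℝ) < N := Nat.cast_pos.2 i.pos
  unfold cavOverlap
  rw [abs_div, Nat.abs_cast, div_le_one hN]
  refine (Finset.abs_sum_le_sum_abs _ _).trans ?_
  simp only [abs_mul, abs_spin, mul_one, Finset.sum_const, nsmul_eq_mul]
  exact_mod_cast (Finset.card_le_univ _).trans (by simp)

theorem abs_cavInter_le_two {q : ℝ} (hq : 0 ≤ q) (hq1 : q ≤ 1) (i : Fin N) (σ τ : Cfg N) :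
    |cavInter N q i σ τ| ≤ 2 := by
  rw [abs_cavInter]
  have := abs_le.1 (abs_cavOverlap_le i σ τ)
  exact abs_le.2 ⟨by linarith, by linarith⟩

theorem sum_abs_cavInter_le (q : ℝ) (i : Fin N) (σs : Option (Option ι) → Cfg N) :
    ∑ a : Option ι, ∑ b ∈ Finset.univ.erase (some a), |cavInter N q i (σs (some a)) (σs b)| ≤
      overlapFluct N q σs := by
  unfold overlapFluct
  rw [Fintype.sum_option (f := fun a => ∑ b ∈ Finset.univ.erase a,
    (|overlap N (σs a) (σs b) - q| + 1 / (N : ℝ)))]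
  refine le_add_of_nonneg_of_le (Finset.sum_nonneg fun _ _ => by positivity) ?_
  refine Finset.sum_le_sum fun a _ => Finset.sum_le_sum fun b _ => ?_
  rw [abs_cavInter]
  exact abs_cavOverlap_sub_le q i _ _

/-- The sum in the cavity derivative. -/
def cavDerivSum (N : ℕ) (β h q : ℝ) (i : Fin N) (θ : ℝ) (f : (ι → Cfg N) → ℝ) : ℝ :=
  ∑ a : Option ι, ∑ b ∈ Finset.univ.erase (some a), repWeight ι a * repWeight (Option ι) b *
    cav N β h q i θ fun σs =>
      f (fun l => σs (some (some l))) * cavInter N q i (σs (some a)) (σs b)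

/-- A bound for products of replica weights. -/
def weightBound (n : ℕ) : ℝ := ((n : ℝ) + 1) * (n + 2)

theorem weightBound_pos (n : ℕ) : 0 < weightBound n := by unfold weightBound; positivity

theorem abs_repWeight_mul_le (a : Option ι) (b : Option (Option ι)) :
    |repWeight ι a * repWeight (Option ι) b| ≤ weightBound (Fintype.card ι) := by
  rw [abs_mul, weightBound]
  have h2 := abs_repWeight_le (Option ι) b
  rw [Fintype.card_option, Nat.cast_add, Nat.cast_one, add_assoc, one_add_one_eq_two] at h2
  exact mul_le_mul (abs_repWeight_le ι a) h2 (abs_nonneg _) (by positivity)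

theorem abs_cavDerivSum_le (β h q : ℝ) (i : Fin N) (θ : ℝ) {f g : (ι → Cfg N) → ℝ}
    (hfg : ∀ σs, |f σs| ≤ g σs) :
    |cavDerivSum N β h q i θ f| ≤ weightBound (Fintype.card ι) *
      ∑ a : Option ι, ∑ b ∈ Finset.univ.erase (some a),
        cav N β h q i θ fun σs =>
          g (fun l => σs (some (some l))) * |cavInter N q i (σs (some a)) (σs b)| := by
  unfold cavDerivSum
  rw [Finset.mul_sum]
  refine (Finset.abs_sum_le_sum_abs _ _).trans (Finset.sum_le_sum fun a _ => ?_)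
  rw [Finset.mul_sum]
  refine (Finset.abs_sum_le_sum_abs _ _).trans (Finset.sum_le_sum fun b _ => ?_)
  rw [abs_mul]
  refine mul_le_mul (abs_repWeight_mul_le a b) (abs_cav_le_of_abs_le _ _ _ _ _ fun σs => ?_)
    (abs_nonneg _) (weightBound_pos _).le
  rw [abs_mul]
  exact mul_le_mul_of_nonneg_right (hfg _) (abs_nonneg _)

theorem abs_sin_mul_cos_le (θ : ℝ) : |Real.sin θ * Real.cos θ| ≤ 1 := by
  rw [abs_mul]
  exact mul_le_one₀ (Real.abs_sin_le_one θ) (abs_nonneg _) (Real.abs_cos_le_one θ)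

/-- The constant in the comparison of the averages along the cavity path with the endpoint. -/
def gronwallConst (n : ℕ) : ℝ :=
  Real.exp (weightBound n * (2 * weightBound n) * (Real.pi / 2))

theorem gronwallConst_pos (n : ℕ) : 0 < gronwallConst n := Real.exp_pos _

theorem cav_le_nu {β h q : ℝ} (hβ : |β| ≤ 1) (hq : 0 ≤ q) (hq1 : q ≤ 1) (i : Fin N) {θ : ℝ}
    (hθ : 0 ≤ θ) (hθ' : θ ≤ Real.pi / 2) {f : (ι → Cfg N) → ℝ} (hf : ∀ σs, 0 ≤ f σs) :
    cav N β h q i θ f ≤ gronwallConst (Fintype.card ι) * nu N β h f := by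
  have hinj : Function.Injective fun l : ι => some (some l) := fun a b hab => by simpa using hab
  set K : ℝ := weightBound (Fintype.card ι) * (2 * weightBound (Fintype.card ι)) with hK
  have hK0 : 0 ≤ K := by have := weightBound_pos (Fintype.card ι); positivity
  have hd : ∀ θ, |β ^ 2 * (Real.sin θ * Real.cos θ) * cavDerivSum N β h q i θ f| ≤
      K * cav N β h q i θ f := by
    intro θ
    have h1 := abs_cavDerivSum_le β h q i θ (f := f) (g := f) fun σs => (abs_of_nonneg (hf σs)).le
    have h2 : ∀ (a : Option ι) (b : Option (Option ι)), (cav N β h q i θ fun σs =>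
        f (fun l => σs (some (some l))) * |cavInter N q i (σs (some a)) (σs b)|) ≤
        2 * cav N β h q i θ f := by
      intro a b
      rw [← cav_comp_injective β h q i θ hinj f, ← cav_const_mul]
      refine cav_mono _ _ _ _ _ fun σs => ?_
      rw [mul_comm]
      exact mul_le_mul_of_nonneg_right (abs_cavInter_le_two hq hq1 i _ _) (hf _)
    have h3 : ∑ a : Option ι, ∑ b ∈ Finset.univ.erase (some a), (cav N β h q i θ fun σs =>
        f (fun l => σs (some (some l))) * |cavInter N q i (σs (some a)) (σs b)|) ≤
        2 * weightBound (Fintype.card ι) * cav N β h q i θ f := by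
      have hc := cav_nonneg β h q i θ hf
      calc _ ≤ ∑ a : Option ι, ∑ b : Option (Option ι), 2 * cav N β h q i θ f :=
            Finset.sum_le_sum fun a _ => (Finset.sum_le_sum fun b _ => h2 a b).trans
              (Finset.sum_le_sum_of_subset_of_nonneg (Finset.subset_univ _)
                fun _ _ _ => by positivity)
        _ = _ := by simp [weightBound]; ring
    rw [abs_mul, abs_mul, abs_pow]
    have h4 : |β| ^ 2 * |Real.sin θ * Real.cos θ| ≤ 1 :=
      mul_le_one₀ (pow_le_one₀ (abs_nonneg _) hβ) (abs_nonneg _) (abs_sin_mul_cos_le θ)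
    calc _ ≤ 1 * |cavDerivSum N β h q i θ f| := mul_le_mul_of_nonneg_right h4 (abs_nonneg _)
      _ ≤ weightBound (Fintype.card ι) *
          (2 * weightBound (Fintype.card ι) * cav N β h q i θ f) := by
        rw [one_mul]
        exact h1.trans (mul_le_mul_of_nonneg_left h3 (weightBound_pos _).le)
      _ = _ := by rw [hK]; ring
  have hmono : Monotone fun θ => Real.exp (K * θ) * cav N β h q i θ f := by
    refine monotone_of_hasDerivAt_nonneg (f' := fun θ => Real.exp (K * θ) * (K * 1) *
      cav N β h q i θ f + Real.exp (K * θ) *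
      (β ^ 2 * (Real.sin θ * Real.cos θ) * cavDerivSum N β h q i θ f)) (fun θ => ?_) fun θ => ?_
    · exact (((hasDerivAt_id θ).const_mul K).exp).mul (hasDerivAt_cav N i.pos β h hq i f θ)
    · have := (abs_le.1 (hd θ)).1
      have := mul_le_mul_of_nonneg_left this (Real.exp_pos (K * θ)).le
      simp only [Pi.zero_apply]
      nlinarith
  have h1 := hmono hθ'
  simp only [cav_pi_div_two] at h1
  have h2 : cav N β h q i θ f ≤ Real.exp (K * θ) * cav N β h q i θ f :=
    le_mul_of_one_le_left (cav_nonneg _ _ _ _ _ hf) (Real.one_le_exp (by positivity))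
  exact h2.trans h1

/-- The constant in the cavity difference bound. -/
def diffConst (n : ℕ) : ℝ := weightBound n * gronwallConst (n + 2) * (Real.pi / 2)

theorem diffConst_pos (n : ℕ) : 0 < diffConst n := by
  unfold diffConst
  have := weightBound_pos n
  have := gronwallConst_pos (n + 2)
  positivity

theorem abs_cavDerivSum_le_nu {β h q : ℝ} (hβ : |β| ≤ 1) (hq : 0 ≤ q) (hq1 : q ≤ 1) (i : Fin N)
    {θ : ℝ} (hθ : 0 ≤ θ) (hθ' : θ ≤ Real.pi / 2) {f g : (ι → Cfg N) → ℝ}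
    (hfg : ∀ σs, |f σs| ≤ g σs) :
    |cavDerivSum N β h q i θ f| ≤
      weightBound (Fintype.card ι) * gronwallConst (Fintype.card ι + 2) *
        nu N β h fun σs : Option (Option ι) → Cfg N =>
          g (fun l => σs (some (some l))) * overlapFluct N q σs := by
  have hg : ∀ σs, 0 ≤ g σs := fun σs => (abs_nonneg _).trans (hfg σs)
  refine (abs_cavDerivSum_le β h q i θ hfg).trans ?_
  rw [mul_assoc]
  refine mul_le_mul_of_nonneg_left ?_ (weightBound_pos _).le
  have h1 := cav_le_nu (h := h) hβ hq hq1 i hθ hθ'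
    (f := fun σs : Option (Option ι) → Cfg N =>
      g (fun l => σs (some (some l))) * overlapFluct N q σs) fun σs => mul_nonneg (hg _)
        (Finset.sum_nonneg fun _ _ => Finset.sum_nonneg fun _ _ => by positivity)
  rw [Fintype.card_option, Fintype.card_option] at h1
  refine le_trans ?_ h1
  simp only [← cav_sum]
  refine cav_mono _ _ _ _ _ fun σs => ?_
  simp only [← Finset.mul_sum]
  exact mul_le_mul_of_nonneg_left (sum_abs_cavInter_le q i σs) (hg _)

theorem abs_cav_sub_le {β h q : ℝ} (hβ : |β| ≤ 1) (hq : 0 ≤ q) (hq1 : q ≤ 1) (i : Fin N)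
    {θ θ' : ℝ} (hθ : θ ∈ Set.Icc 0 (Real.pi / 2)) (hθ' : θ' ∈ Set.Icc 0 (Real.pi / 2))
    {f g : (ι → Cfg N) → ℝ} (hfg : ∀ σs, |f σs| ≤ g σs) :
    |cav N β h q i θ f - cav N β h q i θ' f| ≤ β ^ 2 * (diffConst (Fintype.card ι) *
        nu N β h fun σs : Option (Option ι) → Cfg N =>
          g (fun l => σs (some (some l))) * overlapFluct N q σs) := by
  set E := nu N β h fun σs : Option (Option ι) → Cfg N =>
          g (fun l => σs (some (some l))) * overlapFluct N q σs with hE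
  have h1 := (convex_Icc 0 (Real.pi / 2)).norm_image_sub_le_of_norm_hasDerivWithin_le
    (f := fun θ => cav N β h q i θ f)
    (C := β ^ 2 * (weightBound (Fintype.card ι) * gronwallConst (Fintype.card ι + 2) * E))
    (fun θ _ => (hasDerivAt_cav N i.pos β h hq i f θ).hasDerivWithinAt) (fun θ hθ => ?_) hθ' hθ
  · simp only [Real.norm_eq_abs] at h1
    refine h1.trans ?_
    have hE0 : 0 ≤ weightBound (Fintype.card ι) * gronwallConst (Fintype.card ι + 2) * E :=
      (abs_nonneg _).trans (abs_cavDerivSum_le_nu hβ hq hq1 i hθ.1 hθ.2 hfg)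
    have h2 : |θ - θ'| ≤ Real.pi / 2 := by
      obtain ⟨h3, h4⟩ := hθ
      obtain ⟨h5, h6⟩ := hθ'
      exact abs_le.2 ⟨by linarith, by linarith⟩
    calc _ ≤ β ^ 2 * (weightBound (Fintype.card ι) * gronwallConst (Fintype.card ι + 2) * E) *
          (Real.pi / 2) := mul_le_mul_of_nonneg_left h2 (by positivity)
      _ = _ := by rw [diffConst]; ring
  · rw [Real.norm_eq_abs, abs_mul, abs_mul, abs_of_nonneg (sq_nonneg β)]
    have h2 := abs_cavDerivSum_le_nu hβ hq hq1 i hθ.1 hθ.2 hfg (h := h)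
    refine mul_le_mul ?_ h2 (abs_nonneg _) (sq_nonneg β)
    exact mul_le_of_le_one_right (sq_nonneg β) (abs_sin_mul_cos_le θ)

end Gronwall

theorem add_pow_le_three_mul {a b : ℝ} (ha : 0 ≤ a) (hb : 0 ≤ b) (p : ℕ) :
    (a + b) ^ p ≤ 3 * a ^ p + ((p : ℝ) + 1) ^ p * b ^ p := by
  rcases Nat.eq_zero_or_pos p with rfl | hp
  · simp
  have hp' : (0 : ℝ) < p := Nat.cast_pos.2 hp
  have ha' : 0 ≤ a ^ p := pow_nonneg ha p
  have hb' : 0 ≤ ((p : ℝ) + 1) ^ p * b ^ p := by positivity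
  rcases le_total (p * b) a with h | h
  · have h1 : a + b ≤ a * (1 / p + 1) := by
      have : b ≤ a * (1 / p) := by rw [mul_one_div, le_div_iff₀ hp']; linarith
      linarith
    have h2 : (1 / (p : ℝ) + 1) ^ p ≤ 3 := by
      calc _ ≤ Real.exp (1 / p) ^ p := pow_le_pow_left₀ (by positivity) (Real.add_one_le_exp _) p
        _ = Real.exp 1 := by rw [← Real.exp_nat_mul]; field_simp
        _ ≤ 3 := Real.exp_one_lt_three.le
    calc (a + b) ^ p ≤ (a * (1 / p + 1)) ^ p := pow_le_pow_left₀ (by positivity) h1 p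
      _ = a ^ p * (1 / (p : ℝ) + 1) ^ p := mul_pow _ _ _
      _ ≤ a ^ p * 3 := mul_le_mul_of_nonneg_left h2 ha'
      _ ≤ _ := by linarith
  · calc (a + b) ^ p ≤ (((p : ℝ) + 1) * b) ^ p := pow_le_pow_left₀ (by positivity) (by linarith) p
      _ = ((p : ℝ) + 1) ^ p * b ^ p := mul_pow _ _ _
      _ ≤ _ := by linarith

theorem pow_mul_le_add_pow {u v : ℝ} (hu : 0 ≤ u) (hv : 0 ≤ v) (p : ℕ) :
    u ^ p * v ≤ u ^ (p + 1) + v ^ (p + 1) := by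
  rcases le_total v u with h | h
  · have h1 : u ^ p * v ≤ u ^ p * u := mul_le_mul_of_nonneg_left h (pow_nonneg hu p)
    have := pow_nonneg hv (p + 1)
    rw [pow_succ u]
    linarith
  · have h1 : u ^ p * v ≤ v ^ p * v := mul_le_mul_of_nonneg_right (pow_le_pow_left₀ hu h p) hv
    have := pow_nonneg hu (p + 1)
    rw [pow_succ v]
    linarith

section NuLinear

variable {M : ℕ} {ι ι' : Type} [DecidableEq ι] [Fintype ι] [DecidableEq ι'] [Fintype ι']
  (β h : ℝ)

theorem nu_eq_cav (f : (ι → Cfg (M + 1)) → ℝ) :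
    nu (M + 1) β h f = cav (M + 1) β h 0 0 (Real.pi / 2) f := (cav_pi_div_two _ _ _ _ _ _).symm

theorem nu_const_mul (a : ℝ) (f : (ι → Cfg (M + 1)) → ℝ) :
    nu (M + 1) β h (fun σs => a * f σs) = a * nu (M + 1) β h f := by
  simp only [nu_eq_cav, cav_const_mul]

theorem nu_sum {κ : Type*} (s : Finset κ) (f : κ → (ι → Cfg (M + 1)) → ℝ) :
    nu (M + 1) β h (fun σs => ∑ k ∈ s, f k σs) = ∑ k ∈ s, nu (M + 1) β h (f k) := by
  simp only [nu_eq_cav, cav_sum]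

theorem nu_add (f g : (ι → Cfg (M + 1)) → ℝ) :
    nu (M + 1) β h (fun σs => f σs + g σs) = nu (M + 1) β h f + nu (M + 1) β h g := by
  simp only [nu_eq_cav, cav_add]

theorem nu_const (a : ℝ) : nu (M + 1) β h (fun _ : ι → Cfg (M + 1) => a) = a := by
  simp only [nu_eq_cav, cav_const]

theorem nu_mono {f g : (ι → Cfg (M + 1)) → ℝ} (hfg : ∀ σs, f σs ≤ g σs) :
    nu (M + 1) β h f ≤ nu (M + 1) β h g := by
  simp only [nu_eq_cav]
  exact cav_mono _ _ _ _ _ hfg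

theorem nu_nonneg {f : (ι → Cfg (M + 1)) → ℝ} (hf : ∀ σs, 0 ≤ f σs) :
    0 ≤ nu (M + 1) β h f := by
  simp only [nu_eq_cav]
  exact cav_nonneg _ _ _ _ _ hf

theorem abs_nu_le_of_abs_le {f g : (ι → Cfg (M + 1)) → ℝ} (hfg : ∀ σs, |f σs| ≤ g σs) :
    |nu (M + 1) β h f| ≤ nu (M + 1) β h g := by
  simp only [nu_eq_cav]
  exact abs_cav_le_of_abs_le _ _ _ _ _ hfg

theorem nu_comp_injective {e : ι' → ι} (he : Function.Injective e)
    (f : (ι' → Cfg (M + 1)) → ℝ) :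
    nu (M + 1) β h (fun σs : ι → Cfg (M + 1) => f fun l => σs (e l)) = nu (M + 1) β h f := by
  simp only [nu_eq_cav, cav_comp_injective _ _ _ _ _ he]

theorem nu_pair {a b : ι} (hab : a ≠ b) (f : Cfg (M + 1) → Cfg (M + 1) → ℝ) :
    nu (M + 1) β h (fun σs => f (σs a) (σs b)) =
      nu (M + 1) β h fun σs : Fin 2 → Cfg (M + 1) => f (σs 0) (σs 1) := by
  have he : Function.Injective ![a, b] := by
    intro x y hxy
    fin_cases x <;> fin_cases y <;> simp_all
  exact nu_comp_injective β h he fun σs => f (σs 0) (σs 1)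

end NuLinear

/-- One step of the cavity induction on moments. -/
theorem nu_pow_le_cavity {M : ℕ} {β h q a : ℝ} (hβ : |β| ≤ 1) (hq : 0 ≤ q) (hq1 : q ≤ 1)
    (ha : 0 ≤ a) {X : (Fin 2 → Cfg (M + 1)) → ℝ} {c δ : Fin (M + 1) → ℝ}
    {u Xi : Fin (M + 1) → (Fin 2 → Cfg (M + 1)) → ℝ} {k : ℕ}
    (hX : ∀ σs, X σs = ∑ i, c i * u i σs) (hu : ∀ i σs, |u i σs| ≤ 2)
    (hXi : ∀ i σs, |X σs - Xi i σs| ≤ δ i) (hδ : ∀ i, δ i ≤ 2 * a)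
    (h0 : ∀ i, cav (M + 1) β h q i 0 (fun σs => u i σs * Xi i σs ^ (k + 1)) = 0)
    (hc : ∑ i, |c i| ≤ a * √((M + 1 : ℕ) : ℝ)) (hcδ : ∑ i, |c i| * δ i ≤ 2 * a ^ 2) :
    nu (M + 1) β h (fun σs => X σs ^ (k + 2)) ≤
      4 * (k + 1) * a ^ 2 * nu (M + 1) β h (fun σs => (|X σs| + 2 * a) ^ k) +
      β ^ 2 * (24 * diffConst 2) * (nu (M + 1) β h (fun σs => (|X σs| + 2 * a) ^ (k + 2)) +
        (a * √((M + 1 : ℕ) : ℝ)) ^ (k + 2) * nu (M + 1) β h fun σs : Fin 2 → Cfg (M + 1) =>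
          (|overlap (M + 1) (σs 0) (σs 1) - q| + 1 / (M + 1 : ℕ)) ^ (k + 2)) := by
  set s : ℝ := √((M + 1 : ℕ) : ℝ) with hs
  have hs0 : 0 ≤ s := Real.sqrt_nonneg _
  set Y : (Fin 2 → Cfg (M + 1)) → ℝ := fun σs => |X σs| + 2 * a with hY
  have hY0 : ∀ σs, 0 ≤ Y σs := fun σs => by positivity
  have hXY : ∀ σs, |X σs| ≤ Y σs := fun σs => by simp only [hY]; linarith
  have hXiY : ∀ i σs, |Xi i σs| ≤ Y σs := fun i σs => by
    have h1 := hXi i σs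
    have h2 : |Xi i σs| ≤ |X σs| + |X σs - Xi i σs| := by
      have := abs_sub (X σs) (X σs - Xi i σs)
      simpa using this
    have := hδ i
    simp only [hY]; linarith
  set e : Fin 2 → Option (Option (Fin 2)) := fun l => some (some l) with he
  have hinj : Function.Injective e := fun a b hab => by simpa [he] using hab
  set G : ℝ := nu (M + 1) β h fun σs : Option (Option (Fin 2)) → Cfg (M + 1) =>
    Y (fun l => σs (e l)) ^ (k + 1) * overlapFluct (M + 1) q σs with hG
  have hG0 : 0 ≤ G := nu_nonneg _ _ fun σs => mul_nonneg (pow_nonneg (hY0 _) _)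
    (Finset.sum_nonneg fun _ _ => Finset.sum_nonneg fun _ _ => by positivity)
  have hYk0 : 0 ≤ nu (M + 1) β h (fun σs => Y σs ^ k) :=
    nu_nonneg _ _ fun σs => pow_nonneg (hY0 _) _
  have hterm : ∀ i, |nu (M + 1) β h fun σs => u i σs * X σs ^ (k + 1)| ≤
      2 * (k + 1) * δ i * nu (M + 1) β h (fun σs => Y σs ^ k) +
        β ^ 2 * (diffConst 2 * (2 * G)) := by
    intro i
    have h1 : (fun σs => u i σs * X σs ^ (k + 1)) = fun σs =>
        u i σs * (X σs ^ (k + 1) - Xi i σs ^ (k + 1)) + u i σs * Xi i σs ^ (k + 1) := by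
      funext σs; ring
    rw [h1, nu_add]
    refine (abs_add_le _ _).trans (add_le_add ?_ ?_)
    · rw [← nu_const_mul]
      refine abs_nu_le_of_abs_le _ _ fun σs => ?_
      rw [abs_mul]
      have h2 := abs_pow_sub_pow_le (X σs) (Xi i σs) (k + 1)
      rw [Nat.add_sub_cancel] at h2
      have h3 : max |X σs| |Xi i σs| ^ k ≤ Y σs ^ k :=
        pow_le_pow_left₀ (le_max_of_le_left (abs_nonneg _)) (max_le (hXY _) (hXiY _ _)) k
      have hδ0 : 0 ≤ δ i := (abs_nonneg _).trans (hXi i σs)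
      have h4 : |X σs ^ (k + 1) - Xi i σs ^ (k + 1)| ≤ δ i * (k + 1) * Y σs ^ k := by
        refine h2.trans ?_
        push_cast
        exact mul_le_mul (mul_le_mul_of_nonneg_right (hXi i σs) (by positivity)) h3
          (pow_nonneg (le_max_of_le_left (abs_nonneg _)) _) (by positivity)
      calc _ ≤ 2 * (δ i * (k + 1) * Y σs ^ k) :=
            mul_le_mul (hu i σs) h4 (abs_nonneg _) (by norm_num)
        _ = _ := by ring
    · have h2 := abs_cav_sub_le hβ hq hq1 i (h := h) (θ := Real.pi / 2) (θ' := 0)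
        ⟨by positivity, le_rfl⟩ ⟨le_rfl, by positivity⟩
        (f := fun σs => u i σs * Xi i σs ^ (k + 1)) (g := fun σs => 2 * Y σs ^ (k + 1))
        (fun σs => by
          rw [abs_mul, abs_pow]
          exact mul_le_mul (hu i σs) (pow_le_pow_left₀ (abs_nonneg _) (hXiY i σs) _)
            (by positivity) (by norm_num))
      rw [h0, sub_zero, cav_pi_div_two, Fintype.card_fin] at h2
      simp only [mul_assoc (2 : ℝ)] at h2
      rw [nu_const_mul] at h2
      exact h2
  have hpow : nu (M + 1) β h (fun σs => X σs ^ (k + 2)) =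
      ∑ i, c i * nu (M + 1) β h fun σs => u i σs * X σs ^ (k + 1) := by
    simp only [← nu_const_mul, ← nu_sum]
    congr 1
    funext σs
    have h2 : X σs ^ (k + 2) = (∑ i, c i * u i σs) * X σs ^ (k + 1) := by rw [← hX]; ring
    rw [h2, Finset.sum_mul]
    simp only [mul_assoc]
  have hsum : nu (M + 1) β h (fun σs => X σs ^ (k + 2)) ≤
      2 * (k + 1) * nu (M + 1) β h (fun σs => Y σs ^ k) * (2 * a ^ 2) +
        (a * s) * (β ^ 2 * (diffConst 2 * (2 * G))) := by
    have hD := (diffConst_pos 2).le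
    rw [hpow]
    calc _ ≤ ∑ i, |c i| * (2 * (k + 1) * δ i * nu (M + 1) β h (fun σs => Y σs ^ k) +
          β ^ 2 * (diffConst 2 * (2 * G))) := Finset.sum_le_sum fun i _ => by
            refine (le_abs_self _).trans ?_
            rw [abs_mul]
            exact mul_le_mul_of_nonneg_left (hterm i) (abs_nonneg _)
      _ = 2 * (k + 1) * nu (M + 1) β h (fun σs => Y σs ^ k) * (∑ i, |c i| * δ i) +
          (∑ i, |c i|) * (β ^ 2 * (diffConst 2 * (2 * G))) := by
            rw [Finset.mul_sum, Finset.sum_mul, ← Finset.sum_add_distrib]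
            exact Finset.sum_congr rfl fun i _ => by ring
      _ ≤ _ := add_le_add (mul_le_mul_of_nonneg_left hcδ (by positivity))
            (mul_le_mul_of_nonneg_right hc (by positivity))
  set E : ℝ := nu (M + 1) β h fun σs : Fin 2 → Cfg (M + 1) =>
          (|overlap (M + 1) (σs 0) (σs 1) - q| + 1 / (M + 1 : ℕ)) ^ (k + 2) with hE
  have hGb : (a * s) * G ≤ 12 * (nu (M + 1) β h (fun σs => Y σs ^ (k + 2)) +
      (a * s) ^ (k + 2) * E) := by
    have h1 : ∀ a' b' : Option (Option (Fin 2)), b' ≠ a' →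
        nu (M + 1) β h (fun σs : Option (Option (Fin 2)) → Cfg (M + 1) =>
          (a * s) * (Y (fun l => σs (e l)) ^ (k + 1) *
            (|overlap (M + 1) (σs a') (σs b') - q| + 1 / (M + 1 : ℕ)))) ≤
        nu (M + 1) β h (fun σs => Y σs ^ (k + 2)) + (a * s) ^ (k + 2) * E := by
      intro a' b' hab
      rw [← nu_comp_injective β h hinj fun σs => Y σs ^ (k + 2), hE,
        ← nu_pair β h hab.symm fun σ τ =>
          (|overlap (M + 1) σ τ - q| + 1 / ((M + 1 : ℕ) : ℝ)) ^ (k + 2), ← nu_const_mul, ← nu_add]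
      refine nu_mono _ _ fun σs => ?_
      have := pow_mul_le_add_pow (hY0 fun l => σs (e l)) (v := a * s *
        (|overlap (M + 1) (σs a') (σs b') - q| + 1 / (M + 1 : ℕ))) (by positivity) (k + 1)
      rw [mul_pow] at this
      calc _ = Y (fun l => σs (e l)) ^ (k + 1) * (a * s *
        (|overlap (M + 1) (σs a') (σs b') - q| + 1 / (M + 1 : ℕ))) := by ring
        _ ≤ _ := this
    rw [hG, ← nu_const_mul]
    simp only [overlapFluct, Finset.mul_sum, nu_sum]
    calc _ ≤ ∑ a' : Option (Option (Fin 2)), ∑ _b' ∈ Finset.univ.erase a',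
          (nu (M + 1) β h (fun σs => Y σs ^ (k + 2)) + (a * s) ^ (k + 2) * E) :=
          Finset.sum_le_sum fun a' _ => Finset.sum_le_sum fun b' hb =>
            h1 a' b' (Finset.ne_of_mem_erase hb)
      _ = _ := by
        simp [Finset.card_erase_of_mem]
        ring
  have hD := (diffConst_pos 2).le
  have hfin : (a * s) * (β ^ 2 * (diffConst 2 * (2 * G))) ≤ β ^ 2 * (24 * diffConst 2) *
      (nu (M + 1) β h (fun σs => Y σs ^ (k + 2)) + (a * s) ^ (k + 2) * E) := by
    calc _ = β ^ 2 * diffConst 2 * 2 * (a * s * G) := by ring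
      _ ≤ β ^ 2 * diffConst 2 * 2 * (12 * (nu (M + 1) β h (fun σs => Y σs ^ (k + 2)) +
      (a * s) ^ (k + 2) * E)) := mul_le_mul_of_nonneg_left hGb (by positivity)
      _ = _ := by ring
  refine hsum.trans (add_le_add (le_of_eq ?_) hfin)
  ring

/-- The high temperature threshold. -/
def betaZero : ℝ := 1 / (8 + 288 * diffConst 2)

theorem betaZero_pos : 0 < betaZero := by
  unfold betaZero
  have := diffConst_pos 2
  positivity

/-- The parameters of the model, with a site `i` and a solution `q` of the replica symmetric
equation. -/
structure CavPar where
  M : ℕ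
  β : ℝ
  h : ℝ
  q : ℝ
  t : Fin (M + 1) → ℝ
  i : Fin (M + 1)
  β_pos : 0 < β
  β_lt : β < betaZero
  q_nonneg : 0 ≤ q
  q_le : q ≤ 1
  q_eq : tanhMoment (β * √q) h 2 = q
  t_sq : ∑ i, t i ^ 2 = 1

namespace CavPar

variable (w : CavPar)

/-- The number of sites. -/
abbrev N : ℕ := w.M + 1

/-- The fluctuation scale `N ^ (-1/2)`. -/
def r : ℝ := 1 / √(w.N : ℝ)

theorem N_pos : (0 : ℝ) < w.N := Nat.cast_pos.2 w.M.succ_pos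

theorem r_pos : 0 < w.r := one_div_pos.2 (Real.sqrt_pos.2 w.N_pos)

theorem r_sq : w.r ^ 2 = 1 / w.N := by
  rw [r, div_pow, Real.sq_sqrt w.N_pos.le, one_pow]

theorem r_mul_sqrt : w.r * √(w.N : ℝ) = 1 := by
  rw [r, one_div, inv_mul_cancel₀ (Real.sqrt_pos.2 w.N_pos).ne']

theorem r_le_one : w.r ≤ 1 := by
  rw [r, div_le_one (Real.sqrt_pos.2 w.N_pos), Real.one_le_sqrt]
  exact_mod_cast Nat.succ_pos w.M

theorem β_le : w.β ≤ 1 / 8 := by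
  refine w.β_lt.le.trans ?_
  unfold betaZero
  have := diffConst_pos 2
  exact one_div_le_one_div_of_le (by norm_num) (by linarith)

theorem abs_β_le : |w.β| ≤ 1 := by
  rw [abs_of_pos w.β_pos]
  linarith [w.β_le]

theorem β_sq_mul_le : w.β ^ 2 * (24 * diffConst 2) * 12 ≤ 1 := by
  have hD := diffConst_pos 2
  have h1 : w.β * (8 + 288 * diffConst 2) ≤ 1 := by
    have := w.β_lt.le
    rwa [betaZero, le_div_iff₀ (by positivity)] at this
  have h2 : w.β ^ 2 ≤ w.β := by
    rw [sq]
    exact mul_le_of_le_one_left w.β_pos.le (by linarith [w.β_le])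
  have := w.β_pos
  nlinarith

theorem abs_t_le (i : Fin w.N) : |w.t i| ≤ 1 := by
  have h1 : w.t i ^ 2 ≤ ∑ j, w.t j ^ 2 :=
    Finset.single_le_sum (f := fun j => w.t j ^ 2) (fun _ _ => sq_nonneg _) (Finset.mem_univ i)
  rw [w.t_sq] at h1
  exact (sq_le_one_iff_abs_le_one _).1 h1

theorem sum_abs_t_le : ∑ i, |w.t i| ≤ √(w.N : ℝ) := by
  refine Real.le_sqrt_of_sq_le ?_
  have h1 := sq_sum_le_card_mul_sum_sq (s := (Finset.univ : Finset (Fin w.N)))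
    (f := fun i => |w.t i|)
  simp only [sq_abs, w.t_sq, Finset.card_univ, Fintype.card_fin, mul_one] at h1
  exact h1

/-- The average `ν`. -/
def av {ι : Type} [DecidableEq ι] [Fintype ι] (f : (ι → Cfg w.N) → ℝ) : ℝ := nu w.N w.β w.h f

/-- The averages along the cavity path at the site `i`. -/
def cavAv (θ : ℝ) {ι : Type} [DecidableEq ι] [Fintype ι] (f : (ι → Cfg w.N) → ℝ) : ℝ :=
  cav w.N w.β w.h w.q w.i θ f

end CavPar

theorem nu_add_pow_le {M : ℕ} {ι : Type} [DecidableEq ι] [Fintype ι] (β h : ℝ)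
    {X : (ι → Cfg (M + 1)) → ℝ} {p : ℕ} {m b : ℝ} (hb : 0 ≤ b)
    (hX : nu (M + 1) β h (fun σs => |X σs| ^ p) ≤ m) :
    nu (M + 1) β h (fun σs => (|X σs| + b) ^ p) ≤ 3 * m + ((p : ℝ) + 1) ^ p * b ^ p := by
  calc _ ≤ nu (M + 1) β h (fun σs => 3 * |X σs| ^ p + ((p : ℝ) + 1) ^ p * b ^ p) :=
        nu_mono _ _ fun σs => add_pow_le_three_mul (abs_nonneg _) hb p
    _ = 3 * nu (M + 1) β h (fun σs => |X σs| ^ p) + ((p : ℝ) + 1) ^ p * b ^ p := by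
        rw [nu_add, nu_const_mul, nu_const]
    _ ≤ _ := by linarith

theorem cav_zero_pair (w : CavPar) (i : Fin w.N) {g : (Fin 2 → Cfg w.N) → ℝ}
    (hg : SiteFree i Set.univ g) :
    cav w.N w.β w.h w.q i 0 (fun σs => (spin (σs 0 i) * spin (σs 1 i) - w.q) * g σs) = 0 := by
  have h1 := cav_zero_prod_spin_mul w.β w.h w.q i Finset.univ hg
  simp only [Fin.prod_univ_two, Finset.card_univ, Fintype.card_fin, w.q_eq] at h1
  simp only [sub_mul]
  rw [cav_sub, h1, cav_const_mul, sub_self]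

theorem exists_overlap_moment (k : ℕ) : ∃ C : ℝ, ∀ w : CavPar,
    w.av (fun σs : Fin 2 → Cfg w.N => |overlap w.N (σs 0) (σs 1) - w.q| ^ (2 * k)) ≤
      C * w.r ^ (2 * k) := by
  induction k with
  | zero => exact ⟨1, fun w => by simp [CavPar.av, nu_const]⟩
  | succ k ih =>
    obtain ⟨C, hC⟩ := ih
    set B : ℕ → ℝ := fun p => ((p : ℝ) + 1) ^ p * 2 ^ p with hB
    refine ⟨2 * (4 * ((2 * k : ℕ) + 1) * (3 * C + B (2 * k))) + B (2 * k + 2), fun w => ?_⟩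
    have hr := w.r_pos
    have hrr : 1 / (w.N : ℝ) ≤ 2 * w.r := by
      rw [← w.r_sq]; nlinarith [w.r_le_one]
    have hstep := nu_pow_le_cavity (h := w.h) (k := 2 * k)
      (X := fun σs : Fin 2 → Cfg w.N => overlap w.N (σs 0) (σs 1) - w.q)
      (c := fun _ => 1 / (w.N : ℝ)) (δ := fun _ => 1 / (w.N : ℝ))
      (u := fun i σs => spin (σs 0 i) * spin (σs 1 i) - w.q)
      (Xi := fun i σs => cavOverlap w.N i (σs 0) (σs 1) - w.q)
      w.abs_β_le w.q_nonneg w.q_le w.r_pos.le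
      (fun σs => by
        have := w.N_pos.ne'
        rw [← Finset.mul_sum, Finset.sum_sub_distrib, overlap]
        simp only [Finset.sum_const, Finset.card_univ, Fintype.card_fin, nsmul_eq_mul]
        field_simp)
      (fun i σs => by
        have h1 : |spin (σs 0 i) * spin (σs 1 i)| = 1 := by rw [abs_mul, abs_spin, abs_spin, one_mul]
        refine (abs_sub _ _).trans ?_
        rw [h1, abs_of_nonneg w.q_nonneg]
        linarith [w.q_le])
      (fun i σs => by
        rw [overlap_eq w.N i, abs_le]
        have h1 : |spin (σs 0 i) * spin (σs 1 i) / (w.N : ℝ)| = 1 / w.N := by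
          rw [abs_div, abs_mul, abs_spin, abs_spin, Nat.abs_cast, mul_one]
        have := abs_le.1 h1.le
        constructor <;> linarith)
      (fun i => hrr)
      (fun i => cav_zero_pair w i
        (((siteFree_cavOverlap 0 1).sub (siteFree_const _)).pow _))
      (by
        have := w.N_pos.ne'
        simp only [Finset.sum_const, Finset.card_univ, Fintype.card_fin, nsmul_eq_mul]
        rw [w.r_mul_sqrt, abs_of_pos (one_div_pos.2 w.N_pos), mul_one_div_cancel this])
      (by
        have := w.N_pos.ne'
        simp only [Finset.sum_const, Finset.card_univ, Fintype.card_fin, nsmul_eq_mul]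
        rw [abs_of_pos (one_div_pos.2 w.N_pos), ← mul_assoc, mul_one_div_cancel this, w.r_sq,
          one_mul]
        have := one_div_pos.2 w.N_pos
        linarith)
    have heven : (fun σs : Fin 2 → Cfg w.N => |overlap w.N (σs 0) (σs 1) - w.q| ^ (2 * (k + 1))) =
        fun σs => (overlap w.N (σs 0) (σs 1) - w.q) ^ (2 * k + 2) := by
      funext σs
      exact Even.pow_abs ⟨k + 1, by ring⟩ _
    set m := nu w.N w.β w.h (fun σs : Fin 2 → Cfg w.N =>
      |overlap w.N (σs 0) (σs 1) - w.q| ^ (2 * (k + 1))) with hm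
    have h1 : nu w.N w.β w.h (fun σs : Fin 2 → Cfg w.N =>
        (|overlap w.N (σs 0) (σs 1) - w.q| + 2 * w.r) ^ (2 * k)) ≤
        (3 * C + B (2 * k)) * w.r ^ (2 * k) := by
      refine (nu_add_pow_le (X := fun σs : Fin 2 → Cfg w.N => overlap w.N (σs 0) (σs 1) - w.q)
        _ _ (by positivity) (hC w)).trans (le_of_eq ?_)
      simp only [hB, mul_pow]
      ring_nf
    have h2 : nu w.N w.β w.h (fun σs : Fin 2 → Cfg w.N =>
        (|overlap w.N (σs 0) (σs 1) - w.q| + 2 * w.r) ^ (2 * k + 2)) ≤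
        3 * m + B (2 * k + 2) * w.r ^ (2 * k + 2) := by
      refine (nu_add_pow_le (X := fun σs : Fin 2 → Cfg w.N => overlap w.N (σs 0) (σs 1) - w.q)
        _ _ (by positivity) hm.ge).trans (le_of_eq ?_)
      simp only [hB, mul_pow]
      ring_nf
    have h3 : nu w.N w.β w.h (fun σs : Fin 2 → Cfg w.N =>
        (|overlap w.N (σs 0) (σs 1) - w.q| + 1 / w.N) ^ (2 * k + 2)) ≤
        3 * m + B (2 * k + 2) * w.r ^ (2 * k + 2) :=
      (nu_mono _ _ fun σs => pow_le_pow_left₀ (by positivity) (by linarith) _).trans h2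
    rw [← heven] at hstep
    change m ≤ _ at hstep
    rw [w.r_mul_sqrt, one_pow, one_mul] at hstep
    set κ : ℝ := w.β ^ 2 * (24 * diffConst 2) with hκ
    have hκ0 : 0 ≤ κ := by have := diffConst_pos 2; positivity
    have hκ1 : κ * 12 ≤ 1 := w.β_sq_mul_le
    have hm0 : 0 ≤ m := nu_nonneg _ _ fun σs => by positivity
    have h4 := mul_le_mul_of_nonneg_left h1
      (show (0 : ℝ) ≤ 4 * ((2 * k : ℕ) + 1) * w.r ^ 2 by positivity)
    have h5 := mul_le_mul_of_nonneg_left (add_le_add h2 h3) hκ0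
    have hb0 : 0 ≤ B (2 * k + 2) * w.r ^ (2 * k + 2) := by
      simp only [hB]; positivity
    have h6 : κ * 12 * (m + B (2 * k + 2) * w.r ^ (2 * k + 2)) ≤
        1 * (m + B (2 * k + 2) * w.r ^ (2 * k + 2)) :=
      mul_le_mul_of_nonneg_right hκ1 (by positivity)
    have h7 := mul_nonneg hκ0 hb0
    change m ≤ _
    have h8 : w.r ^ 2 * w.r ^ (2 * k) = w.r ^ (2 * (k + 1)) := by ring
    have h9 : w.r ^ (2 * k + 2) = w.r ^ (2 * (k + 1)) := by ring
    rw [h9] at h5 h6 h7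
    have h10 : 4 * (((2 * k : ℕ) : ℝ) + 1) * w.r ^ 2 * ((3 * C + B (2 * k)) * w.r ^ (2 * k)) =
        4 * (((2 * k : ℕ) : ℝ) + 1) * (3 * C + B (2 * k)) * w.r ^ (2 * (k + 1)) := by
      rw [← h8]; ring
    rw [h10] at h4
    nlinarith

/-- `Σ_i t_i (σ_i - τ_i)`. -/
def spinDiff (w : CavPar) (σ τ : Cfg w.N) : ℝ := ∑ i, w.t i * (spin (σ i) - spin (τ i))

/-- `Σ_{j ≠ i} t_j (σ_j - τ_j)`. -/
def spinDiffCav (w : CavPar) (i : Fin w.N) (σ τ : Cfg w.N) : ℝ :=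
  ∑ j ∈ Finset.univ.erase i, w.t j * (spin (σ j) - spin (τ j))

theorem spinDiff_eq (w : CavPar) (i : Fin w.N) (σ τ : Cfg w.N) :
    spinDiff w σ τ = spinDiffCav w i σ τ + w.t i * (spin (σ i) - spin (τ i)) := by
  unfold spinDiff spinDiffCav
  rw [Finset.sum_erase_add _ _ (Finset.mem_univ i)]

theorem siteFree_spinDiffCav (w : CavPar) {ι : Type} {A : Set ι} (i : Fin w.N) (a b : ι) :
    SiteFree i A fun σs : ι → Cfg w.N => spinDiffCav w i (σs a) (σs b) :=
  SiteFree.sum fun _ hj => (siteFree_const _).mul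
    ((siteFree_spin (Or.inr (Finset.ne_of_mem_erase hj))).sub
      (siteFree_spin (Or.inr (Finset.ne_of_mem_erase hj))))

theorem abs_spin_sub_le (x y : Bool) : |spin x - spin y| ≤ 2 := by
  refine (abs_sub _ _).trans ?_
  rw [abs_spin, abs_spin]; norm_num

theorem exists_spinDiff_moment (k : ℕ) : ∃ C : ℝ, ∀ w : CavPar,
    w.av (fun σs : Fin 2 → Cfg w.N => |spinDiff w (σs 0) (σs 1)| ^ (2 * k)) ≤ C := by
  induction k with
  | zero => exact ⟨1, fun w => by simp [CavPar.av, nu_const]⟩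
  | succ k ih =>
    obtain ⟨C, hC⟩ := ih
    obtain ⟨C', hC'⟩ := exists_overlap_moment (k + 1)
    set B : ℕ → ℝ := fun p => ((p : ℝ) + 1) ^ p with hB
    have hB0 : ∀ p, 0 ≤ B p := fun p => by positivity
    refine ⟨2 * (4 * ((2 * k : ℕ) + 1) * (3 * C + B (2 * k) * 2 ^ (2 * k))) +
      B (2 * k + 2) * 2 ^ (2 * k + 2) + |3 * C' + B (2 * k + 2)|, fun w => ?_⟩
    have hr := w.r_pos
    have hstep := nu_pow_le_cavity (h := w.h) (k := 2 * k) (a := 1)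
      (X := fun σs : Fin 2 → Cfg w.N => spinDiff w (σs 0) (σs 1))
      (c := w.t) (δ := fun i => 2 * |w.t i|)
      (u := fun i σs => spin (σs 0 i) - spin (σs 1 i))
      (Xi := fun i σs => spinDiffCav w i (σs 0) (σs 1))
      w.abs_β_le w.q_nonneg w.q_le zero_le_one
      (fun σs => rfl)
      (fun i σs => abs_spin_sub_le _ _)
      (fun i σs => by
        rw [spinDiff_eq w i, add_sub_cancel_left, abs_mul, mul_comm]
        exact mul_le_mul_of_nonneg_right (abs_spin_sub_le _ _) (abs_nonneg _))
      (fun i => mul_le_mul_of_nonneg_left (w.abs_t_le i) zero_le_two)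
      (fun i => cav_zero_spin_sub_mul _ _ _ i ((siteFree_spinDiffCav w i 0 1).pow _))
      (by rw [one_mul]; exact w.sum_abs_t_le)
      (by
        have h1 : ∀ i, |w.t i| * (2 * |w.t i|) = 2 * w.t i ^ 2 := fun i => by
          rw [← sq_abs]; ring
        simp only [h1, ← Finset.mul_sum, w.t_sq]
        norm_num)
    have heven : (fun σs : Fin 2 → Cfg w.N => |spinDiff w (σs 0) (σs 1)| ^ (2 * (k + 1))) =
        fun σs => spinDiff w (σs 0) (σs 1) ^ (2 * k + 2) := by
      funext σs
      exact Even.pow_abs ⟨k + 1, by ring⟩ _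
    set m := nu w.N w.β w.h (fun σs : Fin 2 → Cfg w.N =>
      |spinDiff w (σs 0) (σs 1)| ^ (2 * (k + 1))) with hm
    have h1 : nu w.N w.β w.h (fun σs : Fin 2 → Cfg w.N =>
        (|spinDiff w (σs 0) (σs 1)| + 2 * 1) ^ (2 * k)) ≤
        3 * C + B (2 * k) * (2 * 1) ^ (2 * k) :=
      nu_add_pow_le (X := fun σs : Fin 2 → Cfg w.N => spinDiff w (σs 0) (σs 1))
        _ _ (by positivity) (hC w)
    have h2 : nu w.N w.β w.h (fun σs : Fin 2 → Cfg w.N =>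
        (|spinDiff w (σs 0) (σs 1)| + 2 * 1) ^ (2 * k + 2)) ≤
        3 * m + B (2 * k + 2) * (2 * 1) ^ (2 * k + 2) :=
      nu_add_pow_le (X := fun σs : Fin 2 → Cfg w.N => spinDiff w (σs 0) (σs 1))
        _ _ (by positivity) hm.ge
    have h3 : (1 * √(w.N : ℝ)) ^ (2 * k + 2) * nu w.N w.β w.h (fun σs : Fin 2 → Cfg w.N =>
        (|overlap w.N (σs 0) (σs 1) - w.q| + 1 / w.N) ^ (2 * k + 2)) ≤
        |3 * C' + B (2 * k + 2)| := by
      have h4 : nu w.N w.β w.h (fun σs : Fin 2 → Cfg w.N =>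
        (|overlap w.N (σs 0) (σs 1) - w.q| + w.r) ^ (2 * k + 2)) ≤
        (3 * C' + B (2 * k + 2)) * w.r ^ (2 * k + 2) :=
        (nu_add_pow_le (X := fun σs : Fin 2 → Cfg w.N => overlap w.N (σs 0) (σs 1) - w.q)
          _ _ hr.le (hC' w)).trans (le_of_eq (by
            change 3 * (C' * w.r ^ (2 * k + 2)) + B (2 * k + 2) * w.r ^ (2 * k + 2) = _
            ring))
      have hrr : 1 / (w.N : ℝ) ≤ w.r := by rw [← w.r_sq]; nlinarith [w.r_le_one]
      have h5 := (nu_mono w.β w.h fun σs : Fin 2 → Cfg w.N => pow_le_pow_left₀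
        (by positivity) (add_le_add_right hrr |overlap w.N (σs 0) (σs 1) - w.q|)
          (2 * k + 2)).trans h4
      refine (mul_le_mul_of_nonneg_left h5 (by positivity)).trans ?_
      rw [mul_left_comm, ← mul_pow, one_mul, mul_comm √_, w.r_mul_sqrt, one_pow, mul_one]
      exact le_abs_self _
    rw [← heven] at hstep
    change m ≤ _ at hstep
    set κ : ℝ := w.β ^ 2 * (24 * diffConst 2) with hκ
    have hκ0 : 0 ≤ κ := by have := diffConst_pos 2; positivity
    have hκ1 : κ * 12 ≤ 1 := w.β_sq_mul_le
    have hm0 : 0 ≤ m := nu_nonneg _ _ fun σs => by positivity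
    simp only [mul_one] at h1 h2 hstep
    have h4 := mul_le_mul_of_nonneg_left h1
      (show (0 : ℝ) ≤ 4 * ((2 * k : ℕ) + 1) * 1 ^ 2 by positivity)
    have h5 := mul_le_mul_of_nonneg_left (add_le_add h2 h3) hκ0
    have hb0 : 0 ≤ B (2 * k + 2) * 2 ^ (2 * k + 2) := mul_nonneg (hB0 _) (by positivity)
    have hb1 := abs_nonneg (3 * C' + B (2 * k + 2))
    have h6 : κ * 12 * (m + B (2 * k + 2) * 2 ^ (2 * k + 2) + |3 * C' + B (2 * k + 2)|) ≤
        1 * (m + B (2 * k + 2) * 2 ^ (2 * k + 2) + |3 * C' + B (2 * k + 2)|) :=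
      mul_le_mul_of_nonneg_right hκ1 (by positivity)
    have h7 := mul_nonneg hκ0 hb0
    have h8 := mul_nonneg hκ0 hb1
    have h9 := mul_nonneg hκ0 hm0
    change m ≤ _
    nlinarith

/-- A family of functions of `ι`-indexed replicas. -/
abbrev ReplicaFun (ι : Type) := ∀ w : CavPar, (ι → Cfg w.N) → ℝ

/-- All moments of `f` have order `r ^ j`, uniformly in the parameters. -/
def MomBdd {ι : Type} [DecidableEq ι] [Fintype ι] (j : ℕ) (f : ReplicaFun ι) : Prop :=
  ∀ p : ℕ, ∃ C : ℝ, ∀ w : CavPar, w.av (fun σs => |f w σs| ^ p) ≤ C * w.r ^ (j * p)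

namespace MomBdd

variable {ι ι' : Type} [DecidableEq ι] [Fintype ι] [DecidableEq ι'] [Fintype ι'] {j j' : ℕ}
  {f g : ReplicaFun ι}

theorem of_even (hf : ∀ k : ℕ, ∃ C : ℝ, ∀ w : CavPar,
    w.av (fun σs => |f w σs| ^ (2 * k)) ≤ C * w.r ^ (j * (2 * k))) : MomBdd j f := by
  intro p
  obtain ⟨C, hC⟩ := hf p
  refine ⟨1 + C, fun w => ?_⟩
  have hr : 0 < w.r ^ (j * p) := pow_pos w.r_pos _
  have h1 : ∀ σs, |f w σs| ^ p ≤ w.r ^ (j * p) + (w.r ^ (j * p))⁻¹ * |f w σs| ^ (2 * p) := by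
    intro σs
    set x := |f w σs| ^ p with hx
    have hx0 : 0 ≤ x := by positivity
    have h2 : |f w σs| ^ (2 * p) = x * x := by rw [hx, two_mul, pow_add]
    rw [h2]
    set R := w.r ^ (j * p)
    have h3 : x = R * (R⁻¹ * x) := by rw [mul_inv_cancel_left₀ hr.ne']
    have h4 : R + R⁻¹ * (x * x) = R * (1 + (R⁻¹ * x) ^ 2) := by
      field_simp
    rw [h4]
    nth_rewrite 1 [h3]
    refine mul_le_mul_of_nonneg_left ?_ hr.le
    nlinarith [sq_nonneg (R⁻¹ * x - 1)]
  refine (nu_mono _ _ h1).trans ?_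
  rw [nu_add, nu_const, nu_const_mul]
  have h5 := mul_le_mul_of_nonneg_left (hC w) (inv_nonneg.2 hr.le)
  have h6 : (w.r ^ (j * p))⁻¹ * (C * w.r ^ (j * (2 * p))) = C * w.r ^ (j * p) := by
    rw [show j * (2 * p) = j * p + j * p by ring, pow_add]
    field_simp
  rw [h6] at h5
  change w.r ^ (j * p) + (w.r ^ (j * p))⁻¹ * w.av _ ≤ _
  linarith

theorem mono (hg : MomBdd j g) (h : ∀ w σs, |f w σs| ≤ |g w σs|) : MomBdd j f := fun p => by
  obtain ⟨C, hC⟩ := hg p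
  exact ⟨C, fun w => (nu_mono _ _ fun σs =>
    pow_le_pow_left₀ (abs_nonneg _) (h w σs) p).trans (hC w)⟩

theorem of_le {B : ℝ} (h : ∀ w σs, |f w σs| ≤ B * w.r ^ j) : MomBdd j f := fun p =>
  ⟨B ^ p, fun w => by
    refine (nu_mono (g := fun _ => (B * w.r ^ j) ^ p) _ _ fun σs =>
      pow_le_pow_left₀ (abs_nonneg _) (h w σs) p).trans ?_
    rw [nu_const, mul_pow, pow_mul]⟩

theorem of_bdd {B : ℝ} (h : ∀ w σs, |f w σs| ≤ B) : MomBdd 0 f :=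
  of_le (B := B) fun w σs => by simpa using h w σs

theorem add (hf : MomBdd j f) (hg : MomBdd j g) : MomBdd j fun w σs => f w σs + g w σs := by
  intro p
  obtain ⟨C, hC⟩ := hf p
  obtain ⟨C', hC'⟩ := hg p
  refine ⟨2 ^ p * (C + C'), fun w => ?_⟩
  have h1 : ∀ σs, |f w σs + g w σs| ^ p ≤ 2 ^ p * (|f w σs| ^ p + |g w σs| ^ p) := by
    intro σs
    have ha := abs_nonneg (f w σs)
    have hb := abs_nonneg (g w σs)
    have h2 : |f w σs + g w σs| ≤ 2 * max |f w σs| |g w σs| := by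
      have := le_max_left |f w σs| |g w σs|
      have := le_max_right |f w σs| |g w σs|
      linarith [abs_add_le (f w σs) (g w σs)]
    refine (pow_le_pow_left₀ (abs_nonneg _) h2 p).trans ?_
    rw [mul_pow]
    refine mul_le_mul_of_nonneg_left ?_ (by positivity)
    rcases max_choice |f w σs| |g w σs| with h3 | h3 <;> rw [h3]
    · exact le_add_of_nonneg_right (by positivity)
    · exact le_add_of_nonneg_left (by positivity)
  refine (nu_mono _ _ h1).trans ?_
  rw [nu_const_mul, nu_add, mul_assoc, add_mul]
  exact mul_le_mul_of_nonneg_left (add_le_add (hC w) (hC' w)) (by positivity)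

theorem mul (hf : MomBdd j f) (hg : MomBdd j' g) :
    MomBdd (j + j') fun w σs => f w σs * g w σs := by
  intro p
  obtain ⟨C, hC⟩ := hf (2 * p)
  obtain ⟨C', hC'⟩ := hg (2 * p)
  refine ⟨C + C', fun w => ?_⟩
  set R := w.r ^ (j * p) with hR
  set R' := w.r ^ (j' * p) with hR'
  have hr : 0 < R := pow_pos w.r_pos _
  have hr' : 0 < R' := pow_pos w.r_pos _
  have h1 : ∀ σs, |f w σs * g w σs| ^ p ≤
      R' * R⁻¹ * |f w σs| ^ (2 * p) + R * R'⁻¹ * |g w σs| ^ (2 * p) := by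
    intro σs
    rw [abs_mul, mul_pow]
    have h2 : |f w σs| ^ (2 * p) = (|f w σs| ^ p) ^ 2 := by rw [← pow_mul, mul_comm]
    have h2' : |g w σs| ^ (2 * p) = (|g w σs| ^ p) ^ 2 := by rw [← pow_mul, mul_comm]
    rw [h2, h2']
    have hx : 0 ≤ |f w σs| ^ p := by positivity
    have hy : 0 ≤ |g w σs| ^ p := by positivity
    set x := |f w σs| ^ p
    set y := |g w σs| ^ p
    have h3 : R' * R⁻¹ * x ^ 2 + R * R'⁻¹ * y ^ 2 = R * R' * ((R⁻¹ * x) ^ 2 + (R'⁻¹ * y) ^ 2) := by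
      field_simp
    have h4 : x * y = R * R' * ((R⁻¹ * x) * (R'⁻¹ * y)) := by field_simp
    rw [h3, h4]
    refine mul_le_mul_of_nonneg_left ?_ (by positivity)
    nlinarith [sq_nonneg (R⁻¹ * x - R'⁻¹ * y), sq_nonneg (R⁻¹ * x), sq_nonneg (R'⁻¹ * y)]
  refine (nu_mono _ _ h1).trans ?_
  rw [nu_add, nu_const_mul, nu_const_mul]
  have h5 := mul_le_mul_of_nonneg_left (hC w) (show 0 ≤ R' * R⁻¹ by positivity)
  have h6 := mul_le_mul_of_nonneg_left (hC' w) (show 0 ≤ R * R'⁻¹ by positivity)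
  have e1 : w.r ^ (j * (2 * p)) = R * R := by rw [hR, ← pow_add]; ring_nf
  have e2 : w.r ^ (j' * (2 * p)) = R' * R' := by rw [hR', ← pow_add]; ring_nf
  have e3 : w.r ^ ((j + j') * p) = R * R' := by rw [hR, hR', ← pow_add, add_mul]
  rw [e1] at h5
  rw [e2] at h6
  rw [e3]
  have h7 : R' * R⁻¹ * (C * (R * R)) = C * (R * R') := by field_simp
  have h8 : R * R'⁻¹ * (C' * (R' * R')) = C' * (R * R') := by field_simp
  rw [h7] at h5
  rw [h8] at h6
  rw [add_mul]
  exact add_le_add h5 h6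

theorem const_mul {a : CavPar → ℝ} {B : ℝ} (ha : ∀ w, |a w| ≤ B) (hf : MomBdd j f) :
    MomBdd j fun w σs => a w * f w σs := by
  have := (of_bdd (f := fun w (_ : ι → Cfg w.N) => a w) fun w _ => ha w).mul hf
  rwa [zero_add] at this

theorem neg (hf : MomBdd j f) : MomBdd j fun w σs => -f w σs :=
  hf.mono fun w σs => by rw [abs_neg]

theorem sub (hf : MomBdd j f) (hg : MomBdd j g) : MomBdd j fun w σs => f w σs - g w σs := by
  simpa only [sub_eq_add_neg] using hf.add hg.neg

theorem zero : MomBdd j fun w (_ : ι → Cfg w.N) => 0 :=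
  of_le (B := 0) fun w σs => by simp

theorem sum {κ : Type*} {s : Finset κ} {f : κ → ReplicaFun ι} (hf : ∀ k ∈ s, MomBdd j (f k)) :
    MomBdd j fun w σs => ∑ k ∈ s, f k w σs := by
  classical
  induction s using Finset.induction_on with
  | empty => simpa using zero
  | insert a s ha ih =>
    simp only [Finset.sum_insert ha]
    exact (hf a (Finset.mem_insert_self _ _)).add
      (ih fun k hk => hf k (Finset.mem_insert_of_mem hk))

theorem one : MomBdd 0 fun w (_ : ι → Cfg w.N) => 1 :=
  of_bdd (B := 1) fun w σs => by simp

theorem mul_zero (hf : MomBdd j f) (hg : MomBdd 0 g) : MomBdd j fun w σs => f w σs * g w σs :=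
  hf.mul hg

theorem prod {κ : Type*} {s : Finset κ} {f : κ → ReplicaFun ι} (hf : ∀ k ∈ s, MomBdd 0 (f k)) :
    MomBdd 0 fun w σs => ∏ k ∈ s, f k w σs := by
  classical
  induction s using Finset.induction_on with
  | empty => simpa using one
  | insert a s ha ih =>
    simp only [Finset.prod_insert ha]
    exact (hf a (Finset.mem_insert_self _ _)).mul_zero
      (ih fun k hk => hf k (Finset.mem_insert_of_mem hk))

theorem pow (hf : MomBdd 0 f) (k : ℕ) : MomBdd 0 fun w σs => f w σs ^ k := by
  simpa using prod (s := Finset.range k) (f := fun _ => f) fun _ _ => hf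

theorem comp {f : ReplicaFun ι'} (hf : MomBdd j f) {e : ι' → ι} (he : Function.Injective e) :
    MomBdd j fun w (σs : ι → Cfg w.N) => f w fun l => σs (e l) := fun p => by
  obtain ⟨C, hC⟩ := hf p
  refine ⟨C, fun w => ?_⟩
  have := nu_comp_injective w.β w.h he fun σs => |f w σs| ^ p
  exact this.trans_le (hC w)

theorem abs (hf : MomBdd j f) : MomBdd j fun w σs => |f w σs| :=
  hf.mono fun w σs => by rw [abs_abs]

end MomBdd

section Sizes

variable {ι : Type} [DecidableEq ι] [Fintype ι]

theorem MomBdd.of_pair {j : ℕ} {f : ∀ w : CavPar, Cfg w.N → Cfg w.N → ℝ}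
    (hf : ∀ k : ℕ, ∃ C : ℝ, ∀ w : CavPar,
      w.av (fun σs : Fin 2 → Cfg w.N => |f w (σs 0) (σs 1)| ^ (2 * k)) ≤ C * w.r ^ (j * (2 * k)))
    {a b : ι} (hab : a ≠ b) : MomBdd j fun w (σs : ι → Cfg w.N) => f w (σs a) (σs b) := by
  refine MomBdd.of_even fun k => ?_
  obtain ⟨C, hC⟩ := hf k
  refine ⟨C, fun w => ?_⟩
  have := nu_pair w.β w.h hab fun σ τ => |f w σ τ| ^ (2 * k)
  exact this.trans_le (hC w)

theorem momBdd_overlap_sub {a b : ι} (hab : a ≠ b) :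
    MomBdd 1 fun w (σs : ι → Cfg w.N) => overlap w.N (σs a) (σs b) - w.q := by
  refine MomBdd.of_pair (f := fun w σ τ => overlap w.N σ τ - w.q) (fun k => ?_) hab
  simpa only [one_mul] using exists_overlap_moment k

theorem momBdd_one_div_size {ι : Type} [DecidableEq ι] [Fintype ι] :
    MomBdd 1 fun w (_ : ι → Cfg w.N) => 1 / (w.N : ℝ) :=
  MomBdd.of_le (B := 1) fun w _ => by
    rw [← w.r_sq, abs_of_nonneg (by have := w.r_pos; positivity)]
    nlinarith [w.r_le_one, w.r_pos]

theorem momBdd_cavOverlap_sub {a b : ι} (hab : a ≠ b) :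
    MomBdd 1 fun w (σs : ι → Cfg w.N) => cavOverlap w.N w.i (σs a) (σs b) - w.q :=
  ((momBdd_overlap_sub hab).abs.add momBdd_one_div_size).mono fun w _ =>
    (abs_cavOverlap_sub_le w.q w.i _ _).trans (le_abs_self _)

theorem momBdd_cavInter {a b : ι} (hab : a ≠ b) :
    MomBdd 1 fun w (σs : ι → Cfg w.N) => cavInter w.N w.q w.i (σs a) (σs b) :=
  (momBdd_cavOverlap_sub hab).mono fun w _ => (abs_cavInter w.q w.i _ _).le

theorem momBdd_overlapFluct :
    MomBdd 1 fun w (σs : ι → Cfg w.N) => overlapFluct w.N w.q σs :=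
  MomBdd.sum fun _ _ => MomBdd.sum fun _ hb =>
    (momBdd_overlap_sub (Finset.ne_of_mem_erase hb).symm).abs.add momBdd_one_div_size

theorem momBdd_spinDiff {a b : ι} (hab : a ≠ b) :
    MomBdd 0 fun w (σs : ι → Cfg w.N) => spinDiff w (σs a) (σs b) := by
  refine MomBdd.of_pair (f := fun w σ τ => spinDiff w σ τ) (fun k => ?_) hab
  simpa only [zero_mul, pow_zero, mul_one] using exists_spinDiff_moment k

theorem momBdd_spin (a : ι) : MomBdd 0 fun w (σs : ι → Cfg w.N) => spin (σs a w.i) :=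
  MomBdd.of_bdd fun _ _ => (abs_spin _).le

theorem momBdd_site_weight {ι : Type} [DecidableEq ι] [Fintype ι] :
    MomBdd 0 fun w (_ : ι → Cfg w.N) => w.t w.i :=
  MomBdd.of_bdd fun w _ => w.abs_t_le w.i

theorem momBdd_spinDiffCav {a b : ι} (hab : a ≠ b) :
    MomBdd 0 fun w (σs : ι → Cfg w.N) => spinDiffCav w w.i (σs a) (σs b) := by
  refine ((momBdd_spinDiff hab).sub (momBdd_site_weight.mul_zero
    ((momBdd_spin a).sub (momBdd_spin b)))).mono fun w σs => le_of_eq ?_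
  rw [spinDiff_eq w w.i, add_sub_cancel_right]

end Sizes

section Expansion

variable {ι : Type} [DecidableEq ι] [Fintype ι] {j : ℕ} {f : ReplicaFun ι}

theorem injective_some_some : Function.Injective fun l : ι => some (some l) :=
  fun a b hab => by simpa using hab

theorem zero_mem_path : (0 : ℝ) ∈ Set.Icc 0 (Real.pi / 2) :=
  ⟨le_rfl, by positivity⟩

theorem end_mem_path : Real.pi / 2 ∈ Set.Icc 0 (Real.pi / 2) :=
  ⟨by positivity, le_rfl⟩

theorem CavPar.cavAv_end (w : CavPar) (f : (ι → Cfg w.N) → ℝ) :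
    w.cavAv (Real.pi / 2) f = w.av f := cav_pi_div_two _ _ _ _ _ _

theorem MomBdd.exists_abs_cavAv_sub_le (hf : MomBdd j f) : ∃ C : ℝ, 0 ≤ C ∧ ∀ w : CavPar,
    ∀ θ ∈ Set.Icc 0 (Real.pi / 2), |w.cavAv θ (f w) - w.cavAv 0 (f w)| ≤ C * w.r ^ (j + 1) := by
  have h1 := ((hf.comp injective_some_some).abs.mul
    (momBdd_overlapFluct (ι := Option (Option ι)))) 1
  obtain ⟨C, hC⟩ := h1
  have hD := diffConst_pos (Fintype.card ι)
  refine ⟨diffConst (Fintype.card ι) * |C|, by positivity, fun w θ hθ => ?_⟩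
  refine (abs_cav_sub_le w.abs_β_le w.q_nonneg w.q_le w.i hθ zero_mem_path
    (f := f w) (g := fun σs => |f w σs|) fun σs => le_rfl).trans ?_
  have h2 := hC w
  simp only [pow_one, mul_one] at h2
  have h3 : w.av (fun σs : Option (Option ι) → Cfg w.N =>
      |f w fun l => σs (some (some l))| * overlapFluct w.N w.q σs) ≤ |C| * w.r ^ (j + 1) := by
    refine (nu_mono _ _ fun σs => le_abs_self _).trans (h2.trans ?_)
    exact mul_le_mul_of_nonneg_right (le_abs_self C) (pow_pos w.r_pos _).le
  have hβ : w.β ^ 2 ≤ 1 := by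
    rw [← sq_abs]; exact pow_le_one₀ (abs_nonneg _) w.abs_β_le
  have h0 : 0 ≤ |C| * w.r ^ (j + 1) := by have := w.r_pos; positivity
  have h4 := mul_le_mul_of_nonneg_left h3 hD.le
  refine (mul_le_mul_of_nonneg_left h4 (sq_nonneg _)).trans ?_
  refine (mul_le_mul_of_nonneg_right hβ (by positivity)).trans ?_
  rw [one_mul, mul_assoc]

theorem isBigO_top_of_abs_le {α : Type*} {a e : α → ℝ} {C : ℝ} (h : ∀ x, |a x| ≤ C * e x)
    (he : ∀ x, 0 ≤ e x) : a =O[⊤] e :=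
  isBigO_top.2 ⟨C, fun x => by
    rw [Real.norm_eq_abs, Real.norm_of_nonneg (he x)]; exact h x⟩

theorem MomBdd.av_sub_cavAv_isBigO (hf : MomBdd j f) :
    (fun w : CavPar => w.av (f w) - w.cavAv 0 (f w)) =O[⊤] fun w => w.r ^ (j + 1) := by
  obtain ⟨C, _, hC⟩ := hf.exists_abs_cavAv_sub_le
  exact isBigO_top_of_abs_le (fun w => w.cavAv_end (f w) ▸ hC w _ end_mem_path)
    fun w => (pow_pos w.r_pos _).le

theorem MomBdd.av_isBigO (hf : MomBdd j f) :
    (fun w : CavPar => w.av (f w)) =O[⊤] fun w => w.r ^ j := by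
  obtain ⟨C, hC⟩ := hf 1
  refine isBigO_top_of_abs_le (C := C) (fun w => ?_) fun w => (pow_pos w.r_pos _).le
  have := hC w
  simp only [pow_one, mul_one] at this
  exact (abs_nu_le_of_abs_le _ _ fun σs => le_rfl).trans this

/-- The derivative of the cavity path at `0`, up to the time change. -/
def CavPar.cavSlope (w : CavPar) (f : (ι → Cfg w.N) → ℝ) : ℝ :=
  cavDerivSum w.N w.β w.h w.q w.i 0 f

theorem MomBdd.av_expansion (hf : MomBdd 0 f) :
    (fun w : CavPar => w.av (f w) - w.cavAv 0 (f w) - w.β ^ 2 / 2 * w.cavSlope (f w)) =O[⊤]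
      fun w => w.r ^ 2 := by
  have h1 : ∀ (a : Option ι) (b : Option (Option ι)), ∃ C : ℝ, 0 ≤ C ∧ (b ≠ some a →
      ∀ w : CavPar, ∀ θ ∈ Set.Icc 0 (Real.pi / 2),
      |w.cavAv θ (fun σs => f w (fun l => σs (some (some l))) *
          cavInter w.N w.q w.i (σs (some a)) (σs b)) -
        w.cavAv 0 (fun σs => f w (fun l => σs (some (some l))) *
          cavInter w.N w.q w.i (σs (some a)) (σs b))| ≤ C * w.r ^ 2) := by
    intro a b
    by_cases hab : b = some a
    · exact ⟨0, le_rfl, fun h => absurd hab h⟩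
    · obtain ⟨C, hC0, hC⟩ := ((hf.comp injective_some_some).mul
        (momBdd_cavInter (Ne.symm hab))).exists_abs_cavAv_sub_le
      exact ⟨C, hC0, fun _ => hC⟩
  choose C hC0 hC using h1
  set K : ℝ := ∑ a : Option ι, ∑ b ∈ Finset.univ.erase (some a),
    weightBound (Fintype.card ι) * C a b with hK
  have hK0 : 0 ≤ K := Finset.sum_nonneg fun a _ => Finset.sum_nonneg fun b _ =>
    mul_nonneg (weightBound_pos _).le (hC0 a b)
  have h2 : ∀ w : CavPar, ∀ θ ∈ Set.Icc 0 (Real.pi / 2),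
      |cavDerivSum w.N w.β w.h w.q w.i θ (f w) - w.cavSlope (f w)| ≤ K * w.r ^ 2 := by
    intro w θ hθ
    unfold CavPar.cavSlope cavDerivSum
    rw [← Finset.sum_sub_distrib, hK, Finset.sum_mul]
    refine (Finset.abs_sum_le_sum_abs _ _).trans (Finset.sum_le_sum fun a _ => ?_)
    rw [← Finset.sum_sub_distrib, Finset.sum_mul]
    refine (Finset.abs_sum_le_sum_abs _ _).trans (Finset.sum_le_sum fun b hb => ?_)
    rw [← mul_sub, abs_mul, mul_assoc]
    exact mul_le_mul (abs_repWeight_mul_le a b) (hC a b (Finset.ne_of_mem_erase hb) w θ hθ)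
      (abs_nonneg _) (weightBound_pos _).le
  refine isBigO_top_of_abs_le (C := K * (Real.pi / 2)) (fun w => ?_)
    fun w => (pow_pos w.r_pos _).le
  set s := w.cavSlope (f w) with hs
  have h3 : ∀ θ, HasDerivAt (fun θ => w.cavAv θ (f w) - w.β ^ 2 / 2 * s * Real.sin θ ^ 2)
      (w.β ^ 2 * (Real.sin θ * Real.cos θ) * (cavDerivSum w.N w.β w.h w.q w.i θ (f w) - s))
      θ := by
    intro θ
    have h4 : HasDerivAt (fun θ => w.cavAv θ (f w))
        (w.β ^ 2 * (Real.sin θ * Real.cos θ) * cavDerivSum w.N w.β w.h w.q w.i θ (f w)) θ :=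
      hasDerivAt_cav w.N w.i.pos w.β w.h w.q_nonneg w.i (f w) θ
    have h5 := h4.sub (((Real.hasDerivAt_sin θ).pow 2).const_mul (w.β ^ 2 / 2 * s))
    convert! h5 using 1
    push_cast
    ring
  have hβ : w.β ^ 2 ≤ 1 := by
    rw [← sq_abs]; exact pow_le_one₀ (abs_nonneg _) w.abs_β_le
  have h6 := (convex_Icc 0 (Real.pi / 2)).norm_image_sub_le_of_norm_hasDerivWithin_le
    (f := fun θ => w.cavAv θ (f w) - w.β ^ 2 / 2 * s * Real.sin θ ^ 2)
    (C := K * w.r ^ 2) (fun θ _ => (h3 θ).hasDerivWithinAt) (fun θ hθ => by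
      rw [Real.norm_eq_abs, abs_mul, abs_mul, abs_of_nonneg (sq_nonneg w.β)]
      have h7 : w.β ^ 2 * |Real.sin θ * Real.cos θ| ≤ 1 := by
        refine mul_le_one₀ hβ (abs_nonneg _) ?_
        rw [abs_mul]
        exact mul_le_one₀ (Real.abs_sin_le_one θ) (abs_nonneg _) (Real.abs_cos_le_one θ)
      exact (mul_le_of_le_one_left (abs_nonneg _) h7).trans (h2 w θ hθ))
    zero_mem_path end_mem_path
  simp only [Real.norm_eq_abs, Real.sin_pi_div_two, Real.sin_zero, sub_zero,
    abs_of_pos (div_pos Real.pi_pos two_pos), w.cavAv_end] at h6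
  refine (le_of_eq ?_).trans (h6.trans (le_of_eq (by ring)))
  congr 1
  ring

end Expansion

namespace CavPar

variable (w : CavPar) {ι : Type} [DecidableEq ι] [Fintype ι]

theorem av_add (f g : (ι → Cfg w.N) → ℝ) : w.av (fun σs => f σs + g σs) = w.av f + w.av g :=
  nu_add _ _ _ _

theorem av_const_mul (c : ℝ) (f : (ι → Cfg w.N) → ℝ) :
    w.av (fun σs => c * f σs) = c * w.av f :=
  nu_const_mul _ _ _ _

theorem cavAv_sub (f g : (ι → Cfg w.N) → ℝ) :
    w.cavAv 0 (fun σs => f σs - g σs) = w.cavAv 0 f - w.cavAv 0 g :=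
  cav_sub _ _ _ _ _ _ _

theorem cavAv_const_mul (c : ℝ) (f : (ι → Cfg w.N) → ℝ) :
    w.cavAv 0 (fun σs => c * f σs) = c * w.cavAv 0 f :=
  cav_const_mul _ _ _ _ _ _ _

/-- The moments of the local magnetization in the replica symmetric approximation. -/
def mag (k : ℕ) : ℝ := tanhMoment (w.β * √w.q) w.h k

theorem mag_two : w.mag 2 = w.q := w.q_eq

theorem abs_mag_le (k : ℕ) : |w.mag k| ≤ 1 := abs_tanhMoment_le _ _ _

theorem cavAv_prod_spin_mul (A : Finset ι) {g : (ι → Cfg w.N) → ℝ}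
    (hg : SiteFree w.i Set.univ g) :
    w.cavAv 0 (fun σs => (∏ a ∈ A, spin (σs a w.i)) * g σs) = w.mag A.card * w.cavAv 0 g :=
  cav_zero_prod_spin_mul _ _ _ _ _ hg

/-- The order of the one-site error terms. -/
def siteErr : ℝ := w.t w.i ^ 2 + w.r ^ 2

theorem siteErr_nonneg : 0 ≤ w.siteErr := by unfold siteErr; positivity

end CavPar

theorem sq_site_isBigO : (fun w : CavPar => w.t w.i ^ 2) =O[⊤] CavPar.siteErr :=
  isBigO_top_of_abs_le (C := 1) (fun w => by
    rw [abs_of_nonneg (sq_nonneg _), one_mul, CavPar.siteErr]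
    linarith [sq_nonneg w.r]) fun w => w.siteErr_nonneg

theorem sq_scale_isBigO : (fun w : CavPar => w.r ^ 2) =O[⊤] CavPar.siteErr :=
  isBigO_top_of_abs_le (C := 1) (fun w => by
    rw [abs_of_nonneg (sq_nonneg _), one_mul, CavPar.siteErr]
    linarith [sq_nonneg (w.t w.i)]) fun w => w.siteErr_nonneg

theorem site_mul_scale_isBigO : (fun w : CavPar => w.t w.i * w.r) =O[⊤] CavPar.siteErr :=
  isBigO_top_of_abs_le (C := 1) (fun w => by
    rw [CavPar.siteErr, abs_le]
    constructor <;> nlinarith [sq_nonneg (w.t w.i + w.r), sq_nonneg (w.t w.i - w.r)])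
    fun w => w.siteErr_nonneg

theorem isBigO_of_bdd {a : CavPar → ℝ} {B : ℝ} (h : ∀ w, |a w| ≤ B) :
    a =O[⊤] fun _ : CavPar => (1 : ℝ) :=
  isBigO_top_of_abs_le (C := B) (fun w => by simpa using h w) fun _ => zero_le_one

theorem bdd_mul_isBigO {a b e : CavPar → ℝ} {B : ℝ} (h : ∀ w, |a w| ≤ B) (hb : b =O[⊤] e) :
    (fun w => a w * b w) =O[⊤] e := by
  simpa only [one_mul] using (isBigO_of_bdd h).mul hb

section SiteSplit

variable {ι : Type} [DecidableEq ι] [Fintype ι]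

/-- `f'` does not depend on the spins at the distinguished site and `f - f'` has the order of the
weight of that site. -/
structure SiteSplit (f f' : ReplicaFun ι) : Prop where
  momBdd : MomBdd 0 f
  momBdd_cav : MomBdd 0 f'
  siteFree : ∀ w, SiteFree w.i Set.univ (f' w)
  diff : ∃ G : ReplicaFun ι, MomBdd 0 G ∧ ∀ w σs, f w σs = f' w σs + w.t w.i * G w σs

namespace SiteSplit

variable {f f' g g' : ReplicaFun ι}

theorem mul (hf : SiteSplit f f') (hg : SiteSplit g g') :
    SiteSplit (fun w σs => f w σs * g w σs) fun w σs => f' w σs * g' w σs := by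
  obtain ⟨G, hG, hG'⟩ := hf.diff
  obtain ⟨H, hH, hH'⟩ := hg.diff
  refine ⟨hf.momBdd.mul_zero hg.momBdd, hf.momBdd_cav.mul_zero hg.momBdd_cav,
    fun w => (hf.siteFree w).mul (hg.siteFree w),
    fun w σs => G w σs * g w σs + f' w σs * H w σs,
    (hG.mul_zero hg.momBdd).add (hf.momBdd_cav.mul_zero hH), fun w σs => ?_⟩
  dsimp only
  rw [hG' w σs, hH' w σs]
  ring

theorem one : SiteSplit (fun w (_ : ι → Cfg w.N) => 1) fun _ _ => 1 :=
  ⟨MomBdd.one, MomBdd.one, fun _ => siteFree_const _, fun _ _ => 0, MomBdd.zero,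
    fun w σs => by simp⟩

theorem prod {κ : Type*} {s : Finset κ} {f f' : κ → ReplicaFun ι}
    (hf : ∀ k ∈ s, SiteSplit (f k) (f' k)) :
    SiteSplit (fun w σs => ∏ k ∈ s, f k w σs) fun w σs => ∏ k ∈ s, f' k w σs := by
  classical
  induction s using Finset.induction_on with
  | empty => simpa using one
  | insert a s ha ih =>
    simp only [Finset.prod_insert ha]
    exact (hf a (Finset.mem_insert_self _ _)).mul
      (ih fun k hk => hf k (Finset.mem_insert_of_mem hk))

theorem pow (hf : SiteSplit f f') (k : ℕ) :
    SiteSplit (fun w σs => f w σs ^ k) fun w σs => f' w σs ^ k := by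
  simpa using prod (s := Finset.range k) (f := fun _ => f) (f' := fun _ => f') fun _ _ => hf

end SiteSplit

theorem momBdd_spin_sub (x y : ι) :
    MomBdd 0 fun w (σs : ι → Cfg w.N) => spin (σs x w.i) - spin (σs y w.i) :=
  (momBdd_spin x).sub (momBdd_spin y)

theorem siteSplit_spinDiff {x y : ι} (hxy : x ≠ y) :
    SiteSplit (fun w (σs : ι → Cfg w.N) => spinDiff w (σs x) (σs y))
      fun w σs => spinDiffCav w w.i (σs x) (σs y) :=
  ⟨momBdd_spinDiff hxy, momBdd_spinDiffCav hxy, fun w => siteFree_spinDiffCav w w.i x y,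
    fun w σs => spin (σs x w.i) - spin (σs y w.i), momBdd_spin_sub x y,
    fun w _ => spinDiff_eq w w.i _ _⟩

theorem MomBdd.exists_pow_expansion {X U : ReplicaFun ι} (hX : MomBdd 0 X) (hU : MomBdd 0 U)
    (k : ℕ) : ∃ G : ReplicaFun ι, MomBdd 0 G ∧ ∀ w σs, (X w σs + U w σs) ^ (k + 1) =
      X w σs ^ (k + 1) + U w σs * ((k + 1) * X w σs ^ k + U w σs * G w σs) := by
  induction k with
  | zero => exact ⟨fun _ _ => 0, MomBdd.zero, fun w σs => by simp⟩
  | succ k ih =>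
    obtain ⟨G, hG, hG'⟩ := ih
    refine ⟨fun w σs => (k + 1) * X w σs ^ k + (X w σs + U w σs) * G w σs,
      (MomBdd.const_mul (a := fun _ => (k : ℝ) + 1) (fun _ => le_rfl) (hX.pow k)).add
        ((hX.add hU).mul_zero hG), fun w σs => ?_⟩
    rw [pow_succ (X w σs + U w σs), hG' w σs]
    push_cast
    ring

end SiteSplit

section SiteExpansion

variable {ι : Type} [DecidableEq ι] [Fintype ι] {f f' : ReplicaFun ι}

theorem MomBdd.sq_site_mul_isBigO (hf : MomBdd 0 f) :
    (fun w : CavPar => w.t w.i ^ 2 * w.av (f w)) =O[⊤] CavPar.siteErr := by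
  simpa only [pow_zero, mul_one] using sq_site_isBigO.mul hf.av_isBigO

theorem MomBdd.site_mul_av_sub_isBigO (hf : MomBdd 0 f) :
    (fun w : CavPar => w.t w.i * (w.av (f w) - w.cavAv 0 (f w))) =O[⊤] CavPar.siteErr := by
  have h1 := (isBigO_refl (fun w : CavPar => w.t w.i) ⊤).mul hf.av_sub_cavAv_isBigO
  simp only [zero_add, pow_one] at h1
  exact h1.trans site_mul_scale_isBigO

theorem SiteSplit.site_mul_av_sub_isBigO (hf : SiteSplit f f') :
    (fun w : CavPar => w.t w.i * (w.av (f w) - w.cavAv 0 (f' w))) =O[⊤] CavPar.siteErr := by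
  obtain ⟨G, hG, hG'⟩ := hf.diff
  refine (hf.momBdd_cav.site_mul_av_sub_isBigO.add hG.sq_site_mul_isBigO).congr_left fun w => ?_
  have h1 : w.av (f w) = w.av (f' w) + w.t w.i * w.av (G w) := by
    rw [← w.av_const_mul, ← w.av_add]
    congr 1
    funext σs
    exact hG' w σs
  rw [h1]
  ring

/-- The coefficient of the linear response in the weight of the site. -/
def CavPar.linResp (w : CavPar) : ℝ := 2 * (w.mag 1 - w.mag 3)

theorem CavPar.abs_linResp_le (w : CavPar) : |w.linResp| ≤ 4 := by
  unfold CavPar.linResp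
  have h1 := abs_le.1 (w.abs_mag_le 1)
  have h3 := abs_le.1 (w.abs_mag_le 3)
  exact abs_le.2 ⟨by linarith, by linarith⟩

theorem CavPar.cavAv_sq_spin_sub_mul (w : CavPar) {x y b : ι} (hxy : x ≠ y) (hbx : b ≠ x)
    (hby : b ≠ y) {g : (ι → Cfg w.N) → ℝ} (hg : SiteFree w.i Set.univ g) :
    w.cavAv 0 (fun σs => (spin (σs x w.i) - spin (σs y w.i)) ^ 2 * spin (σs b w.i) * g σs) =
      w.linResp * w.cavAv 0 g := by
  have h1 := w.cavAv_prod_spin_mul {b} hg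
  have h3 := w.cavAv_prod_spin_mul {x, y, b} hg
  have hx : x ∉ ({y, b} : Finset ι) := by simp [hxy, hbx.symm]
  have hy : y ∉ ({b} : Finset ι) := by simp [hby.symm]
  rw [Finset.card_insert_of_notMem hx, Finset.card_insert_of_notMem hy] at h3
  simp only [Finset.prod_insert hx, Finset.prod_insert hy, Finset.prod_singleton,
    Finset.card_singleton] at h1 h3
  have h4 : (fun σs : ι → Cfg w.N =>
      (spin (σs x w.i) - spin (σs y w.i)) ^ 2 * spin (σs b w.i) * g σs) = fun σs =>
      2 * (spin (σs b w.i) * g σs - spin (σs x w.i) * (spin (σs y w.i) * spin (σs b w.i)) *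
        g σs) := by
    funext σs
    linear_combination (spin (σs b w.i) * g σs) *
      (spin_mul_self (σs x w.i) + spin_mul_self (σs y w.i))
  rw [h4, w.cavAv_const_mul, w.cavAv_sub, h1, h3, CavPar.linResp]
  ring

theorem av_spin_sub_mul_isBigO {x y b : ι} (hxy : x ≠ y) (hbx : b ≠ x) (hby : b ≠ y)
    {P P' : ReplicaFun ι} (hP : SiteSplit P P') (hfree : ∀ w, SiteFree w.i {x, y} (P w)) (k : ℕ) :
    (fun w : CavPar =>
      w.av (fun σs => (spin (σs x w.i) - spin (σs y w.i)) * spin (σs b w.i) *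
        (spinDiff w (σs x) (σs y) ^ (k + 1) * P w σs)) -
      w.av (fun σs => (spin (σs x w.i) - spin (σs y w.i)) * spin (σs b w.i) *
        (spinDiffCav w w.i (σs x) (σs y) ^ (k + 1) * P' w σs)) -
      (k + 1) * w.linResp * (w.t w.i *
        w.av (fun σs => spinDiff w (σs x) (σs y) ^ k * P w σs))) =O[⊤] CavPar.siteErr := by
  obtain ⟨G, hG, hG'⟩ := hP.diff
  have hD := momBdd_spin_sub x y
  have hU := momBdd_site_weight.mul_zero hD
  obtain ⟨H, hH, hH'⟩ := (momBdd_spinDiffCav hxy).exists_pow_expansion hU k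
  set D : ReplicaFun ι := fun w σs => spin (σs x w.i) - spin (σs y w.i) with hDdef
  set S : ReplicaFun ι := fun w σs => spinDiffCav w w.i (σs x) (σs y) with hS
  set A1 : ReplicaFun ι := fun w σs => D w σs * (spin (σs b w.i) * (S w σs ^ (k + 1) * G w σs))
    with hA1
  set A2 : ReplicaFun ι := fun w σs => D w σs ^ 2 * spin (σs b w.i) * (S w σs ^ k * P' w σs)
    with hA2
  set A3 : ReplicaFun ι := fun w σs => (k + 1) * (D w σs ^ 2 * spin (σs b w.i) *
    (S w σs ^ k * G w σs)) + D w σs ^ 3 * spin (σs b w.i) * (H w σs * P w σs) with hA3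
  have hSb : MomBdd 0 S := momBdd_spinDiffCav hxy
  have hA1b : MomBdd 0 A1 := hD.mul_zero ((momBdd_spin b).mul_zero ((hSb.pow _).mul_zero hG))
  have hA2b : MomBdd 0 A2 := ((hD.pow 2).mul_zero (momBdd_spin b)).mul_zero
    ((hSb.pow _).mul_zero hP.momBdd_cav)
  have hA3b : MomBdd 0 A3 := (MomBdd.const_mul (a := fun _ => (k : ℝ) + 1) (fun _ => le_rfl)
    (((hD.pow 2).mul_zero (momBdd_spin b)).mul_zero ((hSb.pow _).mul_zero hG))).add
    (((hD.pow 3).mul_zero (momBdd_spin b)).mul_zero (hH.mul_zero hP.momBdd))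
  have hsplit : ∀ w : CavPar, w.av (fun σs => D w σs * spin (σs b w.i) *
        (spinDiff w (σs x) (σs y) ^ (k + 1) * P w σs)) =
      w.av (fun σs => D w σs * spin (σs b w.i) * (S w σs ^ (k + 1) * P' w σs)) +
        w.t w.i * w.av (A1 w) + w.t w.i * (k + 1) * w.av (A2 w) + w.t w.i ^ 2 * w.av (A3 w) := by
    intro w
    rw [← w.av_const_mul, ← w.av_const_mul, ← w.av_const_mul, ← w.av_add, ← w.av_add,
      ← w.av_add]
    congr 1
    funext σs
    have h1 := hH' w σs
    have h2 := hG' w σs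
    rw [spinDiff_eq w w.i]
    simp only [hS, hDdef, hA1, hA2, hA3] at h1 ⊢
    rw [h1, h2]
    ring
  have hzero : ∀ w : CavPar, w.t w.i * w.cavAv 0 (A1 w) = 0 := by
    intro w
    have h1 : SiteFree w.i {x, y} fun σs : ι → Cfg w.N =>
        spin (σs b w.i) * (S w σs ^ (k + 1) * (P w σs - P' w σs)) :=
      (siteFree_spin (Or.inl (by simp [hbx, hby]))).mul
        (((siteFree_spinDiffCav w w.i x y).pow _).mul
          ((hfree w).sub ((hP.siteFree w).subset (Set.subset_univ _))))
    have h2 := cav_zero_spin_sub_mul w.β w.h w.q w.i h1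
    rw [← w.cavAv_const_mul, ← h2]
    unfold CavPar.cavAv
    congr 1
    funext σs
    rw [hG' w σs]
    simp only [hA1, hDdef]
    ring
  have hA2z : ∀ w : CavPar, w.cavAv 0 (A2 w) =
      w.linResp * w.cavAv 0 (fun σs => S w σs ^ k * P' w σs) := fun w =>
    w.cavAv_sq_spin_sub_mul hxy hbx hby
      (((siteFree_spinDiffCav w w.i x y).pow _).mul (hP.siteFree w))
  have hSk : SiteSplit (fun w (σs : ι → Cfg w.N) => spinDiff w (σs x) (σs y) ^ k * P w σs)
      fun w σs => S w σs ^ k * P' w σs := ((siteSplit_spinDiff hxy).pow k).mul hP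
  have hk : ∀ w : CavPar, |(k + 1) * w.linResp| ≤ |(k : ℝ) + 1| * 4 := fun w => by
    rw [abs_mul]
    exact mul_le_mul_of_nonneg_left w.abs_linResp_le (abs_nonneg _)
  refine (((hA1b.site_mul_av_sub_isBigO.add
    ((hA2b.site_mul_av_sub_isBigO).const_mul_left ((k : ℝ) + 1))).add
    hA3b.sq_site_mul_isBigO).sub (bdd_mul_isBigO hk hSk.site_mul_av_sub_isBigO)).congr_left
    fun w => ?_
  have h3 := hsplit w
  have h4 := hzero w
  have h5 := hA2z w
  simp only [hDdef, hS] at h3 ⊢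
  rw [h3, mul_sub, h4, h5]
  simp only [hS]
  ring

end SiteExpansion

theorem sum_sum_erase_eq_of_symm {κ : Type*} [Fintype κ] [DecidableEq κ] {X Y : κ} (hXY : X ≠ Y)
    {u v : κ → ℝ} {T : κ → κ → ℝ} (hsymm : ∀ a b, T a b = T b a)
    (h0 : ∀ a b, a ≠ X → a ≠ Y → b ≠ X → b ≠ Y → T a b = 0) (hT : T X Y = 0)
    (huX : u X = 1) (huY : u Y = 1) (hvX : v X = 1) (hvY : v Y = 1) :
    ∑ a, ∑ b ∈ Finset.univ.erase a, u a * v b * T a b =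
      ∑ c ∈ (Finset.univ.erase X).erase Y, (u c + v c) * (T X c + T Y c) := by
  have hY : Y ∈ (Finset.univ : Finset κ).erase X :=
    Finset.mem_erase.2 ⟨hXY.symm, Finset.mem_univ _⟩
  have hX : X ∈ (Finset.univ : Finset κ).erase Y := Finset.mem_erase.2 ⟨hXY, Finset.mem_univ _⟩
  rw [← Finset.add_sum_erase _ _ (Finset.mem_univ X), ← Finset.add_sum_erase _ _ hY,
    ← Finset.add_sum_erase _ _ hY, ← Finset.add_sum_erase _ _ hX, hsymm Y X, hT,
    Finset.erase_right_comm (a := Y) (b := X)]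
  have h1 : ∀ c ∈ (Finset.univ.erase X).erase Y,
      ∑ b ∈ Finset.univ.erase c, u c * v b * T c b = u c * (T X c + T Y c) := by
    intro c hc
    obtain ⟨hcY, hc⟩ := Finset.mem_erase.1 hc
    have hcX := Finset.ne_of_mem_erase hc
    rw [Finset.sum_eq_add X Y hXY (fun b _ hb => by rw [h0 c b hcX hcY hb.1 hb.2, mul_zero])
      (fun h => absurd (Finset.mem_erase.2 ⟨hcX.symm, Finset.mem_univ _⟩) h)
      (fun h => absurd (Finset.mem_erase.2 ⟨hcY.symm, Finset.mem_univ _⟩) h), hvX, hvY,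
      hsymm c X, hsymm c Y]
    ring
  rw [Finset.sum_congr rfl h1, mul_zero, zero_add, mul_zero, zero_add, ← add_assoc,
    ← Finset.sum_add_distrib, ← Finset.sum_add_distrib]
  refine Finset.sum_congr rfl fun c _ => ?_
  rw [huX, huY]
  ring

/-- The total weight of the replica `c` in the derivative of a function of `ι`-indexed replicas. -/
def pairWeight (ι : Type) [DecidableEq ι] [Fintype ι] (c : Option (Option ι)) : ℝ :=
  c.elim 0 (repWeight ι) + repWeight (Option ι) c

/-- The coefficient of the replica `c` in the first order response of a product with `b`. -/
def CavPar.respCoef (w : CavPar) {κ : Type} [DecidableEq κ] (b c : κ) : ℝ :=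
  if c = b then 1 - w.q else w.q - w.mag 4

theorem CavPar.abs_respCoef_le (w : CavPar) {κ : Type} [DecidableEq κ] (b c : κ) :
    |w.respCoef b c| ≤ 2 := by
  unfold CavPar.respCoef
  have h4 := abs_le.1 (w.abs_mag_le 4)
  have := w.q_nonneg
  have := w.q_le
  split_ifs
  · exact abs_le.2 ⟨by linarith, by linarith⟩
  · exact abs_le.2 ⟨by linarith, by linarith⟩

section Response

variable (w : CavPar) {κ : Type} [DecidableEq κ] [Fintype κ] {X Y B : κ}
  {g : (κ → Cfg w.N) → ℝ}

theorem siteFree_cavOverlap_sub (i : Fin w.N) (A : Set κ) (a b : κ) :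
    SiteFree i A fun σs : κ → Cfg w.N => cavOverlap w.N i (σs a) (σs b) - w.q :=
  (siteFree_cavOverlap a b).sub (siteFree_const _)

theorem CavPar.cavAv_one_sub_mul (hXY : X ≠ Y) (hBX : B ≠ X) (hBY : B ≠ Y) {c : κ} (hcX : c ≠ X)
    (hcY : c ≠ Y) (hg : SiteFree w.i Set.univ g) :
    w.cavAv 0 (fun σs => (1 - spin (σs X w.i) * spin (σs Y w.i)) *
      (spin (σs B w.i) * spin (σs c w.i)) * g σs) = w.respCoef B c * w.cavAv 0 g := by
  unfold CavPar.respCoef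
  split_ifs with hcB
  · subst hcB
    have h1 := w.cavAv_prod_spin_mul {X, Y} hg
    rw [Finset.card_pair hXY, w.mag_two] at h1
    simp only [Finset.prod_pair hXY] at h1
    rw [sub_mul, one_mul, ← h1, ← w.cavAv_sub]
    congr 1
    funext σs
    rw [spin_mul_self]
    ring
  · have hBc : B ≠ c := fun h => hcB h.symm
    have h1 := w.cavAv_prod_spin_mul {B, c} hg
    have h2 := w.cavAv_prod_spin_mul {X, Y, B, c} hg
    have hX : X ∉ ({Y, B, c} : Finset κ) := by simp [hXY, hBX.symm, hcX.symm]
    have hY : Y ∉ ({B, c} : Finset κ) := by simp [hBY.symm, hcY.symm]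
    rw [Finset.card_insert_of_notMem hX, Finset.card_insert_of_notMem hY,
      Finset.card_pair hBc] at h2
    rw [Finset.card_pair hBc, w.mag_two] at h1
    simp only [Finset.prod_insert hX, Finset.prod_insert hY, Finset.prod_pair hBc] at h1 h2
    rw [sub_mul, ← h1, ← h2, ← w.cavAv_sub]
    congr 1
    funext σs
    ring

theorem CavPar.cavAv_interaction_eq_zero (hBX : B ≠ X) (hBY : B ≠ Y) {a c : κ} (haX : a ≠ X)
    (haY : a ≠ Y) (hcX : c ≠ X) (hcY : c ≠ Y) (hg : SiteFree w.i Set.univ g) :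
    w.cavAv 0 (fun σs => (spin (σs X w.i) - spin (σs Y w.i)) * spin (σs B w.i) * g σs *
      cavInter w.N w.q w.i (σs a) (σs c)) = 0 := by
  have h1 : SiteFree w.i {X, Y} fun σs : κ → Cfg w.N =>
      spin (σs B w.i) * g σs * (spin (σs a w.i) * spin (σs c w.i) *
        (cavOverlap w.N w.i (σs a) (σs c) - w.q)) :=
    ((siteFree_spin (Or.inl (by simp [hBX, hBY]))).mul (hg.subset (Set.subset_univ _))).mul
      (((siteFree_spin (Or.inl (by simp [haX, haY]))).mul
        (siteFree_spin (Or.inl (by simp [hcX, hcY])))).mul (siteFree_cavOverlap_sub w _ _ _ _))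
  refine Eq.trans ?_ (cav_zero_spin_sub_mul w.β w.h w.q w.i h1)
  unfold CavPar.cavAv cavInter
  congr 1
  funext σs
  ring

theorem CavPar.cavAv_interaction_pair (hBX : B ≠ X) (hBY : B ≠ Y)
    (hg : SiteFree w.i Set.univ g) :
    w.cavAv 0 (fun σs => (spin (σs X w.i) - spin (σs Y w.i)) * spin (σs B w.i) * g σs *
      cavInter w.N w.q w.i (σs X) (σs Y)) = 0 := by
  have h1 : SiteFree w.i {X, Y} fun σs : κ → Cfg w.N =>
      spin (σs B w.i) * g σs * ((-1) * (cavOverlap w.N w.i (σs X) (σs Y) - w.q)) :=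
    ((siteFree_spin (Or.inl (by simp [hBX, hBY]))).mul (hg.subset (Set.subset_univ _))).mul
      ((siteFree_const _).mul (siteFree_cavOverlap_sub w _ _ _ _))
  refine Eq.trans ?_ (cav_zero_spin_sub_mul w.β w.h w.q w.i h1)
  unfold CavPar.cavAv cavInter
  congr 1
  funext σs
  linear_combination (spin (σs B w.i) * g σs * (cavOverlap w.N w.i (σs X) (σs Y) - w.q)) *
    (spin (σs Y w.i) * spin_mul_self (σs X w.i) - spin (σs X w.i) * spin_mul_self (σs Y w.i))

theorem CavPar.cavAv_interaction_add (hXY : X ≠ Y) (hBX : B ≠ X) (hBY : B ≠ Y) {c : κ}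
    (hcX : c ≠ X) (hcY : c ≠ Y) (hg : SiteFree w.i Set.univ g) :
    w.cavAv 0 (fun σs => (spin (σs X w.i) - spin (σs Y w.i)) * spin (σs B w.i) * g σs *
        cavInter w.N w.q w.i (σs X) (σs c)) +
      w.cavAv 0 (fun σs => (spin (σs X w.i) - spin (σs Y w.i)) * spin (σs B w.i) * g σs *
        cavInter w.N w.q w.i (σs Y) (σs c)) =
      w.respCoef B c * w.cavAv 0 (fun σs => (cavOverlap w.N w.i (σs X) (σs c) -
        cavOverlap w.N w.i (σs Y) (σs c)) * g σs) := by
  have h1 := w.cavAv_one_sub_mul hXY hBX hBY hcX hcY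
    ((siteFree_cavOverlap_sub w w.i Set.univ X c).mul hg)
  have h2 := w.cavAv_one_sub_mul hXY hBX hBY hcX hcY
    ((siteFree_cavOverlap_sub w w.i Set.univ Y c).mul hg)
  have h3 : w.cavAv 0 (fun σs => (cavOverlap w.N w.i (σs X) (σs c) -
        cavOverlap w.N w.i (σs Y) (σs c)) * g σs) =
      w.cavAv 0 (fun σs => (cavOverlap w.N w.i (σs X) (σs c) - w.q) * g σs) -
      w.cavAv 0 (fun σs => (cavOverlap w.N w.i (σs Y) (σs c) - w.q) * g σs) := by
    rw [← w.cavAv_sub]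
    congr 1
    funext σs
    ring
  rw [h3, mul_sub, ← h1, ← h2, sub_eq_add_neg]
  refine congrArg₂ _ ?_ ?_
  · congr 1
    funext σs
    unfold cavInter
    linear_combination (spin (σs B w.i) * g σs * spin (σs c w.i) *
      (cavOverlap w.N w.i (σs X) (σs c) - w.q)) * spin_mul_self (σs X w.i)
  · rw [← neg_one_mul, ← w.cavAv_const_mul]
    congr 1
    funext σs
    unfold cavInter
    linear_combination (-spin (σs B w.i) * g σs * spin (σs c w.i) *
      (cavOverlap w.N w.i (σs Y) (σs c) - w.q)) * spin_mul_self (σs Y w.i)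

theorem cavInter_comm (N : ℕ) (q : ℝ) (i : Fin N) (σ τ : Cfg N) :
    cavInter N q i σ τ = cavInter N q i τ σ := by
  unfold cavInter
  rw [cavOverlap_comm, mul_comm (spin _)]

end Response

section Slope

variable {ι : Type} [DecidableEq ι] [Fintype ι] {x y b : ι}

theorem CavPar.cavSlope_spin_sub_mul (w : CavPar) (hxy : x ≠ y) (hbx : b ≠ x) (hby : b ≠ y)
    {g : (ι → Cfg w.N) → ℝ} (hg : SiteFree w.i Set.univ g) :
    w.cavSlope (fun σs => (spin (σs x w.i) - spin (σs y w.i)) * spin (σs b w.i) * g σs) =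
      ∑ c ∈ (Finset.univ.erase (some (some x))).erase (some (some y)),
        pairWeight ι c * (w.respCoef (some (some b)) c *
          w.cavAv 0 (fun σs => (cavOverlap w.N w.i (σs (some (some x))) (σs c) -
            cavOverlap w.N w.i (σs (some (some y))) (σs c)) *
              g fun l => σs (some (some l)))) := by
  set X : Option (Option ι) := some (some x) with hX
  set Y : Option (Option ι) := some (some y) with hY
  set B : Option (Option ι) := some (some b) with hB
  have hXY : X ≠ Y := fun h => hxy (injective_some_some h)
  have hBX : B ≠ X := fun h => hbx (injective_some_some h)
  have hBY : B ≠ Y := fun h => hby (injective_some_some h)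
  have hg' : SiteFree w.i Set.univ fun σs : Option (Option ι) → Cfg w.N =>
      g fun l => σs (some (some l)) := hg.comp _ fun _ _ => Set.mem_univ _
  set T : Option (Option ι) → Option (Option ι) → ℝ := fun a c =>
    w.cavAv 0 (fun σs => (spin (σs X w.i) - spin (σs Y w.i)) * spin (σs B w.i) *
      (g fun l => σs (some (some l))) * cavInter w.N w.q w.i (σs a) (σs c)) with hT
  have h1 := sum_sum_erase_eq_of_symm hXY (u := fun a => a.elim 0 (repWeight ι))
    (v := repWeight (Option ι)) (T := T)
    (fun a c => by simp only [hT, cavInter_comm w.N w.q w.i])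
    (fun a c haX haY hcX hcY => w.cavAv_interaction_eq_zero hBX hBY haX haY hcX hcY hg')
    (w.cavAv_interaction_pair hBX hBY hg') rfl rfl rfl rfl
  rw [Fintype.sum_option] at h1
  simp only [Option.elim_none, zero_mul, Finset.sum_const_zero, zero_add, Option.elim_some] at h1
  refine h1.trans (Finset.sum_congr rfl fun c hc => ?_)
  obtain ⟨hcY, hc⟩ := Finset.mem_erase.1 hc
  have hcX := Finset.ne_of_mem_erase hc
  rw [← w.cavAv_interaction_add hXY hBX hBY hcX hcY hg']
  rfl

theorem SiteSplit.av_overlap_sub_isBigO {κ : Type} [DecidableEq κ] [Fintype κ] {X Y c : κ}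
    (hcX : c ≠ X) (hcY : c ≠ Y) {F F' : ReplicaFun κ} (hF : SiteSplit F F') :
    (fun w : CavPar =>
      w.cavAv 0 (fun σs => (cavOverlap w.N w.i (σs X) (σs c) -
        cavOverlap w.N w.i (σs Y) (σs c)) * F' w σs) -
      w.av (fun σs => (overlap w.N (σs X) (σs c) - overlap w.N (σs Y) (σs c)) * F w σs)) =O[⊤]
        CavPar.siteErr := by
  obtain ⟨G, hG, hG'⟩ := hF.diff
  have h0 : MomBdd 1 fun w (σs : κ → Cfg w.N) => cavOverlap w.N w.i (σs X) (σs c) -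
      cavOverlap w.N w.i (σs Y) (σs c) :=
    ((momBdd_cavOverlap_sub hcX.symm).sub (momBdd_cavOverlap_sub hcY.symm)).mono
      fun w σs => le_of_eq (by ring_nf)
  have h1 := (h0.mul_zero hF.momBdd_cav).av_sub_cavAv_isBigO.trans sq_scale_isBigO
  have h2 : (fun w : CavPar => w.t w.i * w.av (fun σs => (cavOverlap w.N w.i (σs X) (σs c) -
      cavOverlap w.N w.i (σs Y) (σs c)) * G w σs)) =O[⊤] CavPar.siteErr := by
    have := (isBigO_refl (fun w : CavPar => w.t w.i) ⊤).mul (h0.mul_zero hG).av_isBigO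
    simp only [pow_one] at this
    exact this.trans site_mul_scale_isBigO
  have h3 : (fun w : CavPar => w.r ^ 2 * w.av (fun σs => (spin (σs X w.i) - spin (σs Y w.i)) *
      spin (σs c w.i) * F w σs)) =O[⊤] CavPar.siteErr := by
    have := sq_scale_isBigO.mul (((momBdd_spin_sub X Y).mul_zero (momBdd_spin c)).mul_zero
      hF.momBdd).av_isBigO
    simpa only [pow_zero, mul_one] using this
  refine ((h1.add h2).add h3).neg_left.congr_left fun w => ?_
  have h4 : w.av (fun σs => (overlap w.N (σs X) (σs c) - overlap w.N (σs Y) (σs c)) * F w σs) =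
      w.av (fun σs => (cavOverlap w.N w.i (σs X) (σs c) -
        cavOverlap w.N w.i (σs Y) (σs c)) * F' w σs) +
      w.t w.i * w.av (fun σs => (cavOverlap w.N w.i (σs X) (σs c) -
      cavOverlap w.N w.i (σs Y) (σs c)) * G w σs) +
      w.r ^ 2 * w.av (fun σs => (spin (σs X w.i) - spin (σs Y w.i)) *
      spin (σs c w.i) * F w σs) := by
    rw [← w.av_const_mul, ← w.av_const_mul, ← w.av_add, ← w.av_add]
    congr 1
    funext σs
    rw [overlap_eq _ w.i, overlap_eq _ w.i, w.r_sq, hG' w σs]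
    ring
  rw [h4]
  ring

theorem SiteSplit.comp_some_some {F F' : ReplicaFun ι} (hF : SiteSplit F F') :
    SiteSplit (fun w (σs : Option (Option ι) → Cfg w.N) => F w fun l => σs (some (some l)))
      fun w σs => F' w fun l => σs (some (some l)) := by
  obtain ⟨G, hG, hG'⟩ := hF.diff
  exact ⟨hF.momBdd.comp injective_some_some, hF.momBdd_cav.comp injective_some_some,
    fun w => (hF.siteFree w).comp _ fun _ _ => Set.mem_univ _,
    fun w σs => G w fun l => σs (some (some l)), hG.comp injective_some_some,
    fun w σs => hG' w _⟩

/-- The averages of `R_{x,c} - R_{y,c}` against a function of the `ι`-indexed replicas, where `c`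
may be a new replica. -/
def CavPar.overlapAv (w : CavPar) (x y : ι) (F : (ι → Cfg w.N) → ℝ) (c : Option (Option ι)) : ℝ :=
  w.av fun σs : Option (Option ι) → Cfg w.N =>
    (overlap w.N (σs (some (some x))) (σs c) - overlap w.N (σs (some (some y))) (σs c)) *
      F fun l => σs (some (some l))

theorem SiteSplit.av_spin_sub_mul_cav_isBigO (hxy : x ≠ y) (hbx : b ≠ x) (hby : b ≠ y)
    {F F' : ReplicaFun ι} (hF : SiteSplit F F') :
    (fun w : CavPar =>
      w.av (fun σs => (spin (σs x w.i) - spin (σs y w.i)) * spin (σs b w.i) * F' w σs) -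
      w.β ^ 2 / 2 * ∑ c ∈ (Finset.univ.erase (some (some x))).erase (some (some y)),
        pairWeight ι c * (w.respCoef (some (some b)) c * w.overlapAv x y (F w) c)) =O[⊤]
      CavPar.siteErr := by
  have h1 := (((momBdd_spin_sub x y).mul_zero (momBdd_spin b)).mul_zero
    hF.momBdd_cav).av_expansion.trans sq_scale_isBigO
  have h2 : (fun w : CavPar => w.β ^ 2 / 2 *
      ∑ c ∈ (Finset.univ.erase (some (some x))).erase (some (some y)),
        pairWeight ι c * (w.respCoef (some (some b)) c *
          (w.cavAv 0 (fun σs => (cavOverlap w.N w.i (σs (some (some x))) (σs c) -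
            cavOverlap w.N w.i (σs (some (some y))) (σs c)) *
              F' w fun l => σs (some (some l))) - w.overlapAv x y (F w) c))) =O[⊤]
      CavPar.siteErr := by
    refine bdd_mul_isBigO (B := 1) (fun w => ?_) (IsBigO.fun_sum fun c hc => ?_)
    · have := w.β_pos
      have := w.β_le
      rw [abs_of_nonneg (by positivity)]
      nlinarith
    · obtain ⟨hcY, hc⟩ := Finset.mem_erase.1 hc
      have hcX := Finset.ne_of_mem_erase hc
      exact (bdd_mul_isBigO (fun w => w.abs_respCoef_le _ c)
        (hF.comp_some_some.av_overlap_sub_isBigO hcX hcY)).const_mul_left _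
  refine (h1.add h2).congr_left fun w => ?_
  have h3 : w.cavAv 0 (fun σs => (spin (σs x w.i) - spin (σs y w.i)) * spin (σs b w.i) *
      F' w σs) = 0 := by
    have h4 : SiteFree w.i {x, y} fun σs : ι → Cfg w.N => spin (σs b w.i) * F' w σs :=
      (siteFree_spin (Or.inl (by simp [hbx, hby]))).mul
        ((hF.siteFree w).subset (Set.subset_univ _))
    refine Eq.trans ?_ (cav_zero_spin_sub_mul w.β w.h w.q w.i h4)
    unfold CavPar.cavAv
    congr 1
    funext σs
    ring
  rw [h3, w.cavSlope_spin_sub_mul hxy hbx hby (hF.siteFree w)]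
  simp only [mul_sub, Finset.sum_sub_distrib]
  ring

end Slope

namespace CavPar

/-- The same parameters with another distinguished site. -/
def atSite (w : CavPar) (i : Fin w.N) : CavPar := { w with i := i }

/-- The mean of the weights `t_i`. -/
def meanWeight (w : CavPar) : ℝ := (∑ i, w.t i) / w.N

end CavPar

theorem isBigO_average {a : CavPar → ℝ} (ha : a =O[⊤] CavPar.siteErr) :
    (fun w : CavPar => (∑ i, a (w.atSite i)) / w.N) =O[⊤] fun w => w.r ^ 2 := by
  obtain ⟨C, hC⟩ := isBigO_top.1 ha
  refine isBigO_top_of_abs_le (C := C * 2) (fun w => ?_) fun w => sq_nonneg _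
  have hN := w.N_pos
  rw [abs_div, Nat.abs_cast, w.r_sq, div_eq_mul_one_div, mul_comm (C * 2), mul_comm]
  refine mul_le_mul_of_nonneg_left ?_ (by positivity)
  have h1 : ∑ i, (w.t i ^ 2 + w.r ^ 2) = 2 := by
    rw [Finset.sum_add_distrib, w.t_sq, Finset.sum_const, Finset.card_univ, Fintype.card_fin,
      nsmul_eq_mul, w.r_sq, mul_one_div_cancel hN.ne']
    norm_num
  rw [← h1, Finset.mul_sum]
  refine (Finset.abs_sum_le_sum_abs _ _).trans (Finset.sum_le_sum fun i _ => ?_)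
  have h2 := hC (w.atSite i)
  rw [Real.norm_eq_abs, Real.norm_of_nonneg (CavPar.siteErr_nonneg _)] at h2
  exact h2

theorem isBigO_of_mul_of_half_le {a D e : CavPar → ℝ} (hD : ∀ w, 1 / 2 ≤ D w)
    (h : (fun w => D w * a w) =O[⊤] e) : a =O[⊤] e := by
  refine (bdd_mul_isBigO (a := fun w => (D w)⁻¹) (B := 2) (fun w => ?_) h).congr_left fun w => ?_
  · have h1 := hD w
    rw [abs_of_pos (inv_pos.2 (by linarith))]
    exact inv_le_of_inv_le₀ (by norm_num) (by linarith)
  · exact inv_mul_cancel_left₀ (by linarith [hD w]) _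

section Response

variable {ι : Type} [DecidableEq ι] [Fintype ι] {x y z : ι}

theorem CavPar.overlapAv_some_some (w : CavPar) (x y b : ι) (F : (ι → Cfg w.N) → ℝ) :
    w.overlapAv x y F (some (some b)) =
      w.av fun σs => (overlap w.N (σs x) (σs b) - overlap w.N (σs y) (σs b)) * F σs :=
  nu_comp_injective w.β w.h injective_some_some
    fun σs => (overlap w.N (σs x) (σs b) - overlap w.N (σs y) (σs b)) * F σs

theorem CavPar.overlapAv_eq_of_forall_ne (w : CavPar) (hxz : x ≠ z) (hyz : y ≠ z)
    {F : (ι → Cfg w.N) → ℝ} (hF : ∀ σs τs, (∀ l, l ≠ z → σs l = τs l) → F σs = F τs)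
    {c : Option (Option ι)} (hc : ∀ l, l ≠ z → c ≠ some (some l)) :
    w.overlapAv x y F c = w.overlapAv x y F (some (some z)) := by
  rw [w.overlapAv_some_some]
  have he : Function.Injective fun l : ι => if l = z then c else some (some l) := by
    intro a b hab
    dsimp only at hab
    split_ifs at hab with ha hb hb
    · rw [ha, hb]
    · exact absurd hab (hc b hb)
    · exact absurd hab.symm (hc a ha)
    · exact injective_some_some hab
  refine Eq.trans ?_ (nu_comp_injective w.β w.h he fun σs =>
    (overlap w.N (σs x) (σs z) - overlap w.N (σs y) (σs z)) * F σs)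
  unfold CavPar.overlapAv CavPar.av
  congr 1
  funext σs
  dsimp only
  rw [if_neg hxz, if_neg hyz, if_pos rfl,
    hF (fun l => σs (if l = z then c else some (some l))) (fun l => σs (some (some l)))
      fun l hl => by rw [if_neg hl]]

theorem sum_pairWeight : ∑ c, pairWeight ι c = 0 := by
  unfold pairWeight
  rw [Finset.sum_add_distrib, Fintype.sum_option, sum_repWeight]
  simp only [Option.elim_none, Option.elim_some, sum_repWeight, add_zero]

theorem pairWeight_some_some (b : ι) : pairWeight ι (some (some b)) = 2 := by
  simp only [pairWeight, Option.elim_some, repWeight]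
  norm_num

/-- The family of replica pairs used as test functions, and what is required of its other
factors. -/
structure PairFactor (x y z : ι) (P P' : ReplicaFun ι) : Prop where
  split : SiteSplit P P'
  siteFree : ∀ w, SiteFree w.i {x, y} (P w)
  atSite : ∀ (w : CavPar) (i : Fin w.N), P (w.atSite i) = P w
  spare : ∀ w σs τs, (∀ l, l ≠ z → σs l = τs l) → P w σs = P w τs

/-- The test function `S ^ k * P`. -/
def pairTest (x y : ι) (P : ReplicaFun ι) (k : ℕ) : ReplicaFun ι := fun w σs =>
  spinDiff w (σs x) (σs y) ^ k * P w σs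

theorem CavPar.sum_av_site (w : CavPar) (x y b : ι) (F : (ι → Cfg w.N) → ℝ) :
    (∑ i, w.av fun σs => (spin (σs x i) - spin (σs y i)) * spin (σs b i) * F σs) / w.N =
      w.overlapAv x y F (some (some b)) := by
  rw [w.overlapAv_some_some, div_eq_inv_mul]
  have h1 : (∑ i, w.av fun σs => (spin (σs x i) - spin (σs y i)) * spin (σs b i) * F σs) =
      w.av fun σs => ∑ i, (spin (σs x i) - spin (σs y i)) * spin (σs b i) * F σs :=
    (nu_sum _ _ _ _).symm
  rw [h1, ← w.av_const_mul]
  congr 1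
  funext σs
  rw [← Finset.sum_mul]
  simp only [sub_mul, Finset.sum_sub_distrib, overlap]
  ring

variable {P P' : ReplicaFun ι}

theorem PairFactor.overlapAv_isBigO (hP : PairFactor x y z P P') (hxy : x ≠ y) {b : ι}
    (hbx : b ≠ x) (hby : b ≠ y) (k : ℕ) :
    (fun w : CavPar => w.overlapAv x y (pairTest x y P (k + 1) w) (some (some b)) -
      (k + 1) * w.linResp * (w.meanWeight * w.av (pairTest x y P k w)) -
      w.β ^ 2 / 2 * ∑ c ∈ (Finset.univ.erase (some (some x))).erase (some (some y)),
        pairWeight ι c * (w.respCoef (some (some b)) c *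
          w.overlapAv x y (pairTest x y P (k + 1) w) c)) =O[⊤] fun w => w.r ^ 2 := by
  have hS : SiteSplit (pairTest x y P (k + 1)) fun w σs =>
      spinDiffCav w w.i (σs x) (σs y) ^ (k + 1) * P' w σs :=
    ((siteSplit_spinDiff hxy).pow _).mul hP.split
  have h1 := isBigO_average ((av_spin_sub_mul_isBigO hxy hbx hby hP.split hP.siteFree k).add
    (hS.av_spin_sub_mul_cav_isBigO hxy hbx hby))
  refine h1.congr_left fun w => ?_
  have hN := w.N_pos
  have hat : ∀ (i : Fin w.N) (k : ℕ), pairTest x y P k (w.atSite i) = pairTest x y P k w := by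
    intro i k
    funext σs
    exact congrArg (spinDiff w (σs x) (σs y) ^ k * ·) (congrFun (hP.atSite w i) σs)
  rw [← w.sum_av_site x y b]
  have h2 : ∀ i : Fin w.N, ((w.atSite i).av (fun σs =>
        (spin (σs x (w.atSite i).i) - spin (σs y (w.atSite i).i)) * spin (σs b (w.atSite i).i) *
        (spinDiff (w.atSite i) (σs x) (σs y) ^ (k + 1) * P (w.atSite i) σs)) -
      (w.atSite i).av (fun σs => (spin (σs x (w.atSite i).i) - spin (σs y (w.atSite i).i)) *
        spin (σs b (w.atSite i).i) *
        (spinDiffCav (w.atSite i) (w.atSite i).i (σs x) (σs y) ^ (k + 1) * P' (w.atSite i) σs)) -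
      (k + 1) * (w.atSite i).linResp * ((w.atSite i).t (w.atSite i).i *
        (w.atSite i).av (fun σs => spinDiff (w.atSite i) (σs x) (σs y) ^ k *
          P (w.atSite i) σs)) +
      ((w.atSite i).av (fun σs => (spin (σs x (w.atSite i).i) - spin (σs y (w.atSite i).i)) *
        spin (σs b (w.atSite i).i) *
        (spinDiffCav (w.atSite i) (w.atSite i).i (σs x) (σs y) ^ (k + 1) * P' (w.atSite i) σs)) -
      (w.atSite i).β ^ 2 / 2 *
        ∑ c ∈ (Finset.univ.erase (some (some x))).erase (some (some y)),
        pairWeight ι c * ((w.atSite i).respCoef (some (some b)) c * (w.atSite i).overlapAv x y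
          (pairTest x y P (k + 1) (w.atSite i)) c))) =
      w.av (fun σs => (spin (σs x i) - spin (σs y i)) * spin (σs b i) *
        pairTest x y P (k + 1) w σs) -
      (k + 1) * w.linResp * (w.t i * w.av (pairTest x y P k w)) -
      w.β ^ 2 / 2 * ∑ c ∈ (Finset.univ.erase (some (some x))).erase (some (some y)),
        pairWeight ι c * (w.respCoef (some (some b)) c *
          w.overlapAv x y (pairTest x y P (k + 1) w) c) := by
    intro i
    have e1 : (w.atSite i).av (fun σs =>
        (spin (σs x (w.atSite i).i) - spin (σs y (w.atSite i).i)) * spin (σs b (w.atSite i).i) *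
        (spinDiff (w.atSite i) (σs x) (σs y) ^ (k + 1) * P (w.atSite i) σs)) =
        w.av (fun σs => (spin (σs x i) - spin (σs y i)) * spin (σs b i) *
          pairTest x y P (k + 1) w σs) := by
      rw [hP.atSite w i]; rfl
    have e2 : (w.atSite i).av (fun σs => spinDiff (w.atSite i) (σs x) (σs y) ^ k *
          P (w.atSite i) σs) = w.av (pairTest x y P k w) := by
      rw [hP.atSite w i]; rfl
    rw [e1, e2, hat i]
    change _ - (k + 1) * w.linResp * (w.t i * _) + (_ - w.β ^ 2 / 2 * ∑ c ∈ _,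
        pairWeight ι c * (w.respCoef (some (some b)) c *
          w.overlapAv x y (pairTest x y P (k + 1) w) c)) = _
    ring
  rw [Finset.sum_congr rfl fun i _ => h2 i, Finset.sum_sub_distrib, Finset.sum_sub_distrib,
    ← Finset.mul_sum, ← Finset.sum_mul, Finset.sum_const, Finset.card_univ, Fintype.card_fin,
    nsmul_eq_mul, CavPar.meanWeight]
  field_simp

/-- The response of the overlaps to a replica pair. -/
def CavPar.overlapResp (w : CavPar) : ℝ :=
  w.linResp * w.meanWeight / (1 - w.β ^ 2 * (1 - 4 * w.q + 3 * w.mag 4))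

theorem CavPar.half_le_one_sub (w : CavPar) {c : ℝ} (hc : c ≤ 8) : 1 / 2 ≤ 1 - w.β ^ 2 * c := by
  have h1 := w.β_pos
  have h2 := w.β_le
  have h3 : w.β ^ 2 ≤ 1 / 64 := by nlinarith
  nlinarith [sq_nonneg w.β]

theorem PairFactor.overlapAv_sub_isBigO (hP : PairFactor x y z P P') (hxy : x ≠ y) (hxz : x ≠ z)
    (hyz : y ≠ z) {b : ι} (hbx : b ≠ x) (hby : b ≠ y) (k : ℕ) :
    (fun w : CavPar => w.overlapAv x y (pairTest x y P (k + 1) w) (some (some b)) -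
      (k + 1) * (w.overlapResp * w.av (pairTest x y P k w))) =O[⊤] fun w => w.r ^ 2 := by
  set s : Finset (Option (Option ι)) :=
    (Finset.univ.erase (some (some x))).erase (some (some y)) with hs
  set A : CavPar → Option (Option ι) → ℝ :=
    fun w c => w.overlapAv x y (pairTest x y P (k + 1) w) c with hA
  set K : CavPar → ℝ := fun w => (k + 1) * w.linResp * (w.meanWeight *
    w.av (pairTest x y P k w)) with hK
  set W : CavPar → ℝ := fun w => K w + w.β ^ 2 / 2 * ((w.q - w.mag 4) *
    ∑ c ∈ s, pairWeight ι c * A w c) with hW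
  have hmag : ∀ w : CavPar, -1 ≤ w.mag 4 ∧ w.mag 4 ≤ 1 := fun w => abs_le.1 (w.abs_mag_le 4)
  have hmem : ∀ b : ι, b ≠ x → b ≠ y → (some (some b)) ∈ s := fun b hbx hby =>
    Finset.mem_erase.2 ⟨fun h => hby (injective_some_some h),
      Finset.mem_erase.2 ⟨fun h => hbx (injective_some_some h), Finset.mem_univ _⟩⟩
  have hD1 : ∀ w : CavPar, 1 / 2 ≤ 1 - w.β ^ 2 * (1 - 2 * w.q + w.mag 4) := fun w =>
    w.half_le_one_sub (by linarith [(hmag w).2, w.q_nonneg])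
  have hD2 : ∀ w : CavPar, 1 / 2 ≤ 1 - w.β ^ 2 * (1 - 4 * w.q + 3 * w.mag 4) := fun w =>
    w.half_le_one_sub (by linarith [(hmag w).2, w.q_nonneg])
  have h1 : ∀ b : ι, b ≠ x → b ≠ y →
      (fun w : CavPar => (1 - w.β ^ 2 * (1 - 2 * w.q + w.mag 4)) * A w (some (some b)) - W w)
        =O[⊤] fun w => w.r ^ 2 := by
    intro b hbx hby
    refine (hP.overlapAv_isBigO hxy hbx hby k).congr_left fun w => ?_
    have h2 : ∑ c ∈ s, pairWeight ι c * (w.respCoef (some (some b)) c * A w c) =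
        (w.q - w.mag 4) * ∑ c ∈ s, pairWeight ι c * A w c +
          2 * (1 - 2 * w.q + w.mag 4) * A w (some (some b)) := by
      rw [← Finset.add_sum_erase _ _ (hmem b hbx hby),
        ← Finset.add_sum_erase s (fun c => pairWeight ι c * A w c) (hmem b hbx hby), mul_add,
        Finset.mul_sum]
      have h3 : ∀ c ∈ s.erase (some (some b)),
          pairWeight ι c * (w.respCoef (some (some b)) c * A w c) =
            (w.q - w.mag 4) * (pairWeight ι c * A w c) := by
        intro c hc
        rw [CavPar.respCoef, if_neg (Finset.ne_of_mem_erase hc)]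
        ring
      rw [Finset.sum_congr rfl h3, pairWeight_some_some, CavPar.respCoef, if_pos rfl]
      ring
    change A w (some (some b)) - K w - w.β ^ 2 / 2 *
      ∑ c ∈ s, pairWeight ι c * (w.respCoef (some (some b)) c * A w c) = _
    rw [h2]
    simp only [hW]
    ring
  have h4 : ∀ b : ι, b ≠ x → b ≠ y →
      (fun w : CavPar => A w (some (some b)) - A w (some (some z))) =O[⊤] fun w => w.r ^ 2 :=
    fun b hbx hby => isBigO_of_mul_of_half_le hD1
      (((h1 b hbx hby).sub (h1 z hxz.symm hyz.symm)).congr_left fun w => by ring)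
  have hspare : ∀ w : CavPar, ∀ c : Option (Option ι), (∀ l, l ≠ z → c ≠ some (some l)) →
      A w c = A w (some (some z)) := fun w c hc =>
    w.overlapAv_eq_of_forall_ne hxz hyz (fun σs τs h => by
      simp only [pairTest]
      rw [h x hxz, h y hyz, hP.spare w σs τs h]) hc
  have h5 : ∀ c ∈ s, (fun w : CavPar => A w c - A w (some (some z))) =O[⊤] fun w => w.r ^ 2 := by
    intro c hc
    rcases c with _ | _ | c
    · refine (isBigO_zero _ _).congr_left fun w => ?_
      rw [hspare w none fun l _ => by simp, sub_self]
    · refine (isBigO_zero _ _).congr_left fun w => ?_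
      rw [hspare w (some none) fun l _ => by simp, sub_self]
    · obtain ⟨hcy, hc⟩ := Finset.mem_erase.1 hc
      exact h4 c (fun h => Finset.ne_of_mem_erase hc (by rw [h])) (fun h => hcy (by rw [h]))
  have h6 : ∑ c ∈ s, pairWeight ι c = -4 := by
    have h7 := sum_pairWeight (ι := ι)
    have hY : some (some y) ∈ (Finset.univ : Finset (Option (Option ι))).erase (some (some x)) :=
      Finset.mem_erase.2 ⟨fun h => hxy (injective_some_some h).symm, Finset.mem_univ _⟩
    rw [← Finset.add_sum_erase _ _ (Finset.mem_univ (some (some x))),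
      ← Finset.add_sum_erase _ _ hY, pairWeight_some_some, pairWeight_some_some] at h7
    linarith
  have h8 : (fun w : CavPar => (1 - w.β ^ 2 * (1 - 4 * w.q + 3 * w.mag 4)) *
      A w (some (some z)) - K w) =O[⊤] fun w => w.r ^ 2 := by
    have h9 : (fun w : CavPar => w.β ^ 2 / 2 * (w.q - w.mag 4) *
        ∑ c ∈ s, pairWeight ι c * (A w c - A w (some (some z)))) =O[⊤] fun w => w.r ^ 2 := by
      refine bdd_mul_isBigO (B := 2) (fun w => ?_)
        (IsBigO.fun_sum fun c hc => (h5 c hc).const_mul_left _)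
      rw [abs_mul, abs_of_nonneg (by positivity)]
      have hb : w.β ^ 2 / 2 ≤ 1 := by nlinarith [w.β_pos, w.β_le]
      have hq : |w.q - w.mag 4| ≤ 2 :=
        abs_le.2 ⟨by linarith [(hmag w).2, w.q_nonneg], by linarith [(hmag w).1, w.q_le]⟩
      exact (mul_le_mul hb hq (abs_nonneg _) zero_le_one).trans_eq (one_mul _)
    refine ((h1 z hxz.symm hyz.symm).add h9).congr_left fun w => ?_
    simp only [hW, mul_sub, Finset.sum_sub_distrib]
    rw [← Finset.sum_mul, h6]
    ring
  have h10 : (fun w : CavPar => A w (some (some z)) -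
      K w / (1 - w.β ^ 2 * (1 - 4 * w.q + 3 * w.mag 4))) =O[⊤] fun w => w.r ^ 2 :=
    isBigO_of_mul_of_half_le hD2 (h8.congr_left fun w => by
      rw [mul_sub, mul_div_cancel₀ _ (by linarith [hD2 w])])
  refine ((h4 b hbx hby).add h10).congr_left fun w => ?_
  simp only [hK, hA, CavPar.overlapResp]
  ring

end Response

section PairProduct

variable {m : ℕ} {κ : Type}

/-- A product of powers of the `S_l`. -/
def pairProd (s : Finset κ) (f : κ → Fin m) (e : κ → ℕ) : ReplicaFun (RepIx m 2) := fun w σs =>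
  ∏ j ∈ s, spinDiff w (σs (Sum.inl (f j, 0))) (σs (Sum.inl (f j, 1))) ^ e j

theorem inl_zero_ne_inl_one (l : Fin m) :
    (Sum.inl (l, 0) : RepIx m 2) ≠ Sum.inl (l, 1) := by
  simp

theorem pairFactor_pairProd {s : Finset κ} {f : κ → Fin m} {l : Fin m} (hf : ∀ j ∈ s, f j ≠ l)
    (e : κ → ℕ) :
    PairFactor (Sum.inl (l, 0) : RepIx m 2) (Sum.inl (l, 1)) (Sum.inr 0) (pairProd s f e)
      fun w σs => ∏ j ∈ s,
        spinDiffCav w w.i (σs (Sum.inl (f j, 0))) (σs (Sum.inl (f j, 1))) ^ e j where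
  split := SiteSplit.prod fun j _ => (siteSplit_spinDiff (inl_zero_ne_inl_one (f j))).pow _
  siteFree w := by
    have h1 : ∀ j ∈ s, ∀ a : Fin 2, (Sum.inl (f j, a) : RepIx m 2) ∉
        ({Sum.inl (l, 0), Sum.inl (l, 1)} : Set (RepIx m 2)) := by
      intro j hj a ha
      rcases ha with ha | ha <;> exact hf j hj (congrArg Prod.fst (Sum.inl_injective ha))
    refine SiteFree.prod fun j hj => SiteFree.pow (SiteFree.sum fun i _ => ?_) _
    exact (siteFree_const _).mul
      ((siteFree_spin (Or.inl (h1 j hj 0))).sub (siteFree_spin (Or.inl (h1 j hj 1))))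
  atSite _ _ := rfl
  spare w σs τs h := by
    refine Finset.prod_congr rfl fun j _ => ?_
    rw [h _ Sum.inl_ne_inr, h _ Sum.inl_ne_inr]

end PairProduct

theorem prod_eq_pow_mul_prod_erase {n : ℕ} (a : Fin (n + 1) → ℝ) (kvec : Fin (n + 1) → ℕ)
    (k : ℕ) : ∏ j, a j ^ (Function.update kvec 0 k j) =
      a 0 ^ k * ∏ j ∈ Finset.univ.erase 0, a j ^ kvec j := by
  rw [← Finset.mul_prod_erase _ _ (Finset.mem_univ 0), Function.update_self]
  congr 1
  exact Finset.prod_congr rfl fun j hj => by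
    rw [Function.update_of_ne (Finset.ne_of_mem_erase hj)]

theorem overlapAv_pair_sub_isBigO {n : ℕ} (kvec : Fin (n + 1) → ℕ) (k : ℕ)
    {b b' : RepIx (n + 2) 2} (hb0 : b ≠ Sum.inl (1, 0)) (hb1 : b ≠ Sum.inl (1, 1))
    (hb0' : b' ≠ Sum.inl (0, 0)) (hb1' : b' ≠ Sum.inl (0, 1)) :
    (fun w : CavPar =>
      w.av (fun σs : RepIx (n + 2) 2 → Cfg w.N =>
        (overlap w.N (σs (Sum.inl (1, 0))) (σs b) - overlap w.N (σs (Sum.inl (1, 1))) (σs b)) *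
          SbarS w.N (n + 2) 2 w.t σs 1 ^ (k + 1) *
          ∏ j ∈ Finset.univ.erase (0 : Fin (n + 1)),
            SbarS w.N (n + 2) 2 w.t σs j.succ ^ kvec j) -
      (k + 1) * w.av (fun σs : RepIx (n + 2) 2 → Cfg w.N =>
        (overlap w.N (σs (Sum.inl (0, 0))) (σs b') - overlap w.N (σs (Sum.inl (0, 1))) (σs b')) *
          SbarS w.N (n + 2) 2 w.t σs 0 * SbarS w.N (n + 2) 2 w.t σs 1 ^ k *
          ∏ j ∈ Finset.univ.erase (0 : Fin (n + 1)),
            SbarS w.N (n + 2) 2 w.t σs j.succ ^ kvec j)) =O[⊤] fun w => w.r ^ 2 := by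
  have hP := pairFactor_pairProd (m := n + 2) (s := Finset.univ.erase (0 : Fin (n + 1)))
    (f := Fin.succ) (l := 1) (fun j hj h => Finset.ne_of_mem_erase hj
      (Fin.succ_injective _ (h.trans Fin.succ_zero_eq_one.symm))) kvec
  have hP' := pairFactor_pairProd (m := n + 2) (s := (Finset.univ : Finset (Fin (n + 1))))
    (f := Fin.succ) (l := 0) (fun j _ => Fin.succ_ne_zero j) (Function.update kvec 0 k)
  have h1 := hP.overlapAv_sub_isBigO (inl_zero_ne_inl_one _) Sum.inl_ne_inr Sum.inl_ne_inr
    hb0 hb1 k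
  have h2 := hP'.overlapAv_sub_isBigO (inl_zero_ne_inl_one _) Sum.inl_ne_inr Sum.inl_ne_inr
    hb0' hb1' 0
  refine (h1.sub (h2.const_mul_left (k + 1))).congr_left fun w => ?_
  have hprod : ∀ σs : RepIx (n + 2) 2 → Cfg w.N,
      pairProd Finset.univ Fin.succ (Function.update kvec 0 k) w σs =
        SbarS w.N (n + 2) 2 w.t σs 1 ^ k * ∏ j ∈ Finset.univ.erase (0 : Fin (n + 1)),
            SbarS w.N (n + 2) 2 w.t σs j.succ ^ kvec j := fun σs =>
    prod_eq_pow_mul_prod_erase (fun j => SbarS w.N (n + 2) 2 w.t σs j.succ) kvec k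
  have e1 : pairTest (Sum.inl (0, 0)) (Sum.inl (0, 1))
        (pairProd Finset.univ Fin.succ (Function.update kvec 0 k)) 0 w =
      pairTest (Sum.inl (1, 0)) (Sum.inl (1, 1))
        (pairProd (Finset.univ.erase 0) Fin.succ kvec) k w := by
    funext σs
    simp only [pairTest]
    rw [hprod, pow_zero, one_mul]
    rfl
  have e2 : ∀ σs : RepIx (n + 2) 2 → Cfg w.N, pairTest (Sum.inl (0, 0)) (Sum.inl (0, 1))
        (pairProd Finset.univ Fin.succ (Function.update kvec 0 k)) (0 + 1) w σs =
      SbarS w.N (n + 2) 2 w.t σs 0 * (SbarS w.N (n + 2) 2 w.t σs 1 ^ k *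
        ∏ j ∈ Finset.univ.erase (0 : Fin (n + 1)),
            SbarS w.N (n + 2) 2 w.t σs j.succ ^ kvec j) := by
    intro σs
    simp only [pairTest]
    rw [hprod, zero_add, pow_one]
    rfl
  have e3 : ∀ σs : RepIx (n + 2) 2 → Cfg w.N, pairTest (Sum.inl (1, 0)) (Sum.inl (1, 1))
        (pairProd (Finset.univ.erase 0) Fin.succ kvec) (k + 1) w σs =
      SbarS w.N (n + 2) 2 w.t σs 1 ^ (k + 1) * ∏ j ∈ Finset.univ.erase (0 : Fin (n + 1)),
            SbarS w.N (n + 2) 2 w.t σs j.succ ^ kvec j := fun _ => rfl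
  rw [e1, w.overlapAv_some_some, w.overlapAv_some_some]
  simp only [e2, e3, ← mul_assoc]
  push_cast
  ring

end Proof

/-- identity (31) in Step 3: for `k₁ ≥ 4` and any replica indices
`m′ ∉ {1(1),2(1)}`, `m″ ∉ {1(0),2(0)}`,
`ν((R_{1(1),m′} − R_{2(1),m′}) S₁^{k₁−3} ∏_{l≥2} S_l^{k_l})
  = (k₁−3)·ν((R_{1(0),m″} − R_{2(0),m″}) S₀ S₁^{k₁−4} ∏_{l≥2} S_l^{k_l}) + O(N⁻¹)`.
The pair `0` carries `S₀`, the pair `j+1` carries `S_{j+1}` with exponent `kvec j`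
(so `k₁ = kvec 0`), and there are two extra replicas available for `m′, m″`. -/
theorem stmt16 :
    ∃ β₀ : ℝ, 0 < β₀ ∧
      ∀ n : ℕ, ∀ kvec : Fin (n + 1) → ℕ, 4 ≤ kvec 0 →
        ∃ K : ℝ, ∀ β : ℝ, 0 < β → β < β₀ → ∀ M : ℕ, ∀ h : ℝ, 0 ≤ h →
          ∀ t : Fin (M + 1) → ℝ, (∑ i, t i ^ 2) = 1 →
            ∀ m' m'' : RepIx (n + 2) 2,
              m' ≠ Sum.inl (1, 0) → m' ≠ Sum.inl (1, 1) →
              m'' ≠ Sum.inl (0, 0) → m'' ≠ Sum.inl (0, 1) →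
              |nu (M + 1) β h
                  (fun σs : RepIx (n + 2) 2 → Cfg (M + 1) =>
                    (overlap (M + 1) (σs (Sum.inl (1, 0))) (σs m') -
                        overlap (M + 1) (σs (Sum.inl (1, 1))) (σs m')) *
                      SbarS (M + 1) (n + 2) 2 t σs 1 ^ (kvec 0 - 3) *
                      ∏ j ∈ Finset.univ.erase (0 : Fin (n + 1)),
                        SbarS (M + 1) (n + 2) 2 t σs j.succ ^ kvec j) -
                ((kvec 0 : ℝ) - 3) *
                  nu (M + 1) β h
                    (fun σs : RepIx (n + 2) 2 → Cfg (M + 1) =>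
                      (overlap (M + 1) (σs (Sum.inl (0, 0))) (σs m'') -
                          overlap (M + 1) (σs (Sum.inl (0, 1))) (σs m'')) *
                        SbarS (M + 1) (n + 2) 2 t σs 0 *
                        SbarS (M + 1) (n + 2) 2 t σs 1 ^ (kvec 0 - 4) *
                        ∏ j ∈ Finset.univ.erase (0 : Fin (n + 1)),
                          SbarS (M + 1) (n + 2) 2 t σs j.succ ^ kvec j)| ≤
                K / (M + 1) := by
  refine ⟨betaZero, betaZero_pos, fun n kvec hk => ?_⟩
  obtain ⟨k, hk⟩ := Nat.exists_eq_add_of_le hk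
  have hC : ∀ p : RepIx (n + 2) 2 × RepIx (n + 2) 2, ∃ C : ℝ,
      p.1 ≠ Sum.inl (1, 0) → p.1 ≠ Sum.inl (1, 1) →
      p.2 ≠ Sum.inl (0, 0) → p.2 ≠ Sum.inl (0, 1) → ∀ w : CavPar,
        |w.av (fun σs : RepIx (n + 2) 2 → Cfg w.N =>
          (overlap w.N (σs (Sum.inl (1, 0))) (σs p.1) -
              overlap w.N (σs (Sum.inl (1, 1))) (σs p.1)) *
            SbarS w.N (n + 2) 2 w.t σs 1 ^ (k + 1) *
            ∏ j ∈ Finset.univ.erase (0 : Fin (n + 1)),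
              SbarS w.N (n + 2) 2 w.t σs j.succ ^ kvec j) -
        (k + 1) * w.av (fun σs : RepIx (n + 2) 2 → Cfg w.N =>
          (overlap w.N (σs (Sum.inl (0, 0))) (σs p.2) -
              overlap w.N (σs (Sum.inl (0, 1))) (σs p.2)) *
            SbarS w.N (n + 2) 2 w.t σs 0 * SbarS w.N (n + 2) 2 w.t σs 1 ^ k *
            ∏ j ∈ Finset.univ.erase (0 : Fin (n + 1)),
              SbarS w.N (n + 2) 2 w.t σs j.succ ^ kvec j)| ≤ C * (1 / w.N) := by
    intro p
    by_cases hp : (p.1 ≠ Sum.inl (1, 0) ∧ p.1 ≠ Sum.inl (1, 1)) ∧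
      p.2 ≠ Sum.inl (0, 0) ∧ p.2 ≠ Sum.inl (0, 1)
    · obtain ⟨C, hC⟩ := Asymptotics.isBigO_top.1
        (overlapAv_pair_sub_isBigO kvec k hp.1.1 hp.1.2 hp.2.1 hp.2.2)
      refine ⟨C, fun _ _ _ _ w => ?_⟩
      have h1 := hC w
      rwa [Real.norm_eq_abs, Real.norm_of_nonneg (sq_nonneg _), w.r_sq] at h1
    · exact ⟨0, fun h1 h2 h3 h4 => absurd ⟨⟨h1, h2⟩, h3, h4⟩ hp⟩
  choose C hC using hC
  refine ⟨∑ p, |C p|, fun β hβ hβ' M h _ t ht m' m'' h1 h2 h3 h4 => ?_⟩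
  obtain ⟨q, hq0, hq1, hq⟩ := exists_fixedPoint β h
  have h5 := hC (m', m'') h1 h2 h3 h4 ⟨M, β, h, q, t, 0, hβ, hβ', hq0, hq1, hq, ht⟩
  have h6 : C (m', m'') ≤ ∑ p, |C p| := (le_abs_self _).trans
    (Finset.single_le_sum (f := fun p => |C p|) (fun _ _ => abs_nonneg _) (Finset.mem_univ _))
  rw [show kvec 0 - 3 = k + 1 by omega, show kvec 0 - 4 = k by omega,
    show (kvec 0 : ℝ) - 3 = k + 1 by rw [hk]; push_cast; ring]
  refine h5.trans ?_
  rw [mul_one_div]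
  change _ / ((M + 1 : ℕ) : ℝ) ≤ _
  rw [Nat.cast_succ]
  gcongr

end
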